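/- arXiv:2005.14384 — 3 statements merged into one kernel-verified Lean document; each statement's English description precedes it below -/
import Mathlib

section
/- For every integer r ≥ 8 there exists n₀ = n₀(r) such that for all even n > n₀ the following holds: every A ⊆ [n] with |A| ≥ ⌈n/2⌉ + 1 satisfies g(A, r) ≤ r^{⌈n/2⌉ + 1}, with equality if and only if A = I₂ := [n/2, n]. -/
open Finset

/-- The number of rainbow sum-free `r`-colorings of a finite set `A` of positive
integers. -/
noncomputable def numRSF (r : ℕ) (A : Finset ℕ) : ℕ :=
  Nat.card {f : ↥A → Fin r //
    ∀ x y z : ↥A, (x : ℕ) + (y : ℕ) = (z : ℕ) →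
      ¬(f x ≠ f y ∧ f x ≠ f z ∧ f y ≠ f z)}

/-- The number of restrictions to `C` of the colorings in `F`. -/
noncomputable def traceCard {r : ℕ} (F : Set (ℕ → Fin r)) (C : Finset ℕ) : ℕ :=
  ((fun (f : ℕ → Fin r) (c : C) => f c) '' F).ncard

/-- The colorings of `ℕ` without a rainbow sum inside `A`. -/
def rainbowSumFree (r : ℕ) (A : Finset ℕ) : Set (ℕ → Fin r) :=
  {f | ∀ x ∈ A, ∀ y ∈ A, ∀ z ∈ A, x + y = z → ¬(f x ≠ f y ∧ f x ≠ f z ∧ f y ≠ f z)}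

section traceCard

variable {r : ℕ} {F G : Set (ℕ → Fin r)} {C D : Finset ℕ}

lemma traceCard_mono (h : F ⊆ G) : traceCard F C ≤ traceCard G C :=
  Set.ncard_le_ncard (Set.image_mono h) (Set.toFinite _)

lemma traceCard_union_family : traceCard (F ∪ G) C ≤ traceCard F C + traceCard G C := by
  unfold traceCard
  rw [Set.image_union]
  exact Set.ncard_union_le _ _

lemma traceCard_le_of_code {α : Type*} (φ : (ℕ → Fin r) → α) (t : Finset α)
    (hφ : ∀ f ∈ F, φ f ∈ t)
    (hinj : ∀ f ∈ F, ∀ g ∈ F, φ f = φ g → ∀ c ∈ C, f c = g c) :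
    traceCard F C ≤ t.card := by
  classical
  rcases F.eq_empty_or_nonempty with rfl | hne
  · simp [traceCard]
  have : Nonempty (ℕ → Fin r) := ⟨hne.some⟩
  have key : ∀ x ∈ (fun (f : ℕ → Fin r) (c : C) => f c) '' F,
      ∃ f ∈ F, (fun c : C => f c) = x := fun x hx => hx
  choose! e he1 he2 using key
  rw [← Set.ncard_coe_finset t]
  refine Set.ncard_le_ncard_of_injOn (fun x => φ (e x)) (fun x hx => hφ _ (he1 x hx)) ?_
    (Set.toFinite _)
  intro x hx y hy hxy
  rw [← he2 x hx, ← he2 y hy]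
  funext c
  exact hinj _ (he1 x hx) _ (he1 y hy) hxy c c.2

lemma traceCard_subset (h : C ⊆ D) : traceCard F C ≤ traceCard F D := by
  classical
  have := traceCard_le_of_code (F := F) (C := C) (fun f (d : D) => f d)
    ((Set.toFinite ((fun (f : ℕ → Fin r) (d : D) => f d) '' F)).toFinset)
    (fun f hf => by simpa using ⟨f, hf, rfl⟩)
    (fun f _ g _ hfg c hc => congrFun hfg ⟨c, h hc⟩)
  rwa [← Set.ncard_eq_toFinset_card] at this

lemma traceCard_union : traceCard F (C ∪ D) ≤ traceCard F C * traceCard F D := by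
  classical
  have := traceCard_le_of_code (F := F) (C := C ∪ D)
    (fun f => ((fun c : C => f c), (fun d : D => f d)))
    ((Set.toFinite ((fun (f : ℕ → Fin r) (c : C) => f c) '' F)).toFinset ×ˢ
      (Set.toFinite ((fun (f : ℕ → Fin r) (d : D) => f d) '' F)).toFinset)
    (fun f hf => by
      rw [mem_product]
      simp only [Set.Finite.mem_toFinset]
      exact ⟨⟨f, hf, rfl⟩, ⟨f, hf, rfl⟩⟩)
    (fun f _ g _ hfg c hc => by
      rw [Prod.mk.injEq] at hfg
      rcases mem_union.1 hc with hc | hc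
      · exact congrFun hfg.1 ⟨c, hc⟩
      · exact congrFun hfg.2 ⟨c, hc⟩)
  rwa [card_product, ← Set.ncard_eq_toFinset_card, ← Set.ncard_eq_toFinset_card] at this

lemma traceCard_empty : traceCard F ∅ ≤ 1 := by
  simpa using traceCard_le_of_code (F := F) (C := ∅) (fun _ => ()) {()} (by simp) (by simp)

lemma traceCard_singleton {i : ℕ} (P : Finset (Fin r)) (h : ∀ f ∈ F, f i ∈ P) :
    traceCard F {i} ≤ P.card :=
  traceCard_le_of_code (fun f => f i) P h (fun f _ g _ hfg c hc => by
    rw [mem_singleton.1 hc]; exact hfg)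

lemma traceCard_pair {i j : ℕ} (P : Finset (Fin r × Fin r)) (h : ∀ f ∈ F, (f i, f j) ∈ P) :
    traceCard F {i, j} ≤ P.card :=
  traceCard_le_of_code (fun f => (f i, f j)) P h (fun f _ g _ hfg c hc => by
    rw [Prod.mk.injEq] at hfg
    rcases mem_insert.1 hc with rfl | hc
    · exact hfg.1
    · rw [mem_singleton.1 hc]; exact hfg.2)

lemma traceCard_biUnion (s : Finset ℕ) (t : ℕ → Finset ℕ) (k : ℕ)
    (h : ∀ i ∈ s, traceCard F (t i) ≤ k) : traceCard F (s.biUnion t) ≤ k ^ s.card := by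
  classical
  induction s using Finset.induction_on with
  | empty => simpa using traceCard_empty
  | insert a s ha ih =>
    rw [biUnion_insert, card_insert_of_notMem ha, pow_succ']
    exact traceCard_union.trans (Nat.mul_le_mul (h a (mem_insert_self _ _))
      (ih fun i hi => h i (mem_insert_of_mem hi)))

lemma traceCard_le_pow_of_singleton (k : ℕ) (h : ∀ i ∈ C, traceCard F {i} ≤ k) :
    traceCard F C ≤ k ^ C.card := by
  simpa using traceCard_biUnion C (fun i => {i}) k h

lemma traceCard_le_pow : traceCard F C ≤ r ^ C.card :=
  traceCard_le_pow_of_singleton r fun i _ => by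
    simpa using traceCard_singleton (F := F) (i := i) univ (fun _ _ => mem_univ _)

lemma traceCard_le_sum (x : ℕ) :
    traceCard F C ≤ ∑ c : Fin r, traceCard {f ∈ F | f x = c} C := by
  classical
  have h : ∀ s : Finset (Fin r),
      traceCard {f ∈ F | f x ∈ s} C ≤ ∑ c ∈ s, traceCard {f ∈ F | f x = c} C := by
    intro s
    induction s using Finset.induction_on with
    | empty => simp [traceCard]
    | insert a s ha ih =>
      rw [sum_insert ha]
      refine (traceCard_mono ?_).trans (traceCard_union_family.trans (Nat.add_le_add_left ih _))
      rintro f ⟨hf, hfx⟩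
      rcases mem_insert.1 hfx with h | h
      · exact Or.inl ⟨hf, h⟩
      · exact Or.inr ⟨hf, h⟩
  simpa using h univ

/-- Fixing the colors on `S` costs a factor `r ^ |S|`. -/
lemma exists_fixed_on (S : Finset ℕ) (F : Set (ℕ → Fin r)) (hF : F.Nonempty) :
    ∃ F' ⊆ F, (∃ g : ℕ → Fin r, ∀ f ∈ F', ∀ z ∈ S, f z = g z) ∧
      traceCard F C ≤ r ^ S.card * traceCard F' C := by
  classical
  induction S using Finset.induction_on with
  | empty => exact ⟨F, subset_rfl, ⟨hF.some, by simp⟩, by simp⟩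
  | insert a S ha ih =>
    obtain ⟨F', hF', ⟨g, hg⟩, hle⟩ := ih
    obtain ⟨c, hc⟩ : ∃ c : Fin r, traceCard F' C ≤ r * traceCard {f ∈ F' | f a = c} C := by
      by_contra! hcon
      have h1 := traceCard_le_sum (F := F') (C := C) a
      have hr : 0 < r := (hF.some 0).pos
      have : Nonempty (Fin r) := ⟨hF.some 0⟩
      have h2 : ∑ c : Fin r, r * traceCard {f ∈ F' | f a = c} C
          < ∑ _c : Fin r, traceCard F' C :=
        sum_lt_sum_of_nonempty univ_nonempty fun c _ => hcon c
      rw [← mul_sum] at h2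
      simp only [sum_const, card_univ, Fintype.card_fin, smul_eq_mul] at h2
      exact absurd h1 (not_le.2 (Nat.lt_of_mul_lt_mul_left h2))
    refine ⟨{f ∈ F' | f a = c}, fun f hf => hF' hf.1, ⟨Function.update g a c, ?_⟩, ?_⟩
    · rintro f ⟨hf, hfa⟩ z hz
      rcases mem_insert.1 hz with rfl | hz
      · simpa using hfa
      · rw [Function.update_of_ne (ne_of_mem_of_not_mem hz ha), hg f hf z hz]
    · rw [card_insert_of_notMem ha, pow_succ, mul_assoc]
      exact hle.trans (Nat.mul_le_mul_left _ hc)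

end traceCard

lemma card_nonrainbow_pairs {r : ℕ} (c : Fin r) :
    (univ.filter fun p : Fin r × Fin r => ¬(p.1 ≠ p.2 ∧ p.1 ≠ c ∧ p.2 ≠ c)).card
      ≤ 3 * r - 2 := by
  classical
  have hsub : (univ.filter fun p : Fin r × Fin r => ¬(p.1 ≠ p.2 ∧ p.1 ≠ c ∧ p.2 ≠ c)) ⊆
      (univ.image fun a : Fin r => (a, a)) ∪ (((univ.erase c).image fun b => (c, b)) ∪
        ((univ.erase c).image fun a => (a, c))) := by
    rintro ⟨a, b⟩ h
    simp only [mem_filter, mem_union, mem_image, mem_erase, mem_univ, Prod.mk.injEq] at h ⊢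
    by_cases h1 : a = b
    · exact Or.inl ⟨a, trivial, rfl, h1⟩
    · by_cases h2 : a = c
      · exact Or.inr (Or.inl ⟨b, ⟨fun h => h1 (h2.trans h.symm), trivial⟩, h2.symm, rfl⟩)
      · by_cases h3 : b = c
        · exact Or.inr (Or.inr ⟨a, ⟨h2, trivial⟩, rfl, h3.symm⟩)
        · exact absurd ⟨h1, h2, h3⟩ h.2
  have h1 := card_le_card hsub
  have h2 := card_union_le (univ.image fun a : Fin r => (a, a))
    (((univ.erase c).image fun b => (c, b)) ∪ ((univ.erase c).image fun a => (a, c)))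
  have h3 := card_union_le ((univ.erase c).image fun b => (c, b))
    ((univ.erase c).image fun a => (a, c))
  have h4 := card_image_le (s := univ) (f := fun a : Fin r => (a, a))
  have h5 := card_image_le (s := univ.erase c) (f := fun b => (c, b))
  have h6 := card_image_le (s := univ.erase c) (f := fun a => (a, c))
  have h7 := c.pos
  rw [card_erase_of_mem (mem_univ _)] at h5 h6
  simp only [card_univ, Fintype.card_fin] at h4 h5 h6
  omega

/-- Disjoint pairs that form Schur triples with a common `x` restrict the colorings. -/
lemma traceCard_matching {r : ℕ} {A C Q : Finset ℕ} {F : Set (ℕ → Fin r)}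
    (hF : F ⊆ rainbowSumFree r A) (hCA : C ⊆ A) {x : ℕ} (hx : x ∈ C) (g : ℕ → ℕ)
    (hQ : ∀ y ∈ Q, y ∈ C ∧ g y ∈ C ∧ y ≠ x ∧ g y ≠ x ∧ g y ∉ Q)
    (hg : Set.InjOn g Q) (hsum : ∀ y ∈ Q, y + x = g y ∨ y + g y = x) :
    traceCard F C * r ^ (2 * Q.card) ≤ r ^ C.card * (3 * r - 2) ^ Q.card := by
  classical
  set U := Q.biUnion fun y => {y, g y} with hU
  have hUeq : U = Q ∪ Q.image g := by
    ext a
    simp only [hU, mem_biUnion, mem_union, mem_image, mem_insert, mem_singleton]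
    constructor
    · rintro ⟨y, hy, rfl | rfl⟩
      · exact Or.inl hy
      · exact Or.inr ⟨y, hy, rfl⟩
    · rintro (hy | ⟨y, hy, rfl⟩)
      · exact ⟨a, hy, Or.inl rfl⟩
      · exact ⟨y, hy, Or.inr rfl⟩
  have hdisj : Disjoint Q (Q.image g) := by
    rw [disjoint_right]
    intro a ha
    obtain ⟨y, hy, rfl⟩ := mem_image.1 ha
    exact (hQ y hy).2.2.2.2
  have hUcard : U.card = 2 * Q.card := by
    rw [hUeq, card_union_of_disjoint hdisj, card_image_of_injOn hg]; ring
  have hxU : x ∉ U := by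
    rw [hUeq]
    simp only [mem_union, mem_image, not_or, not_exists, not_and]
    exact ⟨fun h => (hQ x h).2.2.1 rfl, fun y hy h => (hQ y hy).2.2.2.1 h⟩
  have hUC : insert x U ⊆ C := by
    intro a ha
    rcases mem_insert.1 ha with rfl | ha
    · exact hx
    · rw [hUeq] at ha
      rcases mem_union.1 ha with ha | ha
      · exact (hQ a ha).1
      · obtain ⟨y, hy, rfl⟩ := mem_image.1 ha
        exact (hQ y hy).2.1
  have hrest : (C \ insert x U).card + (2 * Q.card + 1) = C.card := by
    rw [← hUcard, ← card_insert_of_notMem hxU]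
    exact card_sdiff_add_card_eq_card hUC
  have hcol : ∀ c : Fin r, traceCard {f ∈ F | f x = c} C ≤
      (3 * r - 2) ^ Q.card * r ^ (C \ insert x U).card := by
    intro c
    have h1 : traceCard {f ∈ F | f x = c} {x} ≤ 1 := by
      simpa using traceCard_singleton (F := {f ∈ F | f x = c}) {c}
        (fun f hf => mem_singleton.2 hf.2)
    have h2 : traceCard {f ∈ F | f x = c} U ≤ (3 * r - 2) ^ Q.card := by
      refine traceCard_biUnion _ _ _ fun y hy => ?_
      refine (traceCard_pair _ ?_).trans (card_nonrainbow_pairs c)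
      rintro f ⟨hf, hfx⟩
      rw [mem_filter]
      refine ⟨mem_univ _, ?_⟩
      have hy' := hQ y hy
      have hyA := hCA hy'.1
      have hgA := hCA hy'.2.1
      rintro ⟨h1, h2, h3⟩
      rcases hsum y hy with h | h
      · exact hF hf y hyA x (hCA hx) (g y) hgA h
          ⟨fun e => h2 (e.trans hfx), h1, fun e => h3 (e.symm.trans hfx)⟩
      · exact hF hf y hyA (g y) hgA x (hCA hx) h
          ⟨h1, fun e => h2 (e.trans hfx), fun e => h3 (e.trans hfx)⟩
    have h3 : traceCard {f ∈ F | f x = c} (C \ insert x U) ≤ r ^ (C \ insert x U).card :=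
      traceCard_le_pow
    have h4 : C = ({x} ∪ U) ∪ (C \ insert x U) := by
      rw [← insert_eq, union_sdiff_of_subset hUC]
    calc traceCard {f ∈ F | f x = c} C
        ≤ traceCard {f ∈ F | f x = c} ({x} ∪ U) *
            traceCard {f ∈ F | f x = c} (C \ insert x U) := by
          conv_lhs => rw [h4]
          exact traceCard_union
      _ ≤ (traceCard {f ∈ F | f x = c} {x} * traceCard {f ∈ F | f x = c} U) *
            traceCard {f ∈ F | f x = c} (C \ insert x U) :=
          Nat.mul_le_mul_right _ traceCard_union
      _ ≤ (1 * (3 * r - 2) ^ Q.card) * r ^ (C \ insert x U).card := by gcongr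
      _ = _ := by rw [one_mul]
  have hle : traceCard F C ≤ r * ((3 * r - 2) ^ Q.card * r ^ (C \ insert x U).card) := by
    refine (traceCard_le_sum x).trans ((sum_le_sum fun c _ => hcol c).trans ?_)
    simp
  calc traceCard F C * r ^ (2 * Q.card)
      ≤ r * ((3 * r - 2) ^ Q.card * r ^ (C \ insert x U).card) * r ^ (2 * Q.card) := by gcongr
    _ = r ^ ((C \ insert x U).card + (2 * Q.card + 1)) * (3 * r - 2) ^ Q.card := by ring
    _ = _ := by rw [hrest]

/-- A dense set `B ⊆ A ⊆ [1, 2m]` such that every element of `A` is only rarely a difference or a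
sum of elements of `B` forces `A` to avoid `[1, 2m/3)` as soon as `A` has more than `m` elements. -/
lemma two_mul_le_three_mul_of_sparse {m P : ℕ} {A B : Finset ℕ} (hA : A ⊆ Icc 1 (2 * m))
    (hBA : B ⊆ A) (hP : 2 ≤ P) (hmP : 1000 * P ≤ m) (hB : m ≤ B.card + P)
    (hdiff : ∀ x ∈ A, (B.filter fun b => b + x ∈ B).card ≤ P)
    (hadd : ∀ x ∈ A, (B.filter fun b => b < x ∧ x - b ∈ B).card ≤ P)
    (hcard : m + 1 ≤ A.card) : ∀ x ∈ A, 2 * m ≤ 3 * x := by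
  classical
  have hBI : B ⊆ Icc 1 (2 * m) := hBA.trans hA
  have hne : A.Nonempty := card_pos.1 (by omega)
  set a := A.min' hne with ha_def
  have ha : a ∈ A := A.min'_mem hne
  have hmin : ∀ x ∈ A, a ≤ x := fun x hx => A.min'_le x hx
  suffices h : 2 * m ≤ 3 * a from fun x hx => h.trans (Nat.mul_le_mul_left 3 (hmin x hx))
  have ha1 : 1 ≤ a := (mem_Icc.1 (hA ha)).1
  by_contra! hlt
  -- the translates `B` and `B - a` almost cover `[0, 2m]`
  have hcover : ((range (2 * m + 1)).filter fun u => u ∉ B ∧ u + a ∉ B).card ≤ 3 * P + 1 := by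
    have hinj : (B.image fun b => b - a).card = B.card :=
      card_image_of_injOn fun b hb c hc h => by
        have h1 := hmin b (hBA hb)
        have h2 := hmin c (hBA hc)
        have h : b - a = c - a := h
        omega
    have h1 : (B ∩ B.image fun b => b - a).card ≤ P := by
      refine (card_le_card ?_).trans (hdiff a ha)
      intro u hu
      obtain ⟨h1, h2⟩ := mem_inter.1 hu
      obtain ⟨b, hb, rfl⟩ := mem_image.1 h2
      have := hmin b (hBA hb)
      exact mem_filter.2 ⟨h1, by rwa [Nat.sub_add_cancel this]⟩
    have h2 := card_union_add_card_inter B (B.image fun b => b - a)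
    have h3 : ((range (2 * m + 1)).filter fun u => u ∉ B ∧ u + a ∉ B).card +
        (B ∪ B.image fun b => b - a).card ≤ (range (2 * m + 1)).card := by
      rw [← card_union_of_disjoint]
      · refine card_le_card (union_subset (filter_subset _ _) (union_subset ?_ ?_))
        · intro b hb
          have := mem_Icc.1 (hBI hb)
          exact mem_range.2 (by omega)
        · intro u hu
          obtain ⟨b, hb, rfl⟩ := mem_image.1 hu
          have := mem_Icc.1 (hBI hb)
          exact mem_range.2 (by omega)
      · rw [disjoint_left]
        intro u hu hu'
        obtain ⟨-, h1, h2⟩ := mem_filter.1 hu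
        rcases mem_union.1 hu' with h | h
        · exact h1 h
        · obtain ⟨b, hb, rfl⟩ := mem_image.1 h
          rw [Nat.sub_add_cancel (hmin b (hBA hb))] at h2
          exact h2 hb
    rw [card_range] at h3
    omega
  have hfull : ((Ico a (2 * a)).filter fun u => u ∉ B).card ≤ 3 * P + 1 := by
    refine le_trans ?_ hcover
    refine card_le_card_of_injOn (fun u => u - a) ?_ ?_
    · intro u hu
      obtain ⟨h1, h2⟩ := mem_filter.1 hu
      have h1 := mem_Ico.1 h1
      change u - a ∈ _
      refine mem_filter.2 ⟨mem_range.2 (by omega), fun h => ?_, ?_⟩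
      · have := hmin _ (hBA h)
        omega
      · rwa [Nat.sub_add_cancel h1.1]
    · intro u hu v hv h
      have h1 := mem_Ico.1 (mem_filter.1 hu).1
      have h2 := mem_Ico.1 (mem_filter.1 hv).1
      simp only at h
      omega
  -- sums of two elements of `[a, 2a)` are popular
  have hsums : ∀ lo hi x, a ≤ lo → hi ≤ 2 * a → a ≤ x - hi + 1 → x - lo < 2 * a → hi ≤ x →
      lo + (7 * P + 2) < hi → x ∉ A := by
    intro lo hi x hlo hhi hlo' hhi' hhx hlen hx
    have h1 := hadd x hx
    have h2 : (Ico lo hi).card ≤ (B.filter fun b => b < x ∧ x - b ∈ B).card +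
        (((Ico a (2 * a)).filter fun u => u ∉ B).card +
          (((Ico a (2 * a)).filter fun u => u ∉ B).image fun u => x - u).card) := by
      refine le_trans (card_le_card ?_) ((card_union_le _ _).trans
        (Nat.add_le_add_left (card_union_le _ _) _))
      intro b hb
      have hb := mem_Ico.1 hb
      simp only [mem_union, mem_filter, mem_image, mem_Ico]
      by_cases hbB : b ∈ B
      · by_cases hxb : x - b ∈ B
        · exact Or.inl ⟨hbB, by omega, hxb⟩
        · exact Or.inr (Or.inr ⟨x - b, ⟨by omega, hxb⟩, by omega⟩)
      · exact Or.inr (Or.inl ⟨by omega, hbB⟩)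
    have h3 := card_image_le (s := (Ico a (2 * a)).filter fun u => u ∉ B) (f := fun u => x - u)
    rw [Nat.card_Ico] at h2
    omega
  have hasmall : a ≤ 24 * P := by
    by_contra! hbig
    have h1 : Icc (2 * a + 7 * P + 3) (3 * a - 7 * P - 5) ⊆
        (range (2 * m + 1)).filter fun u => u ∉ B ∧ u + a ∉ B := by
      intro u hu
      have hu := mem_Icc.1 hu
      refine mem_filter.2 ⟨mem_range.2 (by omega), fun h => ?_, fun h => ?_⟩
      · exact hsums a (u - a + 1) u le_rfl (by omega) (by omega) (by omega) (by omega) (by omega)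
          (hBA h)
      · exact hsums (u - a + 1) (2 * a) (u + a) (by omega) le_rfl (by omega) (by omega) (by omega)
          (by omega) (hBA h)
    have h2 := (card_le_card h1).trans hcover
    rw [Nat.card_Icc] at h2
    omega
  -- `B` has density one half on initial segments
  have hdens : ∀ y ≤ 2 * m, y ≤ 2 * (B.filter fun b => b ≤ y).card + 27 * P := by
    intro y hy
    have h1 : (B.filter fun b => b ≤ y).card + (B.filter fun b => ¬ b ≤ y).card = B.card :=
      card_filter_add_card_filter_not _
    set H := B.filter fun b => ¬ b ≤ y with hH
    have hinj : (H.image fun b => b - a).card = H.card :=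
      card_image_of_injOn fun b hb c hc h => by
        have h1 := hmin b (hBA (mem_filter.1 hb).1)
        have h2 := hmin c (hBA (mem_filter.1 hc).1)
        have h : b - a = c - a := h
        omega
    have h2 : (H ∩ H.image fun b => b - a).card ≤ P := by
      refine (card_le_card ?_).trans (hdiff a ha)
      intro u hu
      obtain ⟨h1, h2⟩ := mem_inter.1 hu
      obtain ⟨b, hb, rfl⟩ := mem_image.1 h2
      have := hmin b (hBA (mem_filter.1 hb).1)
      exact mem_filter.2 ⟨(mem_filter.1 h1).1, by
        rw [Nat.sub_add_cancel this]; exact (mem_filter.1 hb).1⟩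
    have h3 := card_union_add_card_inter H (H.image fun b => b - a)
    have h4 : (H ∪ H.image fun b => b - a).card ≤ (Icc (y + 1 - a) (2 * m)).card := by
      refine card_le_card (union_subset ?_ ?_)
      · intro b hb
        obtain ⟨hb, hby⟩ := mem_filter.1 hb
        have := mem_Icc.1 (hBI hb)
        exact mem_Icc.2 (by omega)
      · intro u hu
        obtain ⟨b, hb, rfl⟩ := mem_image.1 hu
        obtain ⟨hb, hby⟩ := mem_filter.1 hb
        have := mem_Icc.1 (hBI hb)
        exact mem_Icc.2 (by omega)
    rw [Nat.card_Icc] at h4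
    omega
  -- translation by a small element of `A` almost exchanges `B` and its complement
  have hunc : ∀ x ∈ A, ((Icc 1 (2 * m)).filter fun u => u ∉ B ∧ u + x ∉ B).card ≤ x + 3 * P := by
    intro x hx
    have hinj : (B.image fun b => b + x).card = B.card :=
      card_image_of_injective _ fun b c h => by simpa using h
    have h1 : (B.image (fun b => b + x) ∩ B).card ≤ P := by
      refine le_trans ?_ (hdiff x hx)
      refine card_le_card_of_injOn (fun u => u - x) ?_ ?_
      · intro u hu
        obtain ⟨h1, h2⟩ := mem_inter.1 hu
        obtain ⟨b, hb, rfl⟩ := mem_image.1 h1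
        simp only [coe_filter, Set.mem_ofPred_eq, Nat.add_sub_cancel]
        exact ⟨hb, h2⟩
      · intro u hu v hv h
        obtain ⟨b, hb, rfl⟩ := mem_image.1 (mem_inter.1 hu).1
        obtain ⟨c, hc, rfl⟩ := mem_image.1 (mem_inter.1 hv).1
        simp only at h
        omega
    have h2 := card_union_add_card_inter (B.image fun b => b + x) B
    set V := (Icc 1 (2 * m)).filter fun u => u ∉ B ∧ u + x ∉ B with hV
    have hVinj : (V.image fun b => b + x).card = V.card :=
      card_image_of_injective _ fun b c h => by simpa using h
    have h3 : (V.image fun b => b + x).card + (B.image (fun b => b + x) ∪ B).card ≤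
        (Icc 1 (2 * m + x)).card := by
      rw [← card_union_of_disjoint]
      · refine card_le_card (union_subset ?_ (union_subset ?_ ?_))
        · intro u hu
          obtain ⟨b, hb, rfl⟩ := mem_image.1 hu
          have := mem_Icc.1 (mem_filter.1 hb).1
          exact mem_Icc.2 (by omega)
        · intro u hu
          obtain ⟨b, hb, rfl⟩ := mem_image.1 hu
          have := mem_Icc.1 (hBI hb)
          exact mem_Icc.2 (by omega)
        · intro b hb
          have := mem_Icc.1 (hBI hb)
          exact mem_Icc.2 (by omega)
      · rw [disjoint_left]
        intro u hu hu'
        obtain ⟨v, hv, rfl⟩ := mem_image.1 hu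
        obtain ⟨-, h1, h2⟩ := mem_filter.1 hv
        rcases mem_union.1 hu' with h | h
        · obtain ⟨b, hb, hbv⟩ := mem_image.1 h
          have : b = v := by simpa using hbv
          exact h1 (this ▸ hb)
        · exact h2 h
    rw [Nat.card_Icc] at h3
    omega
  -- differences of small elements of `B` are almost periods of `B`
  have hper : ∀ b ∈ B, ∀ b' ∈ B, b' < b → b ≤ 300 * P →
      (B.filter fun v => v + (b - b') ∉ B).card ≤ (b - b') + 304 * P := by
    intro b hb b' hb' hlt hle
    have h1 : (B.filter fun v => v + (b - b') ∉ B) ⊆ (B.filter fun v => v + b ∈ B) ∪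
        ((((Icc 1 (2 * m)).filter fun u => u ∉ B ∧ u + b' ∉ B).image fun u => u - (b - b')) ∪
          Ioc (2 * m - (b - b')) (2 * m)) := by
      intro v hv
      obtain ⟨hv, hvn⟩ := mem_filter.1 hv
      have hv1 := mem_Icc.1 (hBI hv)
      simp only [mem_union, mem_filter, mem_image, mem_Icc, mem_Ioc]
      by_cases h1 : v + b ∈ B
      · exact Or.inl ⟨hv, h1⟩
      · by_cases h2 : 2 * m - (b - b') < v
        · exact Or.inr (Or.inr ⟨h2, hv1.2⟩)
        · refine Or.inr (Or.inl ⟨v + (b - b'), ⟨by omega, hvn, ?_⟩, by omega⟩)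
          rwa [show v + (b - b') + b' = v + b by omega]
    have h2 := card_le_card h1
    have h3 := card_union_le (B.filter fun v => v + b ∈ B)
      ((((Icc 1 (2 * m)).filter fun u => u ∉ B ∧ u + b' ∉ B).image fun u => u - (b - b')) ∪
          Ioc (2 * m - (b - b')) (2 * m))
    have h4 := card_union_le
      (((Icc 1 (2 * m)).filter fun u => u ∉ B ∧ u + b' ∉ B).image fun u => u - (b - b'))
      (Ioc (2 * m - (b - b')) (2 * m))
    have h5 := card_image_le (s := (Icc 1 (2 * m)).filter fun u => u ∉ B ∧ u + b' ∉ B)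
      (f := fun u => u - (b - b'))
    have h6 := hunc b' (hBA hb')
    have h7 := hdiff b (hBA hb)
    rw [Nat.card_Ioc] at h4
    omega
  have hpop : ∀ x, (B.filter fun v => v + x ∉ B).card ≤ 900 * P → x ∉ A := by
    intro x hx hxA
    have h1 := hdiff x hxA
    have h2 : (B.filter fun b => b + x ∈ B).card + (B.filter fun b => ¬ b + x ∈ B).card = B.card :=
      card_filter_add_card_filter_not _
    omega
  -- hence small even numbers are not in `A`
  have hsmall : ∀ u, 1 ≤ u → 2 * u ≤ 100 * P → 2 * u ∉ A := by
    intro u hu1 hu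
    set B₁ := B.filter fun b => b ≤ 300 * P with hB₁
    have hB₁card : 300 * P ≤ 2 * B₁.card + 27 * P := hdens (300 * P) (by omega)
    by_cases h1 : ∃ b ∈ B₁, b + u ∈ B₁
    · obtain ⟨b, hb, hbu⟩ := h1
      obtain ⟨hb, -⟩ := mem_filter.1 hb
      obtain ⟨hbu, hbu'⟩ := mem_filter.1 hbu
      have hp := hper (b + u) hbu b hb (by omega) hbu'
      rw [Nat.add_sub_cancel_left] at hp
      apply hpop
      have hsub : (B.filter fun v => v + 2 * u ∉ B) ⊆ (B.filter fun v => v + u ∉ B) ∪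
          ((B.filter fun v => v + u ∉ B).image fun v => v - u) := by
        intro v hv
        obtain ⟨hv, hvn⟩ := mem_filter.1 hv
        simp only [mem_union, mem_filter, mem_image]
        by_cases h : v + u ∈ B
        · refine Or.inr ⟨v + u, ⟨h, ?_⟩, by omega⟩
          rwa [show v + u + u = v + 2 * u by ring]
        · exact Or.inl ⟨hv, h⟩
      have h2 := (card_le_card hsub).trans (card_union_le _ _)
      have h3 := card_image_le (s := B.filter fun v => v + u ∉ B) (f := fun v => v - u)
      omega
    · by_cases h2 : ∃ b ∈ B₁, b + 2 * u ∈ B₁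
      · obtain ⟨b, hb, hbu⟩ := h2
        obtain ⟨hb, -⟩ := mem_filter.1 hb
        obtain ⟨hbu, hbu'⟩ := mem_filter.1 hbu
        have hp := hper (b + 2 * u) hbu b hb (by omega) hbu'
        rw [Nat.add_sub_cancel_left] at hp
        exact hpop _ (by omega)
      · exfalso
        push Not at h1 h2
        have e1 : (B₁.image fun b => b + u).card = B₁.card :=
          card_image_of_injective _ fun b c h => by simpa using h
        have e2 : (B₁.image fun b => b + 2 * u).card = B₁.card :=
          card_image_of_injective _ fun b c h => by simpa using h
        have d1 : Disjoint B₁ (B₁.image fun b => b + u) := by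
          rw [disjoint_right]
          intro v hv
          obtain ⟨b, hb, rfl⟩ := mem_image.1 hv
          exact h1 b hb
        have d2 : Disjoint (B₁ ∪ B₁.image fun b => b + u) (B₁.image fun b => b + 2 * u) := by
          rw [disjoint_right]
          intro v hv hv'
          obtain ⟨b, hb, rfl⟩ := mem_image.1 hv
          rcases mem_union.1 hv' with h | h
          · exact h2 b hb h
          · obtain ⟨c, hc, hcb⟩ := mem_image.1 h
            have : c = b + u := by omega
            exact h1 b hb (this ▸ hc)
        have h3 : ((B₁ ∪ B₁.image fun b => b + u) ∪ B₁.image fun b => b + 2 * u).card ≤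
            (Icc 1 (300 * P + 2 * u)).card := by
          refine card_le_card ?_
          intro v hv
          simp only [mem_union, mem_image] at hv
          rw [mem_Icc]
          rcases hv with (h | ⟨b, h, rfl⟩) | ⟨b, h, rfl⟩ <;>
          · have h4 := (mem_filter.1 h).2
            have h5 := mem_Icc.1 (hBI (mem_filter.1 h).1)
            omega
        rw [card_union_of_disjoint d2, card_union_of_disjoint d1, e1, e2, Nat.card_Icc] at h3
        omega
  -- hence `A` has no even element: the smallest one would be a popular sum of odd numbers
  have hodd : ∀ e, Even e → e ∉ A := by
    intro e
    induction e using Nat.strong_induction_on with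
    | _ e ih =>
      intro he heA
      obtain ⟨k, hk⟩ := he
      have he1 := mem_Icc.1 (hA heA)
      have hebig : 100 * P < e := by
        by_contra! h
        exact hsmall k (by omega) (by omega) (by rwa [two_mul, ← hk])
      have h1 := hdens (e - 1) (by omega)
      have hoddB : ∀ b ∈ B, b < e → b % 2 = 1 := by
        intro b hb hbe
        by_contra h
        exact ih b hbe (Nat.even_iff.2 (by omega)) (hBA hb)
      set O := (range k).image fun i => 2 * i + 1 with hO
      have hOcard : O.card = k := by
        rw [hO, card_image_of_injective _ fun i j h => by simpa using h, card_range]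
      have hBO : (B.filter fun b => b ≤ e - 1) ⊆ O := by
        intro b hb
        obtain ⟨hb, hbe⟩ := mem_filter.1 hb
        have := hoddB b hb (by omega)
        exact mem_image.2 ⟨b / 2, mem_range.2 (by omega), by omega⟩
      have hmiss := card_sdiff_add_card_eq_card hBO
      have h2 : O ⊆ (B.filter fun b => b < e ∧ e - b ∈ B) ∪
          ((O \ B.filter fun b => b ≤ e - 1) ∪
            (O \ B.filter fun b => b ≤ e - 1).image fun u => e - u) := by
        intro u hu
        obtain ⟨i, hi, hiu⟩ := mem_image.1 hu
        have hi := mem_range.1 hi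
        have heu : e - u ∈ O := mem_image.2 ⟨k - 1 - i, mem_range.2 (by omega), by omega⟩
        simp only [mem_union, mem_filter, mem_image, mem_sdiff]
        by_cases huB : u ∈ B
        · by_cases hxu : e - u ∈ B
          · exact Or.inl ⟨huB, by omega, hxu⟩
          · exact Or.inr (Or.inr ⟨e - u, ⟨heu, fun h => hxu h.1⟩, by omega⟩)
        · exact Or.inr (Or.inl ⟨hu, fun h => huB h.1⟩)
      have h3 := (card_le_card h2).trans ((card_union_le _ _).trans
        (Nat.add_le_add_left (card_union_le _ _) _))
      have h4 := card_image_le (s := O \ B.filter fun b => b ≤ e - 1) (f := fun u => e - u)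
      have h5 := hadd e heA
      omega
  have hAodd : A ⊆ (range m).image fun i => 2 * i + 1 := by
    intro x hx
    have h1 := mem_Icc.1 (hA hx)
    have h2 : x % 2 = 1 := by
      by_contra h
      exact hodd x (Nat.even_iff.2 (by omega)) hx
    exact mem_image.2 ⟨x / 2, mem_range.2 (by omega), by omega⟩
  have := (card_le_card hAodd).trans card_image_le
  rw [card_range] at this
  omega

/-- A weighted Kleitman-Winston container argument: if `G` is a conflict relation on pairs
(vertex, color), then after a small loss in the number of colorings, all remaining vertices take
their colors from palettes of small conflict degree. -/
lemma exists_container {r : ℕ} (A : Finset ℕ) (G : ℕ × Fin r → ℕ × Fin r → Prop) (D q : ℕ)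
    (hD : 1 ≤ D) (W : Finset (ℕ × Fin r)) :
    ∀ (F : Set (ℕ → Fin r)) (T : Finset ℕ),
      (∀ f ∈ F, ∀ u v, G u v → f u.1 = u.2 → f v.1 ≠ v.2) →
      (∀ f ∈ F, ∀ i ∈ A, i ∉ T → (i, f i) ∈ W) →
      ∃ F' ⊆ F, ∃ W' ⊆ W, ∃ T' : Finset ℕ, ∃ t : ℕ, D * t ≤ W.card ∧ T'.card ≤ T.card + t ∧
        (∀ f ∈ F', ∀ i ∈ A, i ∉ T' → (i, f i) ∈ W') ∧
        (∀ v ∈ W', Set.ncard {u | u ∈ W' ∧ G v u} ≤ D) ∧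
        (q - 1) ^ W.card * traceCard F A ≤ q ^ (t + W.card) * traceCard F' A := by
  classical
  induction W using Finset.strongInduction with
  | H W ih =>
    intro F T hG hW
    by_cases hdeg : ∀ v ∈ W, Set.ncard {u | u ∈ W ∧ G v u} ≤ D
    · refine ⟨F, subset_rfl, W, subset_rfl, T, 0, by simp, by simp, hW, hdeg, ?_⟩
      rw [zero_add]
      exact Nat.mul_le_mul_right _ (Nat.pow_le_pow_left (Nat.sub_le _ _) _)
    push Not at hdeg
    obtain ⟨v, hv, hvD⟩ := hdeg
    set Y := {f ∈ F | f v.1 = v.2} with hY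
    set N := {f ∈ F | f v.1 ≠ v.2} with hN
    have hsplit : traceCard F A ≤ traceCard Y A + traceCard N A := by
      refine (traceCard_mono ?_).trans traceCard_union_family
      intro f hf
      by_cases h : f v.1 = v.2
      · exact Or.inl ⟨hf, h⟩
      · exact Or.inr ⟨hf, h⟩
    by_cases hbig : traceCard F A ≤ q * traceCard Y A
    · have hWc : {u | u ∈ W ∧ G v u} = (W.filter fun u => G v u : Finset _) := by
        ext u; simp
      rw [hWc, Set.ncard_coe_finset] at hvD
      have hcard : (W.filter fun u => ¬ G v u).card + D ≤ W.card := by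
        have := card_filter_add_card_filter_not (s := W) (fun u => G v u)
        omega
      have hss : (W.filter fun u => ¬ G v u) ⊂ W := by
        refine (filter_subset _ _).ssubset_of_ne fun h => ?_
        rw [h] at hcard
        omega
      obtain ⟨F', hF', W', hW', T', t, h1, h2, h3, h4, h5⟩ := ih _ hss Y (insert v.1 T)
        (fun f hf => hG f hf.1) (by
          intro f hf i hi hiT
          rw [mem_insert, not_or] at hiT
          refine mem_filter.2 ⟨hW f hf.1 i hi hiT.2, fun h => ?_⟩
          exact hG f hf.1 _ _ h hf.2 rfl)
      refine ⟨F', fun f hf => (hF' hf).1, W', hW'.trans (filter_subset _ _), T', t + 1, ?_, ?_,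
        h3, h4, ?_⟩
      · rw [mul_add, mul_one]; omega
      · have := card_insert_le v.1 T
        omega
      · obtain ⟨d, hd⟩ := Nat.exists_eq_add_of_le (Nat.le_of_add_right_le hcard)
        rw [hd]
        calc (q - 1) ^ ((W.filter fun u => ¬ G v u).card + d) * traceCard F A
            ≤ (q - 1) ^ ((W.filter fun u => ¬ G v u).card + d) * (q * traceCard Y A) := by gcongr
          _ = (q - 1) ^ d * q * ((q - 1) ^ (W.filter fun u => ¬ G v u).card * traceCard Y A) := by
              ring
          _ ≤ q ^ d * q * (q ^ (t + (W.filter fun u => ¬ G v u).card) * traceCard F' A) := by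
              gcongr
              exact Nat.sub_le _ _
          _ = _ := by ring
    · have hN' : (q - 1) * traceCard F A ≤ q * traceCard N A := by
        rcases Nat.eq_zero_or_pos q with rfl | hq
        · simp
        · obtain ⟨p, rfl⟩ : ∃ p, q = p + 1 := ⟨q - 1, by omega⟩
          simp only [Nat.add_sub_cancel]
          nlinarith
      obtain ⟨F', hF', W', hW', T', t, h1, h2, h3, h4, h5⟩ := ih _ (erase_ssubset hv) N T
        (fun f hf => hG f hf.1) (by
          intro f hf i hi hiT
          refine mem_erase.2 ⟨fun h => hf.2 ?_, hW f hf.1 i hi hiT⟩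
          rw [← h])
      have hc := card_erase_add_one hv
      refine ⟨F', fun f hf => (hF' hf).1, W', hW'.trans (erase_subset _ _), T', t, by omega, h2,
        h3, h4, ?_⟩
      rw [← hc]
      calc (q - 1) ^ ((W.erase v).card + 1) * traceCard F A
          = (q - 1) ^ (W.erase v).card * ((q - 1) * traceCard F A) := by ring
        _ ≤ (q - 1) ^ (W.erase v).card * (q * traceCard N A) := by gcongr
        _ = q * ((q - 1) ^ (W.erase v).card * traceCard N A) := by ring
        _ ≤ q * (q ^ (t + (W.erase v).card) * traceCard F' A) := by gcongr
        _ = _ := by ring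

/-- With `q = 2 * n` and degree bound `n * q`, the loss of the container argument is `4 ^ h`. -/
lemma container_loss {n h w t a b : ℕ} (hn : 1 ≤ n) (hw : w ≤ n * h) (ht : n * (2 * n) * t ≤ w)
    (hab : (2 * n - 1) ^ w * a ≤ (2 * n) ^ (t + w) * b) : a ≤ 4 ^ h * b := by
  have hbern : (2 * n) ^ n ≤ 2 * (2 * n - 1) ^ n := by
    obtain ⟨p, hp⟩ : ∃ p, 2 * n = p + 1 := ⟨2 * n - 1, by omega⟩
    have h1 : (1 : ℝ) + n * (-(1 / (2 * n))) ≤ (1 + -(1 / (2 * n))) ^ n := by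
      apply one_add_mul_le_pow
      have : (1 : ℝ) / (2 * n) ≤ 1 := by
        rw [div_le_one (by positivity)]
        exact_mod_cast (by omega : 1 ≤ 2 * n)
      linarith
    have hn0 : (n : ℝ) ≠ 0 := by positivity
    have h2 : (1 : ℝ) + n * (-(1 / (2 * n))) = 1 / 2 := by field_simp; norm_num
    have h3 : (1 : ℝ) + -(1 / (2 * n)) = (2 * n - 1) / (2 * n) := by field_simp; ring
    rw [h2, h3, div_pow, div_le_div_iff₀ (by norm_num) (by positivity)] at h1
    have h4 : ((2 * n - 1 : ℕ) : ℝ) = 2 * n - 1 := by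
      rw [Nat.cast_sub (by omega)]; push_cast; ring
    have : ((2 * n : ℕ) : ℝ) ^ n ≤ 2 * ((2 * n - 1 : ℕ) : ℝ) ^ n := by
      rw [h4]; push_cast; linarith
    exact_mod_cast this
  have hpos : 0 < 2 * n - 1 := by omega
  have hloss : (2 * n) ^ w ≤ 2 ^ h * (2 * n - 1) ^ w := by
    obtain ⟨d, hd⟩ := Nat.exists_eq_add_of_le hw
    have h1 : (2 * n) ^ (n * h) ≤ 2 ^ h * (2 * n - 1) ^ (n * h) := by
      rw [pow_mul, pow_mul, ← mul_pow]
      exact Nat.pow_le_pow_left hbern h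
    refine Nat.le_of_mul_le_mul_right (c := (2 * n - 1) ^ d) ?_ (by positivity)
    calc (2 * n) ^ w * (2 * n - 1) ^ d ≤ (2 * n) ^ w * (2 * n) ^ d := by
          gcongr; exact Nat.sub_le _ _
      _ = (2 * n) ^ (n * h) := by rw [hd, pow_add]
      _ ≤ 2 ^ h * (2 * n - 1) ^ (n * h) := h1
      _ = _ := by rw [hd, pow_add]; ring
  have ht' : (2 * n) ^ t ≤ 2 ^ h := by
    have h1 : 2 * n * t ≤ h := by
      refine le_of_mul_le_mul_left ?_ (show 0 < n by omega)
      calc n * (2 * n * t) = n * (2 * n) * t := by ring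
        _ ≤ n * h := ht.trans hw
    calc (2 * n) ^ t ≤ (2 ^ (2 * n)) ^ t := Nat.pow_le_pow_left Nat.lt_two_pow_self.le _
      _ = 2 ^ (2 * n * t) := by rw [← pow_mul]
      _ ≤ 2 ^ h := Nat.pow_le_pow_right (by norm_num) h1
  refine le_of_mul_le_mul_left ?_ (show 0 < (2 * n - 1) ^ w by positivity)
  calc (2 * n - 1) ^ w * a ≤ (2 * n) ^ (t + w) * b := hab
    _ = (2 * n) ^ t * (2 * n) ^ w * b := by rw [pow_add]
    _ ≤ 2 ^ h * (2 ^ h * (2 * n - 1) ^ w) * b := by gcongr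
    _ = (2 * n - 1) ^ w * ((2 * 2) ^ h * b) := by rw [mul_pow]; ring

lemma exists_top_subset (A : Finset ℕ) (h : ℕ) (hh : h ≤ A.card) :
    ∃ S ⊆ A, S.card = h ∧ ∀ i ∈ A, i ∉ S → ∀ z ∈ S, i < z := by
  induction h with
  | zero => exact ⟨∅, by simp, rfl, by simp⟩
  | succ h ih =>
    obtain ⟨S, hS, hc, htop⟩ := ih (by omega)
    have hne : (A \ S).Nonempty := by
      rw [← card_pos, card_sdiff_of_subset hS]
      omega
    set a := (A \ S).max' hne
    have ha : a ∈ A \ S := max'_mem _ hne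
    obtain ⟨haA, haS⟩ := mem_sdiff.1 ha
    refine ⟨insert a S, insert_subset haA hS, by rw [card_insert_of_notMem haS, hc], ?_⟩
    intro i hi hiS z hz
    rw [mem_insert, not_or] at hiS
    rcases mem_insert.1 hz with rfl | hz
    · exact lt_of_le_of_ne (le_max' _ _ (mem_sdiff.2 ⟨hi, hiS.2⟩)) hiS.1
    · exact htop i hi hiS.2 z hz

/-- If `A ⊆ [1, 2m]` has many rainbow sum-free colorings, then many of them are almost free on a
set `B ⊆ A` of nearly `m` elements. -/
lemma exists_almost_free {r m n h : ℕ} {A : Finset ℕ} (hr : 8 ≤ r) (hA : A ⊆ Icc 1 (2 * m))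
    (hn : 2 * r * m ≤ n * h) (hn1 : 1 ≤ n) (hh : n * (n * (2 * n)) < h)
    (hhA : h ≤ A.card) (hcount : r ^ m ≤ traceCard (rainbowSumFree r A) A) :
    ∃ F ⊆ rainbowSumFree r A, ∃ B ⊆ A, B.card ≤ m ∧ m ≤ B.card + 15 * h ∧
      r ^ m ≤ r ^ (15 * h) * traceCard F B := by
  classical
  obtain ⟨S, hSA, hSc, htop⟩ := exists_top_subset A h hhA
  have hFne : (rainbowSumFree r A).Nonempty := by
    by_contra hne
    rw [Set.not_nonempty_iff_eq_empty] at hne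
    rw [hne] at hcount
    have : 0 < r ^ m := by positivity
    simp [traceCard] at hcount
    omega
  obtain ⟨F₁, hF₁, ⟨g, hg⟩, hle₁⟩ := exists_fixed_on (C := A) S _ hFne
  rw [hSc] at hle₁
  set G : ℕ × Fin r → ℕ × Fin r → Prop := fun u v => u.1 ∈ A ∧ v.1 ∈ A ∧ u.1 + v.1 ∈ S ∧
    u.2 ≠ v.2 ∧ u.2 ≠ g (u.1 + v.1) ∧ v.2 ≠ g (u.1 + v.1) with hGdef
  obtain ⟨F', hF', W', hW', T', t, ht, hT', hcov, hdeg, hloss⟩ :=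
    exists_container A G (n * (2 * n)) (2 * n) (Nat.mul_pos hn1 (by omega))
      (A ×ˢ (univ : Finset (Fin r))) F₁ ∅ (by
        rintro f hf u v ⟨hu, hv, hS, h1, h2, h3⟩ e1 e2
        refine hF₁ hf _ hu _ hv _ (hSA hS) rfl ?_
        rw [e1, e2, hg f hf _ hS]
        exact ⟨h1, h2, h3⟩) (by
        intro f _ i hi _
        exact mem_product.2 ⟨hi, mem_univ _⟩)
  have hAcard : A.card ≤ 2 * m := by
    simpa using card_le_card hA
  have hWcard : (A ×ˢ (univ : Finset (Fin r))).card ≤ n * h := by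
    rw [card_product, card_univ, Fintype.card_fin]
    refine le_trans ?_ hn
    calc A.card * r ≤ 2 * m * r := by gcongr
      _ = 2 * r * m := by ring
  have hle₂ := container_loss hn1 hWcard ht hloss
  have hth : T'.card ≤ h := by
    rw [card_empty, zero_add] at hT'
    refine hT'.trans ?_
    refine le_of_mul_le_mul_left ?_ (show 0 < n from hn1)
    calc n * t ≤ n * (2 * n) * t := by
          gcongr
          exact Nat.le_mul_of_pos_right _ (by omega)
      _ ≤ n * h := ht.trans hWcard
  -- some `z ∈ S` is involved in few conflicts
  set bad : ℕ → Finset ℕ := fun z => A.filter fun i => i ≤ z ∧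
    ∃ a b : Fin r, (i, a) ∈ W' ∧ (z - i, b) ∈ W' ∧ G (i, a) (z - i, b) with hbad
  obtain ⟨z, hzS, hzbad⟩ : ∃ z ∈ S, (bad z).card ≤ n * (n * (2 * n)) := by
    by_contra! hcon
    set E := W'.sigma fun v => W'.filter fun u => G v u with hE
    have hEcard : E.card ≤ n * h * (n * (2 * n)) := by
      rw [hE, card_sigma]
      refine (sum_le_card_nsmul _ _ (n * (2 * n)) fun v hv => ?_).trans ?_
      · have := hdeg v hv
        rwa [show {u | u ∈ W' ∧ G v u} = (W'.filter fun u => G v u : Finset _) by ext u; simp,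
          Set.ncard_coe_finset] at this
      · rw [smul_eq_mul]
        exact Nat.mul_le_mul_right _ ((card_le_card hW').trans hWcard)
    have hsub : S.sigma bad ⊆ E.image fun e => (⟨e.1.1 + e.2.1, e.1.1⟩ : Σ _ : ℕ, ℕ) := by
      rintro ⟨z, i⟩ hzi
      obtain ⟨hz, hi⟩ := mem_sigma.1 hzi
      obtain ⟨-, hiz, a, b, h1, h2, h3⟩ := mem_filter.1 hi
      refine mem_image.2 ⟨⟨(i, a), (z - i, b)⟩, mem_sigma.2 ⟨h1, mem_filter.2 ⟨h2, h3⟩⟩, ?_⟩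
      simp only at hiz ⊢
      rw [Nat.add_sub_cancel' hiz]
    have h1 := (card_le_card hsub).trans card_image_le
    rw [card_sigma] at h1
    have h2 : ∑ _z ∈ S, n * (n * (2 * n)) < ∑ z ∈ S, (bad z).card :=
      sum_lt_sum_of_nonempty (card_pos.1 (by omega)) fun z hz => hcon z hz
    rw [sum_const, hSc, smul_eq_mul] at h2
    have h3 : h * (n * (n * (2 * n))) = n * h * (n * (2 * n)) := by ring
    omega
  have hz2m := mem_Icc.1 (hA (hSA hzS))
  set X := S ∪ T' ∪ bad z with hX
  have hXcard : X.card ≤ 3 * h := by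
    have h1 := card_union_le (S ∪ T') (bad z)
    have h2 := card_union_le S T'
    rw [hX]
    omega
  set R := A.filter fun i => i ∉ X with hR
  have hRz : ∀ i ∈ R, i < z ∧ 1 ≤ i := by
    intro i hi
    obtain ⟨hiA, hiX⟩ := mem_filter.1 hi
    simp only [hX, mem_union, not_or] at hiX
    exact ⟨htop i hiA hiX.1.1 z hzS, (mem_Icc.1 (hA hiA)).1⟩
  set P : ℕ → Finset (Fin r) := fun i => univ.filter fun a => (i, a) ∈ W' with hP
  have hFP : ∀ i ∈ R, ∀ f ∈ F', f i ∈ P i := by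
    intro i hi f hf
    obtain ⟨hiA, hiX⟩ := mem_filter.1 hi
    simp only [hX, mem_union, not_or] at hiX
    exact mem_filter.2 ⟨mem_univ _, hcov f hf i hiA hiX.1.2⟩
  have hnc : ∀ i ∈ R, z - i ∈ A → ∀ a ∈ P i, ∀ b ∈ P (z - i), a ≠ b → a ≠ g z → b = g z := by
    intro i hi hzi a ha b hb hab hac
    by_contra hbc
    obtain ⟨hiA, hiX⟩ := mem_filter.1 hi
    simp only [hX, mem_union, not_or] at hiX
    have hiz := (hRz i hi).1.le
    refine hiX.2 (mem_filter.2 ⟨hiA, hiz, a, b, (mem_filter.1 ha).2, (mem_filter.1 hb).2, ?_⟩)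
    simp only [hGdef]
    rw [Nat.add_sub_cancel' hiz]
    exact ⟨hiA, hzi, hzS, hab, hac, hbc⟩
  set B := R.filter fun i => 3 ≤ (P i).card with hB
  have hBR : B ⊆ R := filter_subset _ _
  have hRA : R ⊆ A := filter_subset _ _
  -- the partner of an element with a large palette has the color of `z`
  have hpartner : ∀ i ∈ R, z - i ∈ B → ∀ a ∈ P i, a = g z := by
    intro i hi hzi a ha
    by_contra hac
    have h3 := (mem_filter.1 hzi).2
    have hlt : ({a, g z} : Finset (Fin r)).card < (P (z - i)).card :=
      lt_of_le_of_lt card_le_two (by omega)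
    obtain ⟨b, hb, hbn⟩ := exists_mem_notMem_of_card_lt_card hlt
    simp only [mem_insert, mem_singleton, not_or] at hbn
    exact hbn.2 (hnc i hi (hRA (hBR hzi)) a ha b hb (Ne.symm hbn.1) hac)
  have hBdisj : ∀ i ∈ B, z - i ∉ B := by
    intro i hi hzi
    have h1 : P i ⊆ {g z} := fun a ha => mem_singleton.2 (hpartner i (hBR hi) hzi a ha)
    have h2 := card_le_card h1
    have h3 := (mem_filter.1 hi).2
    rw [card_singleton] at h2
    omega
  set R₂ := (R \ B).filter fun i => z - i ∉ B with hR₂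
  have hBimg : (B.image fun i => z - i).card = B.card :=
    card_image_of_injOn fun i hi j hj hij => by
      have h1 := (hRz i (hBR hi)).1
      have h2 := (hRz j (hBR hj)).1
      have h3 : z - i = z - j := hij
      omega
  have hcards : R₂.card + 2 * B.card ≤ z - 1 := by
    have d1 : Disjoint B (B.image fun i => z - i) := by
      rw [disjoint_right]
      intro j hj
      obtain ⟨i, hi, rfl⟩ := mem_image.1 hj
      exact hBdisj i hi
    have d2 : Disjoint R₂ (B ∪ B.image fun i => z - i) := by
      rw [disjoint_left]
      intro j hj hj'
      obtain ⟨hj1, hj2⟩ := mem_filter.1 hj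
      rcases mem_union.1 hj' with h | h
      · exact (mem_sdiff.1 hj1).2 h
      · obtain ⟨i, hi, rfl⟩ := mem_image.1 h
        rw [Nat.sub_sub_self (hRz i (hBR hi)).1.le] at hj2
        exact hj2 hi
    have h1 : (R₂ ∪ (B ∪ B.image fun i => z - i)).card ≤ (Ico 1 z).card := by
      refine card_le_card (union_subset ?_ (union_subset ?_ ?_))
      · intro i hi
        have := hRz i (mem_sdiff.1 (mem_filter.1 hi).1).1
        exact mem_Ico.2 ⟨this.2, this.1⟩
      · intro i hi
        have := hRz i (hBR hi)
        exact mem_Ico.2 ⟨this.2, this.1⟩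
      · intro j hj
        obtain ⟨i, hi, rfl⟩ := mem_image.1 hj
        have := hRz i (hBR hi)
        exact mem_Ico.2 (by omega)
    rw [card_union_of_disjoint d2, card_union_of_disjoint d1, hBimg, Nat.card_Ico] at h1
    omega
  have hBm : B.card ≤ m := by omega
  have hcovA : A ⊆ X ∪ (B ∪ (R₂ ∪ (R \ B).filter fun i => ¬ z - i ∉ B)) := by
    intro i hi
    by_cases hiX : i ∈ X
    · exact mem_union_left _ hiX
    · have hiR : i ∈ R := mem_filter.2 ⟨hi, hiX⟩
      refine mem_union_right _ ?_
      rw [filter_union_filter_not_eq]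
      by_cases hiB : i ∈ B
      · exact mem_union_left _ hiB
      · exact mem_union_right _ (mem_sdiff.2 ⟨hiR, hiB⟩)
  have hprod : traceCard F' A ≤ r ^ (3 * h) * (traceCard F' B * 4 ^ (m - B.card)) := by
    have h1 : traceCard F' X ≤ r ^ (3 * h) :=
      traceCard_le_pow.trans (Nat.pow_le_pow_right (by omega) hXcard)
    have h2 : traceCard F' R₂ ≤ 4 ^ (m - B.card) := by
      refine (traceCard_le_pow_of_singleton 2 fun i hi => ?_).trans ?_
      · have hi' := mem_sdiff.1 (mem_filter.1 hi).1
        refine (traceCard_singleton (P i) (hFP i hi'.1)).trans ?_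
        by_contra! hlt
        exact hi'.2 (mem_filter.2 ⟨hi'.1, hlt⟩)
      · rw [show 4 = 2 ^ 2 by norm_num, ← pow_mul]
        exact Nat.pow_le_pow_right (by norm_num) (by omega)
    have h3 : traceCard F' ((R \ B).filter fun i => ¬ z - i ∉ B) ≤ 1 := by
      refine (traceCard_le_pow_of_singleton 1 fun i hi => ?_).trans (by rw [one_pow])
      obtain ⟨hi1, hi2⟩ := mem_filter.1 hi
      have hiR := (mem_sdiff.1 hi1).1
      refine (traceCard_singleton {g z} fun f hf => mem_singleton.2 ?_).trans (by simp)
      exact hpartner i hiR (not_not.1 hi2) _ (hFP i hiR f hf)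
    calc traceCard F' A
        ≤ traceCard F' (X ∪ (B ∪ (R₂ ∪ (R \ B).filter fun i => ¬ z - i ∉ B))) :=
          traceCard_subset hcovA
      _ ≤ traceCard F' X * (traceCard F' B *
            (traceCard F' R₂ * traceCard F' ((R \ B).filter fun i => ¬ z - i ∉ B))) :=
          traceCard_union.trans (Nat.mul_le_mul_left _ (traceCard_union.trans
            (Nat.mul_le_mul_left _ traceCard_union)))
      _ ≤ r ^ (3 * h) * (traceCard F' B * (4 ^ (m - B.card) * 1)) := by gcongr
      _ = _ := by rw [mul_one]
  have hmain : r ^ m ≤ r ^ (5 * h) * (traceCard F' B * 4 ^ (m - B.card)) := by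
    calc r ^ m ≤ r ^ h * (4 ^ h * (r ^ (3 * h) * (traceCard F' B * 4 ^ (m - B.card)))) :=
          hcount.trans (hle₁.trans (Nat.mul_le_mul_left _ (hle₂.trans
            (Nat.mul_le_mul_left _ hprod))))
      _ ≤ r ^ h * (r ^ h * (r ^ (3 * h) * (traceCard F' B * 4 ^ (m - B.card)))) := by
          gcongr
          omega
      _ = _ := by ring
  obtain ⟨d, hd⟩ := Nat.exists_eq_add_of_le hBm
  have hd' : m - B.card = d := by omega
  rw [hd'] at hmain
  have hdh : d ≤ 15 * h := by
    have h1 : r ^ d ≤ r ^ (5 * h) * 4 ^ d := by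
      refine le_of_mul_le_mul_left ?_ (show 0 < r ^ B.card by positivity)
      calc r ^ B.card * r ^ d = r ^ m := by rw [← pow_add, ← hd]
        _ ≤ r ^ (5 * h) * (traceCard F' B * 4 ^ d) := hmain
        _ ≤ r ^ (5 * h) * (r ^ B.card * 4 ^ d) := by
            gcongr
            exact traceCard_le_pow
        _ = _ := by ring
    have h2 : r ^ (3 * d) ≤ r ^ (15 * h + 2 * d) := by
      calc r ^ (3 * d) = (r ^ d) ^ 3 := by rw [← pow_mul, mul_comm]
        _ ≤ (r ^ (5 * h) * 4 ^ d) ^ 3 := Nat.pow_le_pow_left h1 3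
        _ = r ^ (15 * h) * ((8 : ℕ) ^ d) ^ 2 := by
            have h3 : ((4 : ℕ) ^ d) ^ 3 = (8 ^ d) ^ 2 := by
              rw [pow_right_comm, pow_right_comm 8]
              norm_num
            rw [mul_pow, h3, ← pow_mul, show 5 * h * 3 = 15 * h by ring]
        _ ≤ r ^ (15 * h) * (r ^ d) ^ 2 := by gcongr
        _ = _ := by rw [← pow_mul, pow_add, mul_comm d 2]
    have := (Nat.pow_le_pow_iff_right (by omega : 1 < r)).1 h2
    omega
  refine ⟨F', hF'.trans hF₁, B, hBR.trans hRA, hBm, by omega, hmain.trans ?_⟩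
  calc r ^ (5 * h) * (traceCard F' B * 4 ^ d)
      ≤ r ^ (5 * h) * (traceCard F' B * 4 ^ (15 * h)) := by
        gcongr
        norm_num
    _ = r ^ (5 * h) * (traceCard F' B * 8 ^ (10 * h)) := by
        rw [show 15 * h = 3 * (5 * h) by ring, show 10 * h = 2 * (5 * h) by ring, pow_mul 4,
          pow_mul 8]
        norm_num
    _ ≤ r ^ (5 * h) * (traceCard F' B * r ^ (10 * h)) := by gcongr
    _ = _ := by ring

lemma sq_three_mul_sub_two_lt {r : ℕ} (hr : 8 ≤ r) : (3 * r - 2) ^ 2 < r ^ 3 := by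
  obtain ⟨k, rfl⟩ := Nat.exists_eq_add_of_le hr
  rw [show 3 * (8 + k) - 2 = 22 + 3 * k by omega]
  ring_nf
  nlinarith [sq_nonneg k, pow_nonneg (Nat.zero_le k) 3]

/-- Almost free colorings of `B` leave little room for disjoint pairs in `B` which form Schur
triples with a common element. -/
lemma card_le_of_matching {r m k : ℕ} {A B Q : Finset ℕ} {F : Set (ℕ → Fin r)} (hr : 8 ≤ r)
    (hF : F ⊆ rainbowSumFree r A) (hBA : B ⊆ A) (hBm : B.card ≤ m)
    (hcount : r ^ m ≤ r ^ k * traceCard F B) {x : ℕ} (hx : x ∈ A) (g : ℕ → ℕ)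
    (hQ : ∀ y ∈ Q, y ∈ B ∧ g y ∈ B ∧ y ≠ x ∧ g y ≠ x ∧ g y ∉ Q)
    (hg : Set.InjOn g Q) (hsum : ∀ y ∈ Q, y + x = g y ∨ y + g y = x) :
    Q.card ≤ 2 * k + 2 := by
  classical
  have h1 := traceCard_matching (C := insert x B) hF (insert_subset hx hBA)
    (mem_insert_self _ _) g (fun y hy => by
      obtain ⟨h1, h2, h3⟩ := hQ y hy
      exact ⟨mem_insert_of_mem h1, mem_insert_of_mem h2, h3⟩) hg hsum
  have hC : (insert x B).card ≤ m + 1 := (card_insert_le _ _).trans (by omega)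
  have hr0 : 0 < r := by omega
  have h2 : r ^ (m + 2 * Q.card) ≤ r ^ (k + m + 1) * (3 * r - 2) ^ Q.card := by
    calc r ^ (m + 2 * Q.card) = r ^ m * r ^ (2 * Q.card) := pow_add ..
      _ ≤ r ^ k * traceCard F (insert x B) * r ^ (2 * Q.card) := by
          gcongr
          exact hcount.trans (Nat.mul_le_mul_left _ (traceCard_subset (subset_insert _ _)))
      _ = r ^ k * (traceCard F (insert x B) * r ^ (2 * Q.card)) := mul_assoc ..
      _ ≤ r ^ k * (r ^ (m + 1) * (3 * r - 2) ^ Q.card) := by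
          refine Nat.mul_le_mul_left _ (h1.trans ?_)
          gcongr
      _ = _ := by ring
  have h3 : r ^ (2 * m + 4 * Q.card) ≤ r ^ (2 * k + 2 * m + 2 + 3 * Q.card) := by
    calc r ^ (2 * m + 4 * Q.card) = (r ^ (m + 2 * Q.card)) ^ 2 := by ring
      _ ≤ (r ^ (k + m + 1) * (3 * r - 2) ^ Q.card) ^ 2 := Nat.pow_le_pow_left h2 2
      _ = r ^ (2 * k + 2 * m + 2) * ((3 * r - 2) ^ 2) ^ Q.card := by ring
      _ ≤ r ^ (2 * k + 2 * m + 2) * (r ^ 3) ^ Q.card := by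
          exact Nat.mul_le_mul_left _ (Nat.pow_le_pow_left (sq_three_mul_sub_two_lt hr).le _)
      _ = _ := by ring
  have := (Nat.pow_le_pow_iff_right (by omega : 1 < r)).1 h3
  omega

lemma card_differences_le {r m k : ℕ} {A B : Finset ℕ} {F : Set (ℕ → Fin r)} (hr : 8 ≤ r)
    (hF : F ⊆ rainbowSumFree r A) (hBA : B ⊆ A) (hpos : ∀ x ∈ A, 1 ≤ x) (hBm : B.card ≤ m)
    (hcount : r ^ m ≤ r ^ k * traceCard F B) {x : ℕ} (hx : x ∈ A) :
    (B.filter fun b => b + x ∈ B).card ≤ 4 * k + 5 := by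
  classical
  have hx1 := hpos x hx
  have key : ∀ e, (B.filter fun b => b + x ∈ B ∧ b ≠ x ∧ b / x % 2 = e).card ≤ 2 * k + 2 := by
    intro e
    refine card_le_of_matching hr hF hBA hBm hcount hx (fun y => y + x) ?_
      (fun y _ z _ h => Nat.add_right_cancel h) (fun _ _ => Or.inl rfl)
    intro y hy
    obtain ⟨hyB, h1, h2, h3⟩ := mem_filter.1 hy
    have hy1 := hpos y (hBA hyB)
    refine ⟨hyB, h1, h2, by omega, fun h => ?_⟩
    have h4 := (mem_filter.1 h).2.2.2
    rw [Nat.add_div_right _ hx1] at h4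
    omega
  have hsub : (B.filter fun b => b + x ∈ B) ⊆
      {x} ∪ ((B.filter fun b => b + x ∈ B ∧ b ≠ x ∧ b / x % 2 = 0) ∪
        (B.filter fun b => b + x ∈ B ∧ b ≠ x ∧ b / x % 2 = 1)) := by
    intro b hb
    obtain ⟨hbB, hb⟩ := mem_filter.1 hb
    simp only [mem_union, mem_singleton, mem_filter]
    rcases Nat.mod_two_eq_zero_or_one (b / x) with h | h <;> tauto
  have h1 := card_le_card hsub
  have h2 := card_union_le {x} ((B.filter fun b => b + x ∈ B ∧ b ≠ x ∧ b / x % 2 = 0) ∪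
        (B.filter fun b => b + x ∈ B ∧ b ≠ x ∧ b / x % 2 = 1))
  have h3 := card_union_le (B.filter fun b => b + x ∈ B ∧ b ≠ x ∧ b / x % 2 = 0)
        (B.filter fun b => b + x ∈ B ∧ b ≠ x ∧ b / x % 2 = 1)
  have h4 := key 0
  have h5 := key 1
  rw [card_singleton] at h2
  omega

lemma card_summands_le {r m k : ℕ} {A B : Finset ℕ} {F : Set (ℕ → Fin r)} (hr : 8 ≤ r)
    (hF : F ⊆ rainbowSumFree r A) (hBA : B ⊆ A) (hpos : ∀ x ∈ A, 1 ≤ x) (hBm : B.card ≤ m)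
    (hcount : r ^ m ≤ r ^ k * traceCard F B) {x : ℕ} (hx : x ∈ A) :
    (B.filter fun b => b < x ∧ x - b ∈ B).card ≤ 4 * k + 5 := by
  classical
  have key : ∀ (p : ℕ → Prop) [DecidablePred p], (∀ y, y < x → p y → ¬ p (x - y)) →
      (B.filter fun b => (b < x ∧ x - b ∈ B) ∧ p b).card ≤ 2 * k + 2 := by
    intro p _ hp
    have hlt : ∀ y ∈ B.filter fun b => (b < x ∧ x - b ∈ B) ∧ p b, y < x := fun y hy =>
      (mem_filter.1 hy).2.1.1
    refine card_le_of_matching hr hF hBA hBm hcount hx (fun y => x - y) ?_ ?_ ?_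
    · intro y hy
      obtain ⟨hyB, ⟨h1, h2⟩, h3⟩ := mem_filter.1 hy
      have hy1 := hpos y (hBA hyB)
      exact ⟨hyB, h2, h1.ne, by omega, fun h => hp y h1 h3 (mem_filter.1 h).2.2⟩
    · intro y hy z hz h
      have h1 := hlt y hy
      have h2 := hlt z hz
      have h3 : x - y = x - z := h
      omega
    · intro y hy
      exact Or.inr (Nat.add_sub_cancel' (hlt y hy).le)
  have hsub : (B.filter fun b => b < x ∧ x - b ∈ B) ⊆
      {x / 2} ∪ ((B.filter fun b => (b < x ∧ x - b ∈ B) ∧ 2 * b < x) ∪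
        (B.filter fun b => (b < x ∧ x - b ∈ B) ∧ x < 2 * b)) := by
    intro b hb
    obtain ⟨hbB, hb⟩ := mem_filter.1 hb
    simp only [mem_union, mem_singleton, mem_filter]
    rcases lt_trichotomy (2 * b) x with h | h | h
    · tauto
    · exact Or.inl (by omega)
    · tauto
  have h1 := card_le_card hsub
  have h2 := card_union_le {x / 2} ((B.filter fun b => (b < x ∧ x - b ∈ B) ∧ 2 * b < x) ∪
        (B.filter fun b => (b < x ∧ x - b ∈ B) ∧ x < 2 * b))
  have h3 := card_union_le (B.filter fun b => (b < x ∧ x - b ∈ B) ∧ 2 * b < x)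
        (B.filter fun b => (b < x ∧ x - b ∈ B) ∧ x < 2 * b)
  have h4 := key (fun b => 2 * b < x) (fun y _ _ => by omega)
  have h5 := key (fun b => x < 2 * b) (fun y _ _ => by omega)
  rw [card_singleton] at h2
  omega

/-- Among the sets with more than `m` elements inside `[2m/3, 2m]`, only `[m, 2m]` can have at
least `r ^ (m + 1)` rainbow sum-free colorings. -/
lemma traceCard_lt_of_two_mul_le {r m : ℕ} {A : Finset ℕ} (hr : 8 ≤ r) (hA : A ⊆ Icc 1 (2 * m))
    (hlow : ∀ x ∈ A, 2 * m ≤ 3 * x) (hcard : m + 1 ≤ A.card) (hne : A ≠ Icc m (2 * m)) :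
    traceCard (rainbowSumFree r A) A < r ^ (m + 1) := by
  classical
  have hAne : A.Nonempty := card_pos.1 (by omega)
  set a := A.min' hAne with ha_def
  have ha : a ∈ A := A.min'_mem hAne
  have hmin : ∀ x ∈ A, a ≤ x := fun x hx => A.min'_le x hx
  have hAa : A ⊆ Icc a (2 * m) := fun x hx =>
    mem_Icc.2 ⟨hmin x hx, (mem_Icc.1 (hA hx)).2⟩
  have ha3 := hlow a ha
  have ha1 := (mem_Icc.1 (hA ha)).1
  have ham : a < m := by
    by_contra! hle
    refine hne (eq_of_subset_of_card_le (hAa.trans (Icc_subset_Icc_left hle)) ?_)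
    rw [Nat.card_Icc]
    omega
  have hM : (Icc a (2 * m) \ A).card + A.card = 2 * m + 1 - a := by
    rw [card_sdiff_add_card_eq_card hAa, Nat.card_Icc]
  set Q := (Ioc a (2 * m - a)).filter fun y => y ∈ A ∧ y + a ∈ A with hQdef
  have hQc : 2 * m - a - a ≤ Q.card + (Icc a (2 * m) \ A).card := by
    have h1 : ((Ioc a (2 * m - a)).filter fun y => ¬(y ∈ A ∧ y + a ∈ A)).card ≤
        (Icc a (2 * m) \ A).card := by
      refine card_le_card_of_injOn (fun y => if y ∈ A then y + a else y) ?_ ?_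
      · intro y hy
        obtain ⟨hy1, hy2⟩ := mem_filter.1 hy
        rw [mem_Ioc] at hy1
        simp only [coe_sdiff, Set.mem_sdiff, mem_coe, mem_Icc]
        split_ifs with h
        · exact ⟨by omega, fun h' => hy2 ⟨h, h'⟩⟩
        · exact ⟨by omega, h⟩
      · intro y hy z hz hyz
        have hy1 := mem_Ioc.1 (mem_filter.1 hy).1
        have hz1 := mem_Ioc.1 (mem_filter.1 hz).1
        simp only at hyz
        split_ifs at hyz <;> omega
    have h2 := card_filter_add_card_filter_not (s := Ioc a (2 * m - a))
      (fun y => y ∈ A ∧ y + a ∈ A)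
    rw [Nat.card_Ioc] at h2
    rw [hQdef]
    omega
  have hmatch := traceCard_matching (F := rainbowSumFree r A) (Q := Q) subset_rfl
    (subset_refl A) ha (fun y => y + a) (by
      intro y hy
      obtain ⟨h1, h2, h3⟩ := mem_filter.1 hy
      rw [mem_Ioc] at h1
      refine ⟨h2, h3, by omega, by omega, fun h => ?_⟩
      have h4 := mem_Ioc.1 (mem_filter.1 h).1
      omega) (fun y _ z _ h => Nat.add_right_cancel h) (fun _ _ => Or.inl rfl)
  obtain ⟨t, ht⟩ := Nat.exists_eq_add_of_le hcard
  have hQ0 : Q.card ≠ 0 := by omega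
  have hQt : 2 * t ≤ Q.card := by omega
  refine lt_of_pow_lt_pow_left₀ 2 (Nat.zero_le _) (lt_of_mul_lt_mul_right ?_
    (Nat.zero_le (r ^ (4 * Q.card))))
  calc traceCard (rainbowSumFree r A) A ^ 2 * r ^ (4 * Q.card)
      = (traceCard (rainbowSumFree r A) A * r ^ (2 * Q.card)) ^ 2 := by ring
    _ ≤ (r ^ A.card * (3 * r - 2) ^ Q.card) ^ 2 := Nat.pow_le_pow_left hmatch 2
    _ = r ^ (2 * A.card) * ((3 * r - 2) ^ 2) ^ Q.card := by ring
    _ < r ^ (2 * A.card) * (r ^ 3) ^ Q.card := by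
        refine Nat.mul_lt_mul_of_pos_left ?_ (by positivity)
        exact Nat.pow_lt_pow_left (sq_three_mul_sub_two_lt hr) hQ0
    _ = r ^ (2 * A.card + 3 * Q.card) := by ring
    _ ≤ r ^ (2 * (m + 1) + 4 * Q.card) := Nat.pow_le_pow_right (by omega) (by omega)
    _ = _ := by ring

lemma traceCard_lt_of_ne_Icc {r m h : ℕ} {A : Finset ℕ} (hr : 8 ≤ r) (hA : A ⊆ Icc 1 (2 * m))
    (hmh : 65000 * h ≤ m) (hhm : m ≤ 130000 * h)
    (hh : 260000 * r * (260000 * r * (2 * (260000 * r))) < h) (hcard : m + 1 ≤ A.card)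
    (hne : A ≠ Icc m (2 * m)) : traceCard (rainbowSumFree r A) A < r ^ (m + 1) := by
  by_contra! hcount
  have hpos : ∀ x ∈ A, 1 ≤ x := fun x hx => (mem_Icc.1 (hA hx)).1
  have hn : 2 * r * m ≤ 260000 * r * h := by
    calc 2 * r * m ≤ 2 * r * (130000 * h) := by gcongr
      _ = _ := by ring
  obtain ⟨F, hF, B, hBA, hBm, hmB, hFB⟩ := exists_almost_free hr hA hn (by omega) hh (by omega)
    ((Nat.pow_le_pow_right (by omega) (Nat.le_succ m)).trans hcount)
  refine absurd hcount (not_le.2 (traceCard_lt_of_two_mul_le hr hA ?_ hcard hne))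
  refine two_mul_le_three_mul_of_sparse (P := 65 * h) hA hBA (by omega) (by omega) (by omega)
    (fun x hx => ?_) (fun x hx => ?_) hcard
  · exact (card_differences_le hr hF hBA hpos hBm hFB hx).trans (by omega)
  · exact (card_summands_le hr hF hBA hpos hBm hFB hx).trans (by omega)

lemma numRSF_eq_traceCard {r : ℕ} (hr : 0 < r) (A : Finset ℕ) :
    numRSF r A = traceCard (rainbowSumFree r A) A := by
  classical
  have h : (fun (f : ℕ → Fin r) (c : A) => f c) '' rainbowSumFree r A =
      {f : ↥A → Fin r | ∀ x y z : ↥A, (x : ℕ) + (y : ℕ) = (z : ℕ) →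
        ¬(f x ≠ f y ∧ f x ≠ f z ∧ f y ≠ f z)} := by
    ext f
    constructor
    · rintro ⟨f, hf, rfl⟩ x y z
      exact hf x x.2 y y.2 z z.2
    · intro hf
      refine ⟨fun i => if hi : i ∈ A then f ⟨i, hi⟩ else ⟨0, hr⟩, ?_, ?_⟩
      · intro x hx y hy z hz hxyz
        simp only [hx, hy, hz, dif_pos]
        exact hf ⟨x, hx⟩ ⟨y, hy⟩ ⟨z, hz⟩ hxyz
      · funext c
        simp
  rw [traceCard, h, ← Nat.card_coe_set_eq]
  rfl

lemma numRSF_Icc_two_mul (r m : ℕ) : numRSF r (Icc m (2 * m)) = r ^ (m + 1) := by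
  have h : ∀ f : ↥(Icc m (2 * m)) → Fin r, ∀ x y z : ↥(Icc m (2 * m)),
      (x : ℕ) + (y : ℕ) = (z : ℕ) → ¬(f x ≠ f y ∧ f x ≠ f z ∧ f y ≠ f z) := by
    intro f x y z hxyz hf
    have hx := mem_Icc.1 x.2
    have hy := mem_Icc.1 y.2
    have hz := mem_Icc.1 z.2
    exact hf.1 (congrArg f (Subtype.ext (by omega)))
  rw [numRSF, Nat.card_congr (Equiv.subtypeUnivEquiv h), Nat.card_fun, Nat.card_eq_fintype_card,
    Nat.card_eq_fintype_card, Fintype.card_fin, Fintype.card_coe, Nat.card_Icc]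
  congr 1
  omega

theorem stmt_6 (r : ℕ) (hr : 8 ≤ r) :
    ∃ n₀ : ℕ, ∀ n : ℕ, n₀ < n → Even n → ∀ A ⊆ Finset.Icc 1 n,
      (n + 1) / 2 + 1 ≤ A.card →
      numRSF r A ≤ r ^ ((n + 1) / 2 + 1) ∧
      (numRSF r A = r ^ ((n + 1) / 2 + 1) ↔ A = Finset.Icc (n / 2) n) := by
  set K := 260000 * r * (260000 * r * (2 * (260000 * r))) with hK
  refine ⟨130000 * (K + 1), fun n hn hev A hA hcard => ?_⟩
  obtain ⟨m, rfl⟩ := hev.two_dvd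
  rw [show (2 * m + 1) / 2 = m by omega] at hcard ⊢
  rw [show 2 * m / 2 = m by omega]
  by_cases hAI : A = Icc m (2 * m)
  · rw [hAI, numRSF_Icc_two_mul]
    simp
  · have hlt : numRSF r A < r ^ (m + 1) := by
      rw [numRSF_eq_traceCard (by omega)]
      exact traceCard_lt_of_ne_Icc (h := m / 65000) hr hA (by omega) (by omega)
        (by rw [← hK]; omega) hcard hAI
    exact ⟨hlt.le, fun h => absurd h hlt.ne, fun h => absurd h hAI⟩
end

section
/- For every integer r ≥ 8 there exists n₀ = n₀(r) such that for all odd n > n₀ the following holds: every A ⊆ [n] with |A| ≥ ⌈n/2⌉ + 1 satisfies g(A, r) ≤ r^{⌈n/2⌉}·(3 - 2/r), with equality if and only if A = I₃ := [(n-1)/2, n]. -/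
open Finset

/-- A coloring of `ℕ` whose restriction to `A` has no rainbow sum. -/
def IsRainbowSumFree {r : ℕ} (A : Finset ℕ) (f : ℕ → Fin r) : Prop :=
  ∀ x ∈ A, ∀ y ∈ A, x + y ∈ A → f x = f y ∨ f x = f (x + y) ∨ f y = f (x + y)

/-- If every rainbow sum-free coloring is captured by one of `#I` palette assignments, each of which
allows at most `B` colorings, then there are at most `#I * B` rainbow sum-free colorings. -/
lemma numRSF_le_card_mul {r : ℕ} [NeZero r] {ι : Type*} (A : Finset ℕ) (I : Finset ι)
    (Q : ι → ℕ → Finset (Fin r)) (B : ℕ)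
    (h : ∀ f : ℕ → Fin r, IsRainbowSumFree A f →
      ∃ i ∈ I, ∏ x ∈ A, #(Q i x) ≤ B ∧ ∀ x ∈ A, f x ∈ Q i x) :
    numRSF r A ≤ #I * B := by
  classical
  let J := I.filter fun i => ∏ x ∈ A, #(Q i x) ≤ B
  have hsub : (univ.filter fun f : ↥A → Fin r => ∀ x y z : ↥A, (x : ℕ) + (y : ℕ) = (z : ℕ) →
      ¬(f x ≠ f y ∧ f x ≠ f z ∧ f y ≠ f z)) ⊆
      J.biUnion fun i => Fintype.piFinset fun x : ↥A => Q i x := by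
    intro f hf
    simp only [mem_filter, mem_univ, true_and] at hf
    let g : ℕ → Fin r := fun x => if h : x ∈ A then f ⟨x, h⟩ else 0
    have hg : ∀ x : ↥A, g x = f x := fun x => by simp [g]
    obtain ⟨i, hi, hB, hQ⟩ := h g fun x hx y hy hxy => by
      have := hf ⟨x, hx⟩ ⟨y, hy⟩ ⟨x + y, hxy⟩ rfl
      simp only [g, hx, hy, hxy, dif_pos]
      tauto
    simp only [mem_biUnion, Fintype.mem_piFinset]
    exact ⟨i, mem_filter.2 ⟨hi, hB⟩, fun x => hg x ▸ hQ x x.2⟩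
  unfold numRSF
  rw [Nat.card_eq_fintype_card, Fintype.card_subtype]
  refine (card_le_card hsub).trans ((card_biUnion_le_card_mul _ _ B fun i hi => ?_).trans ?_)
  · rw [Fintype.card_piFinset, prod_coe_sort A fun x => #(Q i x)]
    exact (mem_filter.1 hi).2
  · exact Nat.mul_le_mul_right _ (card_le_card (filter_subset _ _))

lemma card_pairs_meeting_color {r : ℕ} (c : Fin r) :
    #(univ.filter fun p : Fin r × Fin r => p.1 = p.2 ∨ p.1 = c ∨ p.2 = c) = 3 * r - 2 := by
  have hr : 0 < r := c.pos
  have : (univ.filter fun p : Fin r × Fin r => p.1 = p.2 ∨ p.1 = c ∨ p.2 = c) =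
      univ \ (univ.erase c).offDiag := by
    ext p
    simp only [mem_filter, mem_univ, true_and, mem_sdiff, mem_offDiag, mem_erase]
    tauto
  rw [this, card_sdiff_of_subset (subset_univ _), offDiag_card, card_erase_of_mem (mem_univ _)]
  simp only [card_univ, Fintype.card_prod, Fintype.card_fin]
  obtain ⟨k, rfl⟩ : ∃ k, r = k + 1 := ⟨r - 1, by omega⟩
  simp only [Nat.add_sub_cancel]
  have : k ≤ k * k := Nat.le_mul_self k
  have h : (k + 1) * (k + 1) = k * k + 2 * k + 1 := by ring
  omega

/-- The upper bound on the number of rainbow sum-free colorings coming from `#M` disjoint pairs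
which all complete to a Schur triple with the same element `b`. -/
lemma numRSF_le_of_matching {r : ℕ} [NeZero r] {A : Finset ℕ} {b : ℕ} (hb : b ∈ A)
    (M : Finset (ℕ × ℕ))
    (hM : ∀ m ∈ M, m.1 ∈ A ∧ m.2 ∈ A ∧ m.1 ≠ m.2 ∧ m.1 ≠ b ∧ m.2 ≠ b ∧
      (m.1 + m.2 = b ∨ b + m.1 = m.2))
    (hd : ∀ m ∈ M, ∀ m' ∈ M, m ≠ m' →
      m.1 ≠ m'.1 ∧ m.1 ≠ m'.2 ∧ m.2 ≠ m'.2) :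
    2 * #M + 1 ≤ #A ∧ numRSF r A ≤ r ^ (#A - 2 * #M) * (3 * r - 2) ^ #M := by
  classical
  let U := insert b (M.image Prod.fst ∪ M.image Prod.snd)
  have hUA : U ⊆ A := by
    intro x hx
    simp only [U, mem_insert, mem_union, mem_image] at hx
    obtain rfl | ⟨m, hm, rfl⟩ | ⟨m, hm, rfl⟩ := hx
    exacts [hb, (hM m hm).1, (hM m hm).2.1]
  have hU : #U = 2 * #M + 1 := by
    rw [card_insert_of_notMem, card_union_of_disjoint, card_image_of_injOn, card_image_of_injOn]
    · ring
    · intro m hm m' hm' h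
      by_contra hne
      exact (hd m hm m' hm' hne).2.2 h
    · intro m hm m' hm' h
      by_contra hne
      exact (hd m hm m' hm' hne).1 h
    · rw [disjoint_left]
      intro x hx hx'
      simp only [mem_image] at hx hx'
      obtain ⟨m, hm, rfl⟩ := hx
      obtain ⟨m', hm', h⟩ := hx'
      by_cases hmm : m = m'
      · subst hmm; exact (hM m hm).2.2.1 h.symm
      · exact (hd m hm m' hm' hmm).2.1 h.symm
    · simp only [mem_union, mem_image, not_or, not_exists, not_and]
      exact ⟨fun m hm => (hM m hm).2.2.2.1, fun m hm => (hM m hm).2.2.2.2.1⟩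
  have hle : 2 * #M + 1 ≤ #A := hU ▸ card_le_card hUA
  refine ⟨hle, ?_⟩
  let allowed : Fin r → Finset (Fin r × Fin r) := fun c =>
    univ.filter fun p : Fin r × Fin r => p.1 = p.2 ∨ p.1 = c ∨ p.2 = c
  let I : Finset (Σ _ : Fin r, (↥M → Fin r × Fin r)) :=
    univ.sigma fun c => Fintype.piFinset fun _ : ↥M => allowed c
  let Q : (Σ _ : Fin r, (↥M → Fin r × Fin r)) → ℕ → Finset (Fin r) := fun i x =>
    univ.filter fun d => (x = b → d = i.1) ∧
      ∀ m : ↥M, (x = m.1.1 → d = (i.2 m).1) ∧ (x = m.1.2 → d = (i.2 m).2)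
  have hI : #I = r * (3 * r - 2) ^ #M := by
    simp [I, allowed, card_pairs_meeting_color]
  have := numRSF_le_card_mul (r := r) A I Q (r ^ (#A - (2 * #M + 1))) fun f hf => by
    refine ⟨⟨f b, fun m => (f m.1.1, f m.1.2)⟩, ?_, ?_, ?_⟩
    · simp only [I, mem_sigma, mem_univ, Fintype.mem_piFinset, true_and, allowed, mem_filter]
      intro m
      obtain ⟨h1, h2, -, -, -, h | h⟩ := hM m.1 m.2
      · have := hf _ h1 _ h2 (h ▸ hb)
        rw [h] at this
        exact this
      · have := hf _ hb _ h1 (h ▸ h2)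
        rw [h] at this
        tauto
    · rw [← prod_sdiff hUA, ← hU, ← card_sdiff_of_subset hUA]
      refine (Nat.mul_le_mul (prod_le_pow_card _ _ r fun x _ => ?_)
        (prod_le_one' fun x hx => ?_)).trans_eq (mul_one _)
      · exact (card_le_univ _).trans_eq (Fintype.card_fin r)
      · rw [card_le_one]
        simp only [Q, mem_filter, mem_univ, true_and]
        intro d hd d' hd'
        simp only [U, mem_insert, mem_union, mem_image] at hx
        obtain h | ⟨m, hm, h⟩ | ⟨m, hm, h⟩ := hx
        · rw [hd.1 h, hd'.1 h]
        · rw [(hd.2 ⟨m, hm⟩).1 h.symm, (hd'.2 ⟨m, hm⟩).1 h.symm]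
        · rw [(hd.2 ⟨m, hm⟩).2 h.symm, (hd'.2 ⟨m, hm⟩).2 h.symm]
    · intro x hx
      simp only [Q, mem_filter, mem_univ, true_and]
      refine ⟨fun h => by rw [h], fun m => ⟨fun h => by rw [h], fun h => by rw [h]⟩⟩
  rw [hI] at this
  refine this.trans_eq ?_
  have e : #A - 2 * #M = (#A - (2 * #M + 1)) + 1 := by omega
  rw [e, pow_succ]
  ring

/-- Lower bound for `[m, 2 * m + 1]`, whose only Schur triple with distinct elements is
`m + (m + 1) = 2 * m + 1`. -/
lemma le_numRSF_Icc {r m : ℕ} (hm : 1 ≤ m) :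
    r ^ m * (3 * r - 2) ≤ numRSF r (Icc m (2 * m + 1)) := by
  classical
  let A := Icc m (2 * m + 1)
  let U : Finset ℕ := {m, m + 1, 2 * m + 1}
  let allowed : Fin r → Finset (Fin r × Fin r) := fun c =>
    univ.filter fun p : Fin r × Fin r => p.1 = p.2 ∨ p.1 = c ∨ p.2 = c
  let I : Finset ((Σ _ : Fin r, Fin r × Fin r) × (↥(A \ U) → Fin r)) :=
    (univ.sigma fun c => allowed c) ×ˢ univ
  have hUA : U ⊆ A := by
    intro x hx
    simp only [U, mem_insert, mem_singleton] at hx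
    simp only [A, mem_Icc]
    omega
  have hU : #U = 3 := by
    rw [card_eq_three]
    exact ⟨m, m + 1, 2 * m + 1, by omega, by omega, by omega, rfl⟩
  have hI : #I = r ^ m * (3 * r - 2) := by
    have h1 : #(A \ U) = m - 1 := by
      rw [card_sdiff_of_subset hUA, hU]
      simp only [A, Nat.card_Icc]
      omega
    simp only [I, card_product, card_sigma, allowed, card_pairs_meeting_color, sum_const,
      card_univ, Fintype.card_fin, Fintype.card_fun, Fintype.card_coe, h1, smul_eq_mul]
    obtain ⟨k, rfl⟩ : ∃ k, m = k + 1 := ⟨m - 1, by omega⟩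
    rw [Nat.add_sub_cancel, pow_succ]
    ring
  let F : ((Σ _ : Fin r, Fin r × Fin r) × (↥(A \ U) → Fin r)) → ↥A → Fin r := fun i x =>
    if x.1 = m then i.1.2.1 else if x.1 = m + 1 then i.1.2.2 else
      if h : x.1 ∈ A \ U then i.2 ⟨x, h⟩ else i.1.1
  unfold numRSF
  rw [Nat.card_eq_fintype_card, Fintype.card_subtype, ← hI]
  refine card_le_card_of_injOn F ?_ ?_
  · intro i hi
    simp only [I, coe_product, Set.mem_prod, mem_coe, mem_sigma, mem_univ, true_and, and_true,
      allowed, mem_filter] at hi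
    simp only [mem_coe, mem_filter, mem_univ, true_and]
    intro x y z hxyz
    have hx := mem_Icc.1 x.2
    have hy := mem_Icc.1 y.2
    have hz := mem_Icc.1 z.2
    have h1 : z.1 ≠ m := by omega
    have h2 : (x.1 = m ∧ y.1 = m) ∨ (z.1 = 2 * m + 1 ∧ ((x.1 = m ∧ y.1 = m + 1) ∨
      (x.1 = m + 1 ∧ y.1 = m))) := by omega
    obtain ⟨h3, h4⟩ | ⟨h3, ⟨h4, h5⟩ | ⟨h4, h5⟩⟩ := h2
    · have : x = y := Subtype.ext (h3.trans h4.symm)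
      simp [this]
    · have h6 : ¬ (z.1 = m + 1) := by omega
      have h7 : ¬ (z.1 ∈ A \ U) := by simp [U, h3]
      simp only [F, h4, h5, h1, h6, h7, if_true, if_false, dif_neg, not_false_eq_true,
        Nat.succ_ne_self]
      tauto
    · have h6 : ¬ (z.1 = m + 1) := by omega
      have h7 : ¬ (z.1 ∈ A \ U) := by simp [U, h3]
      simp only [F, h4, h5, h1, h6, h7, if_true, if_false, dif_neg, not_false_eq_true,
        Nat.succ_ne_self]
      tauto
  · rintro ⟨⟨c, p⟩, g⟩ - ⟨⟨c', p'⟩, g'⟩ - h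
    have hmA : ∀ u ∈ U, u ∈ A := fun u hu => hUA hu
    have e1 := congrFun h ⟨m, hmA m (by simp [U])⟩
    have e2 := congrFun h ⟨m + 1, hmA _ (by simp [U])⟩
    have e3 := congrFun h ⟨2 * m + 1, hmA _ (by simp [U])⟩
    have h4 : ¬ (m + m + 1 = m) := by omega
    have h5 : ¬ m = 0 := by omega
    simp [F, U, h4, h5, two_mul] at e1 e2 e3
    have e4 : g = g' := by
      funext x
      have hx := mem_sdiff.1 x.2
      have e := congrFun h ⟨x.1, hx.1⟩
      have h6 : ¬ x.1 = m := fun h => hx.2 (by simp [U, h])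
      have h7 : ¬ x.1 = m + 1 := fun h => hx.2 (by simp [U, h])
      simpa only [F, h6, h7, if_false, x.2, dif_pos] using e
    subst e3 e4
    rw [show p = p' from Prod.ext e1 e2]

open SimpleGraph TripartiteFromTriangles Sum3 in
/-- Removal lemma for Schur triples in an abelian group, in the form that there cannot be many
pairwise disjoint Schur triples in a set with few Schur triples. -/
lemma card_disjoint_schur_triples_lt {G : Type*} [AddCommGroup G] [Fintype G] [DecidableEq G]
    (S : Finset G) (T : Finset (G × G)) (hT : ∀ p ∈ T, p.1 ∈ S ∧ p.2 ∈ S ∧ p.1 + p.2 ∈ S)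
    (h1 : Set.InjOn Prod.fst (T : Set (G × G))) (h2 : Set.InjOn Prod.snd (T : Set (G × G)))
    (h3 : Set.InjOn (fun p : G × G => p.1 + p.2) (T : Set (G × G))) (ε : ℝ)
    (hS : (#((S ×ˢ S).filter fun p => p.1 + p.2 ∈ S) : ℝ) <
      triangleRemovalBound ε * 27 * (Fintype.card G : ℝ) ^ 2) :
    (#T : ℝ) < ε * 9 * Fintype.card G := by
  classical
  by_contra! hcon
  let t : Finset (G × G × G) :=
    (univ ×ˢ T).image fun q : G × G × G => (q.1, q.1 + q.2.1, q.1 + q.2.1 + q.2.2)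
  have ht : ∀ x y z, (x, y, z) ∈ t ↔ (y - x, z - y) ∈ T := by
    intro x y z
    simp only [t, mem_image, mem_product, mem_univ, true_and, Prod.mk.injEq, Prod.exists]
    constructor
    · rintro ⟨a, b, c, h, rfl, rfl, rfl⟩
      simpa using h
    · intro h
      exact ⟨x, y - x, z - y, h, rfl, by abel, by abel⟩
  have htc : #t = Fintype.card G * #T := by
    rw [card_image_of_injective, card_product, card_univ]
    rintro ⟨a, b, c⟩ ⟨a', b', c'⟩ h
    simp only [Prod.mk.injEq] at h
    obtain ⟨rfl, h, h'⟩ := h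
    obtain rfl := add_left_cancel h
    obtain rfl := add_left_cancel h'
    rfl
  have : ExplicitDisjoint t := by
    constructor
    · intro a b c a' h h'
      rw [ht] at h h'
      have := h2 h h' rfl
      simpa using this
    · intro a b c b' h h'
      rw [ht] at h h'
      have := h3 h h' (by simp)
      simpa using this
    · intro a b c c' h h'
      rw [ht] at h h'
      have := h1 h h' rfl
      simpa using this
  have hfar : (graph t).FarFromTriangleFree ε := by
    refine farFromTriangleFree t ?_
    rw [htc]
    push_cast
    nlinarith [(Nat.cast_nonneg (Fintype.card G) : (0 : ℝ) ≤ _)]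
  have hcl := hfar.le_card_cliqueFinset
  let W := (S ×ˢ S).filter fun p => p.1 + p.2 ∈ S
  have hub : #((graph t).cliqueFinset 3) ≤ Fintype.card G * #W := by
    rw [← card_univ, ← card_product]
    refine card_le_card_of_surjOn
      (fun q : G × G × G => {in₀ q.1, in₁ (q.1 + q.2.1), in₂ (q.1 + q.2.1 + q.2.2)}) ?_
    intro s hs
    simp only [mem_coe, mem_cliqueFinset_iff] at hs
    rw [is3Clique_iff] at hs
    obtain ⟨x, y, z, hxy, hxz, hyz, rfl⟩ := hs
    obtain ⟨a, b, c, habc, hab, hac, hbc⟩ := graph_triple hxy hxz hyz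
    obtain ⟨c', hc'⟩ := Graph.in₀₁_iff.1 hab
    obtain ⟨b', hb'⟩ := Graph.in₀₂_iff.1 hac
    obtain ⟨a', ha'⟩ := Graph.in₁₂_iff.1 hbc
    rw [ht] at hc' hb' ha'
    refine ⟨(a, b - a, c - b), ?_, ?_⟩
    · simp only [coe_product, Set.mem_prod, mem_coe, mem_univ, true_and, W, mem_filter,
        mem_product]
      refine ⟨⟨(hT _ hc').1, (hT _ ha').2.1⟩, ?_⟩
      have := (hT _ hb').2.2
      simpa using this
    · simp only [add_sub_cancel, ← habc]
  have hG : (0 : ℝ) < Fintype.card G := by exact_mod_cast Fintype.card_pos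
  have hub' : (#((graph t).cliqueFinset 3) : ℝ) ≤ Fintype.card G * #W := by exact_mod_cast hub
  have e : (Fintype.card (G ⊕ G ⊕ G) : ℝ) = 3 * Fintype.card G := by
    simp only [Fintype.card_sum]; push_cast; ring
  rw [e] at hcl
  have := mul_lt_mul_of_pos_left hS hG
  nlinarith

lemma natCast_zmod_eq_iff {n a b : ℕ} (ha : a ≤ 2 * n) (hb : b ≤ 2 * n) :
    (a : ZMod (2 * n + 1)) = b ↔ a = b := by
  rw [ZMod.natCast_eq_natCast_iff', Nat.mod_eq_of_lt (by omega), Nat.mod_eq_of_lt (by omega)]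

/-- Removal lemma for Schur triples in `[n]`. -/
lemma exists_sumFree_subset (η : ℝ) (hη : 0 < η) :
    ∃ γ : ℝ, 0 < γ ∧ ∀ n : ℕ, 1 ≤ n → ∀ Y ⊆ Icc 1 n,
      (#((Y ×ˢ Y).filter fun p => p.1 + p.2 ∈ Y) : ℝ) ≤ γ * n ^ 2 →
      ∃ S ⊆ Y, (#Y : ℝ) ≤ #S + η * n ∧ ∀ x ∈ S, ∀ y ∈ S, x + y ∉ S := by
  classical
  have hε : 0 < η / 81 := by positivity
  have hpos := SimpleGraph.triangleRemovalBound_pos hε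
  refine ⟨SimpleGraph.triangleRemovalBound (η / 81), hpos, fun n hn Y hY hW => ?_⟩
  set W := (Y ×ˢ Y).filter fun p => p.1 + p.2 ∈ Y with hWdef
  let elems : ℕ × ℕ → Finset ℕ := fun p => {p.1, p.2, p.1 + p.2}
  let 𝒯 := W.powerset.filter fun T => ∀ p ∈ T, ∀ q ∈ T, p ≠ q → Disjoint (elems p) (elems q)
  obtain ⟨T, hT, hmax⟩ := exists_max_image 𝒯 card ⟨∅, by simp [𝒯]⟩
  simp only [𝒯, mem_filter, mem_powerset] at hT hmax
  obtain ⟨hTW, hTd⟩ := hT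
  have hle : ∀ y ∈ Y, y ≤ n := fun y hy => (mem_Icc.1 (hY hy)).2
  have hTY : ∀ p ∈ T, p.1 ∈ Y ∧ p.2 ∈ Y ∧ p.1 + p.2 ∈ Y := fun p hp => by
    have := hTW hp
    simp only [hWdef, mem_filter, mem_product] at this
    tauto
  have hinj : ∀ p ∈ T, ∀ q ∈ T, ∀ x, x ∈ elems p → x ∈ elems q → p = q := by
    intro p hp q hq x hxp hxq
    by_contra hne
    exact disjoint_left.1 (hTd p hp q hq hne) hxp hxq
  let c : ℕ → ZMod (2 * n + 1) := Nat.cast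
  have hcY : ∀ a ∈ Y, ∀ b ∈ Y, c a = c b → a = b := fun a ha b hb h =>
    (natCast_zmod_eq_iff (by have := hle a ha; omega) (by have := hle b hb; omega)).1 h
  have hTinj : Set.InjOn (Prod.map c c) (T : Set (ℕ × ℕ)) := by
    intro p hp q hq h
    simp only [Prod.map, Prod.mk.injEq] at h
    exact Prod.ext (hcY _ (hTY p hp).1 _ (hTY q hq).1 h.1)
      (hcY _ (hTY p hp).2.1 _ (hTY q hq).2.1 h.2)
  have hTcard : (#T : ℝ) < η / 81 * 9 * (2 * n + 1 : ℕ) := by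
    have := card_disjoint_schur_triples_lt (Y.image c) (T.image (Prod.map c c)) ?_ ?_ ?_ ?_
      (η / 81) ?_
    · rwa [card_image_of_injOn hTinj, ZMod.card] at this
    · intro p hp
      obtain ⟨q, hq, rfl⟩ := mem_image.1 hp
      obtain ⟨h1, h2, h3⟩ := hTY q hq
      refine ⟨mem_image_of_mem _ h1, mem_image_of_mem _ h2, mem_image.2 ⟨_, h3, ?_⟩⟩
      simp [c]
    · intro p hp q hq h
      obtain ⟨p', hp', rfl⟩ := mem_image.1 hp
      obtain ⟨q', hq', rfl⟩ := mem_image.1 hq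
      have := hcY _ (hTY p' hp').1 _ (hTY q' hq').1 h
      rw [hinj p' hp' q' hq' p'.1 (by simp [elems]) (by simp [elems, this])]
    · intro p hp q hq h
      obtain ⟨p', hp', rfl⟩ := mem_image.1 hp
      obtain ⟨q', hq', rfl⟩ := mem_image.1 hq
      have := hcY _ (hTY p' hp').2.1 _ (hTY q' hq').2.1 h
      rw [hinj p' hp' q' hq' p'.2 (by simp [elems]) (by simp [elems, this])]
    · intro p hp q hq h
      obtain ⟨p', hp', rfl⟩ := mem_image.1 hp
      obtain ⟨q', hq', rfl⟩ := mem_image.1 hq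
      have := hcY _ (hTY p' hp').2.2 _ (hTY q' hq').2.2 (by simpa [c] using h)
      rw [hinj p' hp' q' hq' (p'.1 + p'.2) (by simp [elems]) (by simp [elems, this])]
    · have h1 : #(((Y.image c) ×ˢ (Y.image c)).filter fun p => p.1 + p.2 ∈ Y.image c) ≤ #W := by
        refine card_le_card_of_surjOn (Prod.map c c) ?_
        intro p hp
        simp only [coe_filter, mem_product, mem_image, Set.mem_ofPred_eq] at hp
        obtain ⟨⟨⟨a, ha, h1⟩, b, hb, h2⟩, d, hd, h3⟩ := hp
        refine ⟨(a, b), ?_, Prod.ext h1 h2⟩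
        rw [← h1, ← h2] at h3
        have : d = a + b := by
          refine (natCast_zmod_eq_iff (n := n) ?_ ?_).1 (by simpa [c] using h3)
          · have := hle d hd; omega
          · have := hle a ha; have := hle b hb; omega
        simp only [hWdef, coe_filter, mem_product, Set.mem_ofPred_eq]
        exact ⟨⟨ha, hb⟩, this ▸ hd⟩
      have h2 : (#(((Y.image c) ×ˢ (Y.image c)).filter fun p => p.1 + p.2 ∈ Y.image c) : ℝ)
        ≤ #W := by exact_mod_cast h1
      refine h2.trans_lt (hW.trans_lt ?_)
      rw [ZMod.card]
      have hn' : (1 : ℝ) ≤ n := by exact_mod_cast hn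
      push_cast
      rw [mul_assoc]
      exact mul_lt_mul_of_pos_left (by nlinarith) hpos
  let R := T.image Prod.fst ∪ T.image Prod.snd ∪ T.image fun p => p.1 + p.2
  have hR : #R ≤ 3 * #T := by
    have h1 := card_union_le (T.image Prod.fst ∪ T.image Prod.snd) (T.image fun p => p.1 + p.2)
    have h2 := card_union_le (T.image Prod.fst) (T.image Prod.snd)
    have h3 : #(T.image Prod.fst) ≤ #T := card_image_le
    have h4 : #(T.image Prod.snd) ≤ #T := card_image_le
    have h5 : #(T.image fun p => p.1 + p.2) ≤ #T := card_image_le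
    simp only [R]
    omega
  refine ⟨Y \ R, sdiff_subset, ?_, ?_⟩
  · have h1 : #Y ≤ #(Y \ R) + 3 * #T := by
      have := le_card_sdiff R Y
      omega
    have h2 : (#Y : ℝ) ≤ #(Y \ R) + 3 * #T := by exact_mod_cast h1
    have hn' : (1 : ℝ) ≤ n := by exact_mod_cast hn
    push_cast at hTcard
    nlinarith
  · intro x hx y hy hxy
    simp only [mem_sdiff] at hx hy hxy
    have hnot : ∀ z ∈ elems (x, y), z ∉ R := by
      intro z hz
      simp only [elems, mem_insert, mem_singleton] at hz
      obtain rfl | rfl | rfl := hz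
      exacts [hx.2, hy.2, hxy.2]
    have helR : ∀ p ∈ T, ∀ z ∈ elems p, z ∈ R := by
      intro p hp z hz
      simp only [elems, mem_insert, mem_singleton] at hz
      simp only [R, mem_union, mem_image]
      obtain rfl | rfl | rfl := hz
      exacts [Or.inl (Or.inl ⟨p, hp, rfl⟩), Or.inl (Or.inr ⟨p, hp, rfl⟩), Or.inr ⟨p, hp, rfl⟩]
    have hnew : (x, y) ∉ T := fun h => hnot x (by simp [elems]) (helR _ h x (by simp [elems]))
    have := hmax (insert (x, y) T) ⟨?_, ?_⟩
    · rw [card_insert_of_notMem hnew] at this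
      omega
    · refine insert_subset ?_ hTW
      simp only [hWdef, mem_filter, mem_product]
      exact ⟨⟨hx.1, hy.1⟩, hxy.1⟩
    · intro p hp q hq hne
      rw [mem_insert] at hp hq
      obtain rfl | hp := hp <;> obtain rfl | hq := hq
      · exact absurd rfl hne
      · exact disjoint_left.2 fun z hz hz' => hnot z hz (helR q hq z hz')
      · exact disjoint_left.2 fun z hz hz' => hnot z hz' (helR p hp z hz)
      · exact hTd p hp q hq hne

open scoped Pointwise in
/-- A finite set with a small difference set has a difference set which is a subgroup. -/
lemma exists_addSubgroup_eq_sub {G : Type*} [AddCommGroup G] [DecidableEq G] {S : Finset G}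
    (hS : S.Nonempty) (h : 2 * #(S - S) < 3 * #S) :
    ∃ K : AddSubgroup G, ∀ x, x ∈ K ↔ x ∈ S - S := by
  have key : ∀ d ∈ S - S, #S < 2 * #{v ∈ S | d + v ∈ S} := by
    intro d hd
    obtain ⟨s, hs, t, ht, rfl⟩ := mem_sub.1 hd
    have h1 : #(S.image (s - ·)) = #S := card_image_of_injective _ sub_right_injective
    have h2 : #(S.image (t - ·)) = #S := card_image_of_injective _ sub_right_injective
    have h3 : S.image (s - ·) ∪ S.image (t - ·) ⊆ S - S := by
      refine union_subset ?_ ?_ <;> intro x hx <;> obtain ⟨y, hy, rfl⟩ := mem_image.1 hx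
      exacts [sub_mem_sub hs hy, sub_mem_sub ht hy]
    have h4 : #(S.image (s - ·) ∩ S.image (t - ·)) ≤ #{v ∈ S | s - t + v ∈ S} := by
      refine card_le_card_of_injOn (t - ·) ?_ (sub_right_injective.injOn)
      intro x hx
      obtain ⟨⟨a, ha, hax⟩, b, hb, hbx⟩ :
          (∃ a ∈ S, s - a = x) ∧ ∃ b ∈ S, t - b = x := by simpa using hx
      simp only [coe_filter, Set.mem_ofPred_eq]
      have e1 : t - x = b := by rw [← hbx]; abel
      have e2 : s - t + b = a := by
        rw [← e1, ← hax]; abel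
      rw [e1, e2]
      exact ⟨hb, ha⟩
    have := card_union_add_card_inter (S.image (s - ·)) (S.image (t - ·))
    have := card_le_card h3
    omega
  have hsub : ∀ d ∈ S - S, ∀ e ∈ S - S, d - e ∈ S - S := by
    intro d hd e he
    have h1 := key d hd
    have h2 := key e he
    have h3 : ({v ∈ S | d + v ∈ S} ∩ {v ∈ S | e + v ∈ S}).Nonempty := by
      rw [← card_pos]
      have := card_union_add_card_inter {v ∈ S | d + v ∈ S} {v ∈ S | e + v ∈ S}
      have := card_le_card (union_subset (filter_subset (fun v => d + v ∈ S) S)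
        (filter_subset (fun v => e + v ∈ S) S))
      omega
    obtain ⟨v, hv⟩ := h3
    simp only [mem_inter, mem_filter] at hv
    have : d - e = (d + v) - (e + v) := by abel
    rw [this]
    exact sub_mem_sub hv.1.2 hv.2.2
  have h0 : (0 : G) ∈ S - S := by
    obtain ⟨s, hs⟩ := hS
    simpa using sub_mem_sub hs hs
  refine ⟨AddSubgroup.ofSub (S - S : Finset G) ⟨0, h0⟩ ?_, fun x => Iff.rfl⟩
  intro x hx y hy
  rw [← sub_eq_add_neg]
  exact hsub x hx y hy

open scoped Pointwise in
/-- A sum-free subset of `[n]` with more than `4 * n / 9 + 1` elements consists of odd numbers or has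
a large minimum. -/
lemma sumFree_odd_or_large {n : ℕ} {B : Finset ℕ} (hB : B ⊆ Icc 1 n)
    (hsf : ∀ x ∈ B, ∀ y ∈ B, x + y ∉ B) (hk : 4 * n + 9 < 9 * #B) :
    (∀ x ∈ B, Odd x) ∨ ∀ x ∈ B, 5 * #B ≤ x + 2 * n + 4 := by
  classical
  have hne : B.Nonempty := by rw [← card_pos]; omega
  set μ := B.min' hne with hμ
  set M := B.max' hne with hM
  have hμB : μ ∈ B := min'_mem _ _
  have hMB : M ∈ B := max'_mem _ _
  have hμle : ∀ b ∈ B, μ ≤ b := fun b hb => min'_le _ _ hb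
  have hMle : ∀ b ∈ B, b ≤ M := fun b hb => le_max' _ _ hb
  have hIcc : ∀ b ∈ B, 1 ≤ b ∧ b ≤ n := fun b hb => mem_Icc.1 (hB hb)
  have hlt : μ < M := min'_lt_max'_of_card _ (by omega)
  obtain ⟨L, hL⟩ : ∃ L, M = μ + L := ⟨M - μ, by omega⟩
  have : NeZero L := ⟨by omega⟩
  let D := {d ∈ Icc 1 n | d < L ∧ ∃ a ∈ B, a + d ∈ B}
  let S : Finset (ZMod L) := B.image Nat.cast
  have hSne : S.Nonempty := hne.image _
  have hDB : #D + #B ≤ n := by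
    have h1 : Disjoint D B := disjoint_left.2 fun d hd hdB => by
      obtain ⟨-, -, a, ha, had⟩ := mem_filter.1 hd
      exact hsf a ha d hdB had
    rw [← card_union_of_disjoint h1]
    have := card_le_card (union_subset (filter_subset _ _) hB : D ∪ B ⊆ Icc 1 n)
    simpa using this
  have hDmem : ∀ a ∈ B, ∀ b ∈ B, a < b → b < a + L → b - a ∈ D := by
    intro a ha b hb hab hbL
    have := hIcc b hb
    simp only [D, mem_filter, mem_Icc]
    exact ⟨⟨by omega, by omega⟩, by omega, a, ha, by rwa [Nat.add_sub_cancel' hab.le]⟩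
  have hScard : #B ≤ #S + 1 := by
    have h1 : #((B.erase M).image (Nat.cast : ℕ → ZMod L)) = #(B.erase M) := by
      refine card_image_of_injOn ?_
      have aux : ∀ a ∈ B, ∀ b ∈ B, b ≠ M → a ≤ b → (a : ZMod L) = b → a = b := by
        intro a ha b hb hbM hab h
        have := (ZMod.natCast_eq_natCast_iff' a b L).1 h
        have := (Nat.modEq_iff_dvd' hab).1 this
        have h3 := hμle a ha
        have h4 := hMle b hb
        have := Nat.eq_zero_of_dvd_of_lt this (by omega)
        omega
      intro a ha b hb h
      simp only [coe_erase, Set.mem_sdiff, mem_coe, Set.mem_singleton_iff] at ha hb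
      rcases le_total a b with hab | hab
      · exact aux a ha.1 b hb.1 hb.2 hab h
      · exact (aux b hb.1 a ha.1 ha.2 hab h.symm).symm
    have h2 : #((B.erase M).image (Nat.cast : ℕ → ZMod L)) ≤ #S :=
      card_le_card (image_subset_image (erase_subset _ _))
    have := card_erase_add_one hMB
    omega
  have hSS : #(S - S) + #B ≤ 2 * #D + 3 := by
    let D' := D.image fun d => L - d
    have h1 : S - S ⊆ insert 0 ((D ∪ D').image Nat.cast) := by
      intro x hx
      obtain ⟨s, hs, t, ht, rfl⟩ := mem_sub.1 hx
      obtain ⟨a, ha, rfl⟩ := mem_image.1 hs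
      obtain ⟨b, hb, rfl⟩ := mem_image.1 ht
      have e1 := hμle a ha
      have e2 := hμle b hb
      have e3 := hMle a ha
      have e4 := hMle b hb
      rw [mem_insert, mem_image]
      rcases lt_trichotomy a b with hab | hab | hab
      · rcases lt_or_ge b (a + L) with hbL | hbL
        · refine Or.inr ⟨L - (b - a), mem_union_right _ (mem_image_of_mem _
            (hDmem a ha b hb hab hbL)), ?_⟩
          rw [Nat.cast_sub (by omega), Nat.cast_sub hab.le]
          simp
        · left
          have : b = a + L := by omega
          simp [this]
      · left; simp [hab]
      · rcases lt_or_ge a (b + L) with hbL | hbL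
        · refine Or.inr ⟨a - b, mem_union_left _ (hDmem b hb a ha hab hbL), ?_⟩
          rw [Nat.cast_sub hab.le]
        · left
          have : a = b + L := by omega
          simp [this]
    have h2 : #((B.erase μ).erase M) ≤ #(D ∩ D') := by
      refine card_le_card_of_injOn (fun b => b - μ) ?_ ?_
      · intro b hb
        simp only [coe_erase, Set.mem_sdiff, mem_coe, Set.mem_singleton_iff] at hb
        obtain ⟨⟨hb, hbμ⟩, hbM⟩ := hb
        have e1 := hμle b hb
        have e2 := hMle b hb
        rw [mem_coe, mem_inter, mem_image]
        refine ⟨hDmem μ hμB b hb (by omega) (by omega), M - b,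
          hDmem b hb M hMB (by omega) (by omega), ?_⟩
        change L - (M - b) = b - μ
        omega
      · intro a ha b hb h
        simp only [coe_erase, Set.mem_sdiff, mem_coe, Set.mem_singleton_iff] at ha hb
        have e1 := hμle a ha.1.1
        have e2 := hμle b hb.1.1
        simp only at h
        omega
    have h3 := card_erase_add_one hμB
    have h4 := card_erase_add_one (mem_erase.2 ⟨hlt.ne', hMB⟩ : M ∈ B.erase μ)
    have h5 := card_union_add_card_inter D D'
    have h6 : #D' ≤ #D := card_image_le
    have h7 := card_le_card h1
    have h8 := card_insert_le (0 : ZMod L) ((D ∪ D').image Nat.cast)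
    have h9 : #((D ∪ D').image (Nat.cast : ℕ → ZMod L)) ≤ #(D ∪ D') := card_image_le
    omega
  have hLn : μ + L ≤ n := by rw [← hL]; exact (hIcc M hMB).2
  have hμ1 := (hIcc μ hμB).1
  have hSle : #S ≤ #(S - S) := by
    obtain ⟨s, hs⟩ := hSne
    exact (card_image_of_injective S (sub_left_injective (b := s))).symm.trans_le
      (card_le_card (by
        intro x hx
        obtain ⟨y, hy, rfl⟩ := mem_image.1 hx
        exact sub_mem_sub hy hs))
  obtain ⟨K, hK⟩ := exists_addSubgroup_eq_sub hSne (by omega)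
  have hKcard : Nat.card K = #(S - S) := by
    have : (K : Set (ZMod L)) = (S - S : Finset (ZMod L)) := Set.ext hK
    rw [← Set.ncard_coe_finset, ← this]
    rfl
  by_cases h1 : (1 : ZMod L) ∈ K
  · right
    have hall : S - S = univ := by
      ext x
      simp only [mem_univ, iff_true, ← hK]
      have := K.nsmul_mem h1 x.val
      simpa using this
    have hcard : #(S - S) = L := by rw [hall, card_univ, ZMod.card]
    have h2 : #B + #B ≤ μ + L + 1 := by
      have e1 : #(B.image (· + μ)) = #B := card_image_of_injective _ (add_left_injective μ)
      have e2 : Disjoint B (B.image (· + μ)) := disjoint_left.2 fun b hb hb' => by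
        obtain ⟨c, hc, rfl⟩ := mem_image.1 hb'
        exact hsf c hc μ hμB hb
      have e3 : B ∪ B.image (· + μ) ⊆ Icc μ (2 * μ + L) := by
        refine union_subset ?_ ?_
        · intro b hb
          have := hμle b hb
          have := hMle b hb
          rw [mem_Icc]; omega
        · intro b hb
          obtain ⟨c, hc, rfl⟩ := mem_image.1 hb
          have := hμle c hc
          have := hMle c hc
          rw [mem_Icc]; omega
      have := card_le_card e3
      rw [card_union_of_disjoint e2, e1, Nat.card_Icc] at this
      omega
    intro x hx
    have := hμle x hx
    omega
  · left
    have hidx : K.index = 2 := by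
      have e1 := K.card_mul_index
      rw [hKcard, Nat.card_zmod] at e1
      have e2 : K.index ≠ 1 := fun h => h1 (by
        rw [AddSubgroup.index_eq_one] at h
        rw [h]; trivial)
      have e3 : K.index ≠ 0 := by
        intro h
        rw [h] at e1
        exact NeZero.ne L (by simpa using e1.symm)
      have e4 : K.index < 3 := by
        by_contra! h
        have := Nat.mul_le_mul_left #(S - S) h
        omega
      omega
    have hpar : ∀ b ∈ B, Even (b - μ) := by
      intro b hb
      by_contra hodd
      rw [Nat.not_even_iff_odd] at hodd
      obtain ⟨j, hj⟩ := hodd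
      apply h1
      have e1 : ((b - μ : ℕ) : ZMod L) ∈ K := by
        rw [hK, Nat.cast_sub (hμle b hb)]
        exact sub_mem_sub (mem_image_of_mem _ hb) (mem_image_of_mem _ hμB)
      have e2 := AddSubgroup.add_self_mem_of_index_two hidx (j : ZMod L)
      have := K.sub_mem e1 e2
      rw [hj] at this
      push_cast at this
      convert this using 1
      ring
    rcases Nat.even_or_odd μ with hμe | hμo
    · exfalso
      let E := (B.erase μ).image fun b => b - μ
      have e1 : #E = #(B.erase μ) := by
        refine card_image_of_injOn ?_
        intro a ha b hb h
        have := hμle a (mem_of_mem_erase ha)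
        have := hμle b (mem_of_mem_erase hb)
        simp only at h
        omega
      have e2 : Disjoint E B := disjoint_left.2 fun x hx hxB => by
        obtain ⟨b, hb, rfl⟩ := mem_image.1 hx
        have hb := mem_of_mem_erase hb
        have := hsf μ hμB _ hxB
        rw [Nat.add_sub_cancel' (hμle b hb)] at this
        exact this hb
      have e3 : E ∪ B ⊆ (Icc 1 (n / 2)).image (2 * ·) := by
        have aux : ∀ x, 1 ≤ x → x ≤ n → Even x → x ∈ (Icc 1 (n / 2)).image (2 * ·) := by
          rintro x hx1 hxn ⟨j, rfl⟩
          exact mem_image.2 ⟨j, mem_Icc.2 (by omega), by ring⟩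
        refine union_subset ?_ ?_
        · intro x hx
          obtain ⟨b, hb, rfl⟩ := mem_image.1 hx
          obtain ⟨hbμ, hb⟩ := mem_erase.1 hb
          have := hμle b hb
          have := hIcc b hb
          exact aux _ (by omega) (by omega) (hpar b hb)
        · intro b hb
          refine aux b (hIcc b hb).1 (hIcc b hb).2 ?_
          have := (hpar b hb).add hμe
          rwa [Nat.sub_add_cancel (hμle b hb)] at this
      have e4 := (card_le_card e3).trans card_image_le
      rw [card_union_of_disjoint e2, e1, Nat.card_Icc] at e4
      have := card_erase_add_one hμB
      omega
    · intro b hb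
      have := (hpar b hb).add_odd hμo
      rwa [Nat.sub_add_cancel (hμle b hb)] at this

/-- A set of linear size has subexponentially many subsets of very small linear size. -/
lemma exists_card_small_subsets_le {α : Type*} (r : ℕ) {ξ : ℝ} (hξ : 0 < ξ) :
    ∃ η : ℝ, 0 < η ∧ ∀ (n : ℕ) (U : Finset α), #U ≤ r * n →
      (#{s ∈ U.powerset | (#s : ℝ) ≤ η * n} : ℝ) ≤ Real.exp (ξ * n) := by
  set l : ℝ := min (1 / 2) (ξ / (2 * (r + 1))) with hl
  have hl0 : 0 < l := by positivity
  have hl1 : l ≤ 1 / 2 := min_le_left _ _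
  have hlr : l * r ≤ ξ / 2 := by
    have h1 : l ≤ ξ / (2 * (r + 1)) := min_le_right _ _
    rw [le_div_iff₀ (by positivity)] at h1
    nlinarith
  have hlog : 0 < 1 - Real.log l := by
    have := Real.log_nonpos hl0.le (by linarith)
    linarith
  refine ⟨ξ / (2 * (1 - Real.log l)), by positivity, fun n U hU => ?_⟩
  set η := ξ / (2 * (1 - Real.log l)) with hη
  have hη0 : 0 < η := by positivity
  have hηl : -(ξ / 2) ≤ η * Real.log l := by
    have : η * (1 - Real.log l) = ξ / 2 := by rw [hη]; field_simp
    nlinarith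
  have hn : (0 : ℝ) ≤ n := n.cast_nonneg
  have h1 : ∀ s ∈ U.powerset.filter fun s => (#s : ℝ) ≤ η * n,
      Real.exp (-(ξ / 2) * n) ≤ l ^ #s * 1 ^ (#U - #s) := by
    intro s hs
    have hs := (mem_filter.1 hs).2
    rw [one_pow, mul_one, ← Real.exp_log hl0, ← Real.exp_nat_mul, Real.exp_le_exp]
    have := Real.log_nonpos hl0.le (by linarith)
    nlinarith
  have h2 := card_nsmul_le_sum _ _ _ h1
  have h3 : ∑ s ∈ U.powerset.filter fun s => (#s : ℝ) ≤ η * n, l ^ #s * 1 ^ (#U - #s) ≤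
      (l + 1) ^ #U := by
    rw [← sum_pow_mul_eq_add_pow]
    exact sum_le_sum_of_subset_of_nonneg (filter_subset _ _) fun _ _ _ => by positivity
  have h4 : (l + 1) ^ #U ≤ Real.exp (ξ / 2 * n) := by
    calc (l + 1) ^ #U ≤ Real.exp l ^ #U := by
          gcongr
          exact Real.add_one_le_exp l
      _ = Real.exp (#U * l) := by rw [Real.exp_nat_mul]
      _ ≤ Real.exp (ξ / 2 * n) := by
          rw [Real.exp_le_exp]
          have : (#U : ℝ) ≤ r * n := by exact_mod_cast hU
          nlinarith
  rw [nsmul_eq_mul] at h2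
  have h5 := (h2.trans h3).trans h4
  have h6 : Real.exp (ξ * n) = Real.exp (ξ / 2 * n) * Real.exp (ξ / 2 * n) := by
    rw [← Real.exp_add]; ring_nf
  have h7 : Real.exp (-(ξ / 2) * n) * Real.exp (ξ / 2 * n) = 1 := by
    rw [← Real.exp_add]; simp
  calc (#{s ∈ U.powerset | (#s : ℝ) ≤ η * n} : ℝ)
      = #{s ∈ U.powerset | (#s : ℝ) ≤ η * n} * Real.exp (-(ξ / 2) * n)
          * Real.exp (ξ / 2 * n) := by rw [mul_assoc, h7, mul_one]
    _ ≤ Real.exp (ξ * n) := by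
        rw [h6]
        gcongr

/-- Greedy covering: if every element of `V` is related to a positive proportion of the elements
of `Ω`, a bounded number of elements of `Ω` covers almost all of `V`. -/
lemma exists_greedy_cover {α β : Type*} [DecidableEq β] (V : Finset α) (Ω : Finset β)
    (rel : α → β → Prop) [∀ x, DecidablePred (rel x)] {δ : ℝ} (hδ1 : δ ≤ 1)
    (h : ∀ x ∈ V, δ * #Ω ≤ #{ω ∈ Ω | rel x ω}) (hΩ : Ω.Nonempty) (L : ℕ) :
    ∃ I ⊆ Ω, #I ≤ L ∧ (#{x ∈ V | ∀ ω ∈ I, ¬ rel x ω} : ℝ) ≤ (1 - δ) ^ L * #V := by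
  induction L with
  | zero => exact ⟨∅, by simp, by simp, by simp⟩
  | succ L ih =>
    obtain ⟨I, hI, hIc, hb⟩ := ih
    set W := {x ∈ V | ∀ ω ∈ I, ¬ rel x ω} with hW
    have hsum : ∑ ω ∈ Ω, (#{x ∈ W | rel x ω} : ℝ) = ∑ x ∈ W, (#{ω ∈ Ω | rel x ω} : ℝ) := by
      exact_mod_cast (sum_card_bipartiteAbove_eq_sum_card_bipartiteBelow rel).symm
    have hlow : ∑ ω ∈ Ω, δ * (#W : ℝ) ≤ ∑ ω ∈ Ω, (#{x ∈ W | rel x ω} : ℝ) := by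
      rw [hsum, sum_const, nsmul_eq_mul]
      calc (#Ω : ℝ) * (δ * #W) = ∑ x ∈ W, δ * (#Ω : ℝ) := by
            rw [sum_const, nsmul_eq_mul]; ring
        _ ≤ _ := sum_le_sum fun x hx => h x (mem_filter.1 hx).1
    obtain ⟨ω, hω, hωle⟩ := exists_le_of_sum_le hΩ hlow
    refine ⟨insert ω I, insert_subset hω hI, (card_insert_le _ _).trans (by omega), ?_⟩
    have h1 : {x ∈ V | ∀ o ∈ insert ω I, ¬ rel x o} = {x ∈ W | ¬ rel x ω} := by
      ext x
      simp only [hW, mem_filter, mem_insert, forall_eq_or_imp]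
      tauto
    have h2 : (#{x ∈ W | rel x ω} : ℝ) + #{x ∈ W | ¬ rel x ω} = #W := by
      exact_mod_cast card_filter_add_card_filter_not (s := W) (rel · ω)
    rw [h1, pow_succ]
    nlinarith

/-- The set of `y` such that `y + (x - y)` is a bichromatic representation of `x` in `A`. -/
def bichromatic {r : ℕ} (A : Finset ℕ) (f : ℕ → Fin r) (x : ℕ) : Finset ℕ :=
  {y ∈ A | x - y ∈ A ∧ f y ≠ f (x - y)}

/-- The colors on a small set `T` suffice to detect almost all elements with many bichromatic
representations. -/
lemma exists_detecting_set (r : ℕ) {β η : ℝ} (hβ : 0 < β) (hβ1 : β ≤ 1) (hη : 0 < η) :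
    ∃ n₀ : ℕ, ∀ n ≥ n₀, ∀ A ⊆ Icc 1 n, ∀ f : ℕ → Fin r, ∃ T ⊆ A, (#T : ℝ) ≤ 3 * η * n ∧
      ∀ x ∈ A, x ∈ T ∨ (∃ y ∈ T, ∃ z ∈ T, y + z = x ∧ f y ≠ f z) ∨
        (#(bichromatic A f x) : ℝ) < β * n := by
  classical
  obtain ⟨L, hL⟩ := exists_pow_lt_of_lt_one hη (by linarith : 1 - β / 2 < 1)
  obtain ⟨q, hq⟩ := exists_nat_ge (L / η + 1)
  have hq1 : 1 ≤ q := by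
    have : (0 : ℝ) ≤ L / η := by positivity
    exact_mod_cast (by linarith : (1 : ℝ) ≤ q)
  have hLq : (L : ℝ) ≤ η * q := by
    have : (L : ℝ) / η ≤ q := by linarith
    rw [div_le_iff₀ hη] at this
    linarith
  obtain ⟨n₁, hn₁⟩ := exists_nat_ge (L * (q + 1) / η)
  refine ⟨max n₁ q, fun n hn A hA f => ?_⟩
  have hnq : q ≤ n := (le_max_right _ _).trans hn
  have hn1 : (L : ℝ) * (q + 1) ≤ η * n := by
    have : (n₁ : ℝ) ≤ n := by exact_mod_cast (le_max_left _ _).trans hn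
    have : (L : ℝ) * (q + 1) / η ≤ n := by linarith
    rw [div_le_iff₀ hη] at this
    linarith
  have hIcc : ∀ a ∈ A, 1 ≤ a ∧ a ≤ n := fun a ha => mem_Icc.1 (hA ha)
  let V := {x ∈ A | β * n ≤ #(bichromatic A f x)}
  let Ω := range (n / q + 1) ×ˢ range q
  let rel : ℕ → ℕ × ℕ → Prop := fun x ω =>
    ∃ y ∈ bichromatic A f x, y / q = ω.1 ∧ (x - y) % q = ω.2
  have hΩc : #Ω = (n / q + 1) * q := by simp [Ω]
  have hΩ2 : #Ω ≤ 2 * n := by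
    have := Nat.div_mul_le_self n q
    rw [hΩc, add_mul]
    omega
  have hΩne : Ω.Nonempty := by
    rw [← card_pos, hΩc]
    positivity
  have hrel : ∀ x ∈ V, β / 2 * #Ω ≤ #{ω ∈ Ω | rel x ω} := by
    intro x hx
    obtain ⟨hxA, hxV⟩ := mem_filter.1 hx
    have h1 : #(bichromatic A f x) ≤ #{ω ∈ Ω | rel x ω} := by
      refine card_le_card_of_injOn (fun y => (y / q, (x - y) % q)) ?_ ?_
      · intro y hy
        have hy' := (mem_filter.1 hy).1
        simp only [Ω, rel, coe_filter, mem_product, mem_range, Set.mem_ofPred_eq]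
        refine ⟨⟨?_, Nat.mod_lt _ hq1⟩, y, hy, rfl, rfl⟩
        exact Nat.lt_succ_of_le (Nat.div_le_div_right (hIcc y hy').2)
      · have aux : ∀ y ∈ bichromatic A f x, ∀ z ∈ bichromatic A f x, y ≤ z →
            (y / q, (x - y) % q) = (z / q, (x - z) % q) → y = z := by
          intro y hy z hz hyz h
          obtain ⟨h1, h2⟩ := Prod.mk.inj h
          have hz' := hIcc _ (mem_filter.1 hz).2.1
          have h3 : q ∣ x - y - (x - z) := (Nat.modEq_iff_dvd' (by omega)).1 h2.symm
          have h4 := Nat.div_add_mod y q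
          have h5 := Nat.div_add_mod z q
          have h6 := Nat.mod_lt y hq1
          have h7 := Nat.mod_lt z hq1
          rw [h1] at h4
          have := Nat.eq_zero_of_dvd_of_lt h3 (by omega)
          omega
        intro y hy z hz h
        rcases le_total y z with hyz | hyz
        exacts [aux y hy z hz hyz h, (aux z hz y hy hyz h.symm).symm]
    have h2 : (#(bichromatic A f x) : ℝ) ≤ #{ω ∈ Ω | rel x ω} := by exact_mod_cast h1
    have h3 : (#Ω : ℝ) ≤ 2 * n := by exact_mod_cast hΩ2
    nlinarith
  obtain ⟨I, hI, hIc, hIb⟩ := exists_greedy_cover V Ω rel (by linarith) hrel hΩne L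
  let t : ℕ × ℕ → Finset ℕ := fun ω => {y ∈ A | y / q = ω.1 ∨ y % q = ω.2}
  have ht : ∀ ω, #(t ω) ≤ q + (n / q + 1) := by
    intro ω
    have h1 : t ω ⊆ {y ∈ A | y / q = ω.1} ∪ {y ∈ A | y % q = ω.2} := by
      rw [← filter_or]
    have h2 : #{y ∈ A | y / q = ω.1} ≤ q := by
      refine (card_le_card_of_injOn (t := range q) (· % q) ?_ ?_).trans_eq (card_range q)
      · intro y _
        simpa using Nat.mod_lt y hq1
      · intro y hy z hz h
        have h1 := (mem_filter.1 hy).2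
        have h2 := (mem_filter.1 hz).2
        have h : y % q = z % q := h
        rw [← Nat.div_add_mod y q, ← Nat.div_add_mod z q, h, h1, h2]
    have h3 : #{y ∈ A | y % q = ω.2} ≤ n / q + 1 := by
      refine (card_le_card_of_injOn (t := range (n / q + 1)) (· / q) ?_ ?_).trans_eq (card_range _)
      · intro y hy
        have := (hIcc y (mem_filter.1 hy).1).2
        simpa using Nat.lt_succ_of_le (Nat.div_le_div_right (c := q) this)
      · intro y hy z hz h
        have h1 := (mem_filter.1 hy).2
        have h2 := (mem_filter.1 hz).2
        have h : y / q = z / q := h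
        rw [← Nat.div_add_mod y q, ← Nat.div_add_mod z q, h, h1, h2]
    exact (card_le_card h1).trans ((card_union_le _ _).trans (by omega))
  refine ⟨I.biUnion t ∪ {x ∈ V | ∀ ω ∈ I, ¬ rel x ω}, union_subset ?_ ?_, ?_, ?_⟩
  · exact biUnion_subset.2 fun ω _ => filter_subset _ _
  · exact (filter_subset _ _).trans (filter_subset _ _)
  · have h1 : #(I.biUnion t) ≤ L * (q + (n / q + 1)) :=
      (card_biUnion_le_card_mul _ _ _ fun ω _ => ht ω).trans (Nat.mul_le_mul_right _ hIc)
    have h2 : (#(I.biUnion t) : ℝ) ≤ L * (q + 1) + L * (n / q : ℕ) := by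
      have : (#(I.biUnion t) : ℝ) ≤ ((L * (q + (n / q + 1)) : ℕ) : ℝ) := by exact_mod_cast h1
      push_cast at this ⊢
      linarith
    have h3 : (L : ℝ) * (n / q : ℕ) ≤ η * n := by
      have : (((n / q) * q : ℕ) : ℝ) ≤ n := by exact_mod_cast Nat.div_mul_le_self n q
      push_cast at this
      have h0 : (0 : ℝ) ≤ (n / q : ℕ) := by positivity
      calc (L : ℝ) * (n / q : ℕ) ≤ η * q * (n / q : ℕ) := by gcongr
        _ = η * ((n / q : ℕ) * q) := by ring
        _ ≤ η * n := by gcongr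
    have h4 : (#V : ℝ) ≤ n := by
      have h : #V ≤ #(Icc 1 n) := card_le_card ((filter_subset _ _).trans hA)
      rw [Nat.card_Icc] at h
      exact_mod_cast h
    have h5 : (1 - β / 2) ^ L * (#V : ℝ) ≤ η * n := by gcongr
    have h6 : (#(I.biUnion t ∪ {x ∈ V | ∀ ω ∈ I, ¬ rel x ω}) : ℝ) ≤
        #(I.biUnion t) + #{x ∈ V | ∀ ω ∈ I, ¬ rel x ω} := by exact_mod_cast card_union_le _ _
    linarith
  · intro x hx
    by_cases hxV : β * n ≤ #(bichromatic A f x)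
    swap
    · exact Or.inr (Or.inr (not_le.1 hxV))
    by_cases hcov : ∀ ω ∈ I, ¬ rel x ω
    · exact Or.inl (mem_union_right _ (mem_filter.2 ⟨mem_filter.2 ⟨hx, hxV⟩, hcov⟩))
    right; left
    push Not at hcov
    obtain ⟨ω, hω, y, hy, h1, h2⟩ := hcov
    obtain ⟨hyA, hxy, hne⟩ := mem_filter.1 hy
    have := hIcc _ hxy
    refine ⟨y, mem_union_left _ (mem_biUnion.2 ⟨ω, hω, mem_filter.2 ⟨hyA, Or.inl h1⟩⟩), x - y,
      mem_union_left _ (mem_biUnion.2 ⟨ω, hω, mem_filter.2 ⟨hxy, Or.inr h2⟩⟩), by omega, hne⟩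

/-- Boundedly many sets among a family of large sets suffice to meet each of them substantially. -/
lemma exists_cluster_representatives {α β : Type*} [DecidableEq α] [DecidableEq β]
    (W : Finset α) (N : α → Finset β) {d n : ℝ} (hd : 0 < d) {K : ℕ} (hK : 2 * n ≤ K * d)
    (hN : ∀ w ∈ W, d ≤ #(N w)) (hU : (#(W.biUnion N) : ℝ) ≤ n) :
    ∃ R ⊆ W, #R ≤ K ∧ ∀ w ∈ W, ∃ u ∈ R, d / (2 * K) ≤ #(N w ∩ N u) := by
  let 𝓡 := {R ∈ W.powerset | #R * (d / 2) ≤ #(R.biUnion N)}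
  obtain ⟨R, hR, hmax⟩ := exists_max_image 𝓡 card ⟨∅, by simp [𝓡]⟩
  simp only [𝓡, mem_filter, mem_powerset] at hR hmax
  obtain ⟨hRW, hRN⟩ := hR
  have hRK : #R ≤ K := by
    have h1 : (#(R.biUnion N) : ℝ) ≤ #(W.biUnion N) := by
      exact_mod_cast card_le_card (biUnion_subset_biUnion_of_subset_left _ hRW)
    have h2 : (#R : ℝ) * d ≤ K * d := by linarith
    exact_mod_cast le_of_mul_le_mul_right h2 hd
  refine ⟨R, hRW, hRK, fun w hw => ?_⟩
  have hcard : (#(N w \ R.biUnion N) : ℝ) + #(N w ∩ R.biUnion N) = #(N w) := by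
    exact_mod_cast card_sdiff_add_card_inter _ _
  have hnew : (#(N w \ R.biUnion N) : ℝ) < d / 2 := by
    by_contra! h
    by_cases hwR : w ∈ R
    · rw [sdiff_eq_empty_iff_subset.2 (subset_biUnion_of_mem N hwR), card_empty] at h
      norm_num at h
      linarith
    · have := hmax (insert w R) ⟨insert_subset hw hRW, ?_⟩
      · rw [card_insert_of_notMem hwR] at this
        omega
      · rw [card_insert_of_notMem hwR, biUnion_insert]
        have : (#(N w ∪ R.biUnion N) : ℝ) = #(N w \ R.biUnion N) + #(R.biUnion N) := by
          rw [← sdiff_union_self_eq_union, card_union_of_disjoint sdiff_disjoint]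
          push_cast; rfl
        rw [this]
        push_cast
        linarith
  have hlow : d / 2 < #(N w ∩ R.biUnion N) := by
    have := hN w hw
    linarith
  have hsum : (#(N w ∩ R.biUnion N) : ℝ) ≤ ∑ u ∈ R, (#(N w ∩ N u) : ℝ) := by
    rw [inter_biUnion]
    exact_mod_cast card_biUnion_le
  by_contra! h
  have h1 : ∑ u ∈ R, (#(N w ∩ N u) : ℝ) ≤ ∑ u ∈ R, d / (2 * K) :=
    sum_le_sum fun u hu => (h u hu).le
  rw [sum_const, nsmul_eq_mul] at h1
  have h2 : (#R : ℝ) * (d / (2 * K)) ≤ d / 2 := by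
    rcases Nat.eq_zero_or_pos K with rfl | hK0
    · simp; linarith
    · have : (#R : ℝ) ≤ K := by exact_mod_cast hRK
      calc (#R : ℝ) * (d / (2 * K)) ≤ K * (d / (2 * K)) := by gcongr
        _ = d / 2 := by field_simp
  linarith

/-- The elements of `A` whose sum with `y` lies in `X`. -/
def sumNeighbors (A X : Finset ℕ) (y : ℕ) : Finset ℕ := {z ∈ A | y + z ∈ X}

lemma card_bichromatic_neighbors_le {r n : ℕ} {A X : Finset ℕ} (hA : A ⊆ Icc 1 n) (hX : X ⊆ A)
    {f : ℕ → Fin r} {β θ : ℝ} (hβ0 : 0 ≤ β) (hn : 1 ≤ n)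
    (hβ : ∀ x ∈ X, (#(bichromatic A f x) : ℝ) ≤ β * n) :
    (#{y ∈ A | θ * n ≤ #{z ∈ sumNeighbors A X y | f y ≠ f z}} : ℝ) * θ ≤ β * n := by
  set E := {y ∈ A | θ * n ≤ #{z ∈ sumNeighbors A X y | f y ≠ f z}} with hE
  have hn0 : (0 : ℝ) < n := by exact_mod_cast hn
  have hinj : #(E.sigma fun y => {z ∈ sumNeighbors A X y | f y ≠ f z}) ≤
      #(X.sigma fun x => bichromatic A f x) := by
    refine card_le_card_of_injOn (fun p => ⟨p.1 + p.2, p.1⟩) ?_ ?_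
    · rintro ⟨y, z⟩ hp
      simp only [E, sumNeighbors, bichromatic, coe_sigma, Set.mem_sigma_iff, mem_coe, mem_filter,
        Nat.add_sub_cancel_left] at hp ⊢
      exact ⟨hp.2.1.2, (mem_filter.1 hp.1).1, hp.2.1.1, hp.2.2⟩
    · rintro ⟨y, z⟩ - ⟨y', z'⟩ - h
      simp only [Sigma.mk.injEq, heq_eq_eq] at h ⊢
      omega
  rw [card_sigma, card_sigma] at hinj
  have h1 : (#E : ℝ) * (θ * n) ≤ ∑ y ∈ E, (#{z ∈ sumNeighbors A X y | f y ≠ f z} : ℝ) := by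
    rw [← nsmul_eq_mul]
    exact card_nsmul_le_sum _ _ _ fun y hy => (mem_filter.1 hy).2
  have h2 : ∑ x ∈ X, (#(bichromatic A f x) : ℝ) ≤ #X * (β * n) := by
    rw [← nsmul_eq_mul]
    exact sum_le_card_nsmul _ _ _ hβ
  have h3 : ∑ y ∈ E, (#{z ∈ sumNeighbors A X y | f y ≠ f z} : ℝ) ≤
      ∑ x ∈ X, (#(bichromatic A f x) : ℝ) := by exact_mod_cast hinj
  have h4 : (#X : ℝ) ≤ n := by
    have h : #X ≤ #(Icc 1 n) := card_le_card (hX.trans hA)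
    rw [Nat.card_Icc] at h
    exact_mod_cast h
  have h6 : (#X : ℝ) * (β * n) ≤ n * (β * n) := by gcongr
  refine le_of_mul_le_mul_right ?_ hn0
  linarith

/-- If the elements of `X` have few bichromatic representations, then up to a small exceptional set
the colors of all elements with many sum-neighbors are determined by boundedly many of them. -/
lemma exists_exceptional_and_representatives {r n : ℕ} {A X : Finset ℕ} (hA : A ⊆ Icc 1 n)
    (hX : X ⊆ A) {f : ℕ → Fin r} {κ η : ℝ} (hκ : 0 < κ) (hη : 0 ≤ η) {K : ℕ} (hK : 2 / κ ≤ K)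
    (hn : 1 ≤ n)
    (hβ : ∀ x ∈ X, (#(bichromatic A f x) : ℝ) ≤ η * (κ / (4 * K)) * n) :
    ∃ E ⊆ A, ∃ R ⊆ A, (#E : ℝ) ≤ η * n ∧ #R ≤ K ∧
      (∀ w ∈ A, w ∉ E → κ * n ≤ #(sumNeighbors A X w) →
        ∃ u ∈ R, κ * n / (2 * K) ≤ #(sumNeighbors A X w ∩ sumNeighbors A X u)) ∧
      ∀ w ∈ A, w ∉ E → ∀ u ∈ R,
        κ * n / (2 * K) ≤ #(sumNeighbors A X w ∩ sumNeighbors A X u) → f w = f u := by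
  have hn0 : (0 : ℝ) < n := by exact_mod_cast hn
  have hK0 : (0 : ℝ) < K := lt_of_lt_of_le (by positivity) hK
  set θ := κ / (4 * K) with hθ
  have hθ0 : 0 < θ := by positivity
  set E := {y ∈ A | θ * n ≤ #{z ∈ sumNeighbors A X y | f y ≠ f z}} with hE
  have hEc : (#E : ℝ) ≤ η * n := by
    have := card_bichromatic_neighbors_le (θ := θ) hA hX (by positivity) hn hβ
    refine le_of_mul_le_mul_right ?_ hθ0
    linarith
  obtain ⟨R, hR, hRK, hRN⟩ := exists_cluster_representatives
    {w ∈ A \ E | κ * n ≤ #(sumNeighbors A X w)} (sumNeighbors A X) (d := κ * n) (n := n) (K := K)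
    (by positivity) (by
      rw [div_le_iff₀ hκ] at hK
      nlinarith) (fun w hw => (mem_filter.1 hw).2) (by
      have h : #(({w ∈ A \ E | κ * n ≤ #(sumNeighbors A X w)}).biUnion (sumNeighbors A X)) ≤
          #(Icc 1 n) :=
        card_le_card (biUnion_subset.2 fun w _ => (filter_subset _ _).trans hA)
      rw [Nat.card_Icc] at h
      exact_mod_cast h)
  refine ⟨E, filter_subset _ _, R, hR.trans ((filter_subset _ _).trans sdiff_subset), hEc, hRK,
    fun w hw hwE hwκ => hRN w (mem_filter.2 ⟨mem_sdiff.2 ⟨hw, hwE⟩, hwκ⟩), ?_⟩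
  have hsmall : ∀ w ∈ A, w ∉ E → (#{z ∈ sumNeighbors A X w | f w ≠ f z} : ℝ) < θ * n := by
    intro w hw hwE
    by_contra! h
    exact hwE (mem_filter.2 ⟨hw, h⟩)
  intro w hw hwE u hu hcom
  have huAE := mem_sdiff.1 (mem_filter.1 (hR hu)).1
  by_contra hne
  have h1 : sumNeighbors A X w ∩ sumNeighbors A X u ⊆
      {z ∈ sumNeighbors A X w | f w ≠ f z} ∪ {z ∈ sumNeighbors A X u | f u ≠ f z} := by
    intro z hz
    obtain ⟨hz1, hz2⟩ := mem_inter.1 hz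
    rw [mem_union, mem_filter, mem_filter]
    by_cases h : f w = f z
    · exact Or.inr ⟨hz2, fun h' => hne (h.trans h'.symm)⟩
    · exact Or.inl ⟨hz1, h⟩
  have h2 : (#(sumNeighbors A X w ∩ sumNeighbors A X u) : ℝ) ≤
      #{z ∈ sumNeighbors A X w | f w ≠ f z} + #{z ∈ sumNeighbors A X u | f u ≠ f z} := by
    exact_mod_cast (card_le_card h1).trans (card_union_le _ _)
  have h3 := hsmall w hw hwE
  have h4 := hsmall u huAE.1 huAE.2
  have h5 : κ * n / (2 * K) = θ * n + θ * n := by rw [hθ]; field_simp; ring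
  linarith

/-- The elements of `A` which are not colored by `p` and are not the sum of two elements to which
`p` gives different colors. -/
def undetected {r : ℕ} (A : Finset ℕ) (p : Finset (ℕ × Fin r)) : Finset ℕ :=
  {x ∈ A | (∀ s ∈ p, s.1 ≠ x) ∧ ∀ s ∈ p, ∀ t ∈ p, s.1 + t.1 = x → s.2 = t.2}

open scoped Classical in
/-- The colors of `x` which are compatible with the partial colorings `p.1`, `p.2.1` and with the
colors `p.2.2` of the cluster representatives. -/
noncomputable def palette {r : ℕ} (A : Finset ℕ) (δ : ℝ)
    (p : Finset (ℕ × Fin r) × Finset (ℕ × Fin r) × Finset (ℕ × Fin r)) (x : ℕ) : Finset (Fin r) :=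
  {c | (∀ s ∈ p.1 ∪ p.2.1, s.1 = x → c = s.2) ∧
    (∀ s ∈ p.1, ∀ t ∈ p.1, s.1 + t.1 = x → s.2 ≠ t.2 → c = s.2 ∨ c = t.2) ∧
    ((∀ s ∈ p.2.1, s.1 ≠ x) → ∀ u ∈ p.2.2,
      δ ≤ #(sumNeighbors A (undetected A p.1) x ∩ sumNeighbors A (undetected A p.1) u.1) →
        c = u.2)}

lemma card_le_two_of_forall_eq {r : ℕ} {Q : Finset (Fin r)} {a : Fin r} (h : ∀ c ∈ Q, c = a) :
    #Q ≤ 2 :=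
  (card_le_card fun c hc => mem_singleton.2 (h c hc)).trans (by simp)

/-- Container lemma: up to a subexponential factor, all rainbow sum-free colorings of `A` come from
palettes which are unrestricted on a set `Y` with few Schur triples, and of size two elsewhere. -/
lemma exists_container_s7 (r : ℕ) [NeZero r] {ξ κ : ℝ} (hξ : 0 < ξ) (hκ : 0 < κ) :
    ∃ n₀ : ℕ, ∀ n ≥ n₀, ∀ A ⊆ Icc 1 n, ∃ Y ⊆ A,
      (numRSF r A : ℝ) ≤ Real.exp (ξ * n) * (r ^ #Y * 2 ^ (#A - #Y)) ∧
      ∀ y ∈ Y, (#(sumNeighbors A Y y) : ℝ) ≤ κ * n := by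
  classical
  obtain ⟨η₀, hη₀, hsmall⟩ :=
    exists_card_small_subsets_le (α := ℕ × Fin r) r (by positivity : 0 < ξ / 3)
  obtain ⟨K, hK⟩ := exists_nat_ge (2 / κ)
  have hK0 : (0 : ℝ) < K := lt_of_lt_of_le (by positivity) hK
  set η := η₀ / 3 with hη
  have hη0 : 0 < η := by positivity
  set β := min 1 (η * (κ / (4 * K))) with hβ
  have hβ0 : 0 < β := by positivity
  obtain ⟨n₁, hn₁⟩ := exists_detecting_set r hβ0 (min_le_left _ _) hη0
  obtain ⟨n₂, hn₂⟩ := exists_nat_ge (K / η₀)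
  refine ⟨max (max n₁ n₂) 1, fun n hn A hA => ?_⟩
  have hn1 : 1 ≤ n := (le_max_right _ _).trans hn
  have hKn : (K : ℝ) ≤ η₀ * n := by
    have : (n₂ : ℝ) ≤ n := by
      exact_mod_cast ((le_max_right _ _).trans (le_max_left _ _)).trans hn
    have : (K : ℝ) / η₀ ≤ n := by linarith
    rw [div_le_iff₀ hη₀] at this
    linarith
  let 𝒴 := {Y ∈ A.powerset | ∀ y ∈ Y, (#(sumNeighbors A Y y) : ℝ) ≤ κ * n}
  obtain ⟨Y, hY, hmax⟩ := exists_max_image 𝒴 (fun Y => r ^ #Y * 2 ^ (#A - #Y)) ⟨∅, by simp [𝒴]⟩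
  simp only [𝒴, mem_filter, mem_powerset] at hY hmax
  refine ⟨Y, hY.1, ?_, hY.2⟩
  let 𝓢 := {s ∈ (A ×ˢ (univ : Finset (Fin r))).powerset | (#s : ℝ) ≤ η₀ * n}
  have h𝓢 : (#𝓢 : ℝ) ≤ Real.exp (ξ / 3 * n) := by
    refine hsmall n _ ?_
    have h : #A ≤ #(Icc 1 n) := card_le_card hA
    rw [Nat.card_Icc, Nat.add_sub_cancel] at h
    rw [card_product, card_univ, Fintype.card_fin, mul_comm]
    exact Nat.mul_le_mul_left _ h
  have hmain := numRSF_le_card_mul A (𝓢 ×ˢ 𝓢 ×ˢ 𝓢) (palette A (κ * n / (2 * K)))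
    (r ^ #Y * 2 ^ (#A - #Y)) ?_
  · rw [card_product, card_product] at hmain
    have h1 : (numRSF r A : ℝ) ≤ #𝓢 * (#𝓢 * #𝓢) * (r ^ #Y * 2 ^ (#A - #Y)) := by
      exact_mod_cast hmain
    have h2 : Real.exp (ξ * n) =
        Real.exp (ξ / 3 * n) * (Real.exp (ξ / 3 * n) * Real.exp (ξ / 3 * n)) := by
      rw [← Real.exp_add, ← Real.exp_add]
      ring_nf
    rw [h2]
    refine h1.trans ?_
    gcongr
  intro f hf
  let graph : Finset ℕ → Finset (ℕ × Fin r) := fun T => T.image fun x => (x, f x)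
  have hgraph : ∀ T ⊆ A, (#T : ℝ) ≤ η₀ * n → graph T ∈ 𝓢 := by
    intro T hT hTc
    refine mem_filter.2 ⟨mem_powerset.2 fun s hs => ?_, ?_⟩
    · obtain ⟨x, hx, rfl⟩ := mem_image.1 hs
      exact mem_product.2 ⟨hT hx, mem_univ _⟩
    · refine le_trans ?_ hTc
      exact_mod_cast card_image_le
  have hmem : ∀ T x, x ∈ T → (x, f x) ∈ graph T := fun T x hx => mem_image_of_mem _ hx
  have hval : ∀ T, ∀ s ∈ graph T, s.1 ∈ T ∧ s.2 = f s.1 := by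
    intro T s hs
    obtain ⟨x, hx, rfl⟩ := mem_image.1 hs
    exact ⟨hx, rfl⟩
  obtain ⟨T, hTA, hTc, hT⟩ := hn₁ n ((le_max_left _ _).trans ((le_max_left _ _).trans hn)) A hA f
  set X := undetected A (graph T) with hX
  have hXA : X ⊆ A := filter_subset _ _
  have hXb : ∀ x ∈ X, (#(bichromatic A f x) : ℝ) ≤ η * (κ / (4 * K)) * n := by
    intro x hx
    obtain ⟨hxA, hx1, hx2⟩ := mem_filter.1 hx
    rcases hT x hxA with h | ⟨y, hy, z, hz, hyz, hne⟩ | h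
    · exact absurd rfl (hx1 _ (hmem T x h))
    · exact absurd (hx2 _ (hmem T y hy) _ (hmem T z hz) hyz) hne
    · refine h.le.trans ?_
      gcongr
      exact min_le_right _ _
  obtain ⟨E, hEA, R, hRA, hEc, hRc, hER, hEeq⟩ :=
    exists_exceptional_and_representatives hA hXA hκ hη0.le hK hn1 hXb
  refine ⟨(graph T, graph E, graph R), ?_, ?_, ?_⟩
  · refine mem_product.2 ⟨hgraph T hTA ?_, mem_product.2 ⟨hgraph E hEA ?_, hgraph R hRA ?_⟩⟩
    · rw [hη] at hTc; linarith
    · have : η * n ≤ η₀ * n := by gcongr; rw [hη]; linarith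
      linarith
    · have : (#R : ℝ) ≤ K := by exact_mod_cast hRc
      linarith
  · let Z := {x ∈ X | (#(sumNeighbors A X x) : ℝ) ≤ κ * n}
    have hZX : Z ⊆ X := filter_subset _ _
    have hZA : Z ⊆ A := hZX.trans hXA
    have hZmem : Z ⊆ A ∧ ∀ y ∈ Z, (#(sumNeighbors A Z y) : ℝ) ≤ κ * n := by
      refine ⟨hZA, fun y hy => le_trans ?_ (mem_filter.1 hy).2⟩
      have : sumNeighbors A Z y ⊆ sumNeighbors A X y :=
        monotone_filter_right _ fun z _ hz => hZX hz
      exact_mod_cast card_le_card this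
    refine le_trans ?_ (hmax Z hZmem)
    rw [← prod_sdiff hZA, mul_comm]
    refine Nat.mul_le_mul (prod_le_pow_card _ _ _ fun x _ => ?_) ?_
    · exact (card_le_univ _).trans_eq (Fintype.card_fin r)
    rw [← card_sdiff_of_subset hZA]
    refine prod_le_pow_card _ _ _ fun x hx => ?_
    obtain ⟨hxA, hxZ⟩ := mem_sdiff.1 hx
    by_cases hxT : x ∈ T
    · exact card_le_two_of_forall_eq fun c hc =>
        (mem_filter.1 hc).2.1 _ (mem_union_left _ (hmem T x hxT)) rfl
    by_cases hxE : x ∈ E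
    · exact card_le_two_of_forall_eq fun c hc =>
        (mem_filter.1 hc).2.1 _ (mem_union_right _ (hmem E x hxE)) rfl
    by_cases hxX : x ∈ X
    · obtain ⟨u, hu, hux⟩ := hER x hxA hxE (by
        by_contra h
        exact hxZ (mem_filter.2 ⟨hxX, (not_le.1 h).le⟩))
      refine card_le_two_of_forall_eq fun c hc =>
        (mem_filter.1 hc).2.2.2 (fun s hs h => hxE ?_) _ (hmem R u hu) hux
      exact h ▸ (hval E s hs).1
    · have : ∃ s ∈ graph T, ∃ t ∈ graph T, s.1 + t.1 = x ∧ s.2 ≠ t.2 := by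
        by_contra! h
        refine hxX (mem_filter.2 ⟨hxA, fun s hs hsx => hxT ?_, h⟩)
        exact hsx ▸ (hval T s hs).1
      obtain ⟨s, hs, t, ht, hst, hne⟩ := this
      refine (card_le_card fun c hc => ?_ : _ ≤ #({s.2, t.2} : Finset (Fin r))).trans card_le_two
      rw [mem_insert, mem_singleton]
      exact (mem_filter.1 hc).2.2.1 s hs t ht hst hne
  · intro x hx
    refine mem_filter.2 ⟨mem_univ _, ?_, ?_, ?_⟩
    · intro s hs hsx
      rcases mem_union.1 hs with hs | hs <;> rw [(hval _ s hs).2, hsx]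
    · intro s hs t ht hst hne
      obtain ⟨hsT, hs2⟩ := hval T s hs
      obtain ⟨htT, ht2⟩ := hval T t ht
      have := hf s.1 (hTA hsT) t.1 (hTA htT) (by rwa [hst])
      rw [hst, ← hs2, ← ht2] at this
      rcases this with h | h | h
      exacts [absurd h hne, Or.inl h.symm, Or.inr h.symm]
    · intro hxE u hu hcom
      obtain ⟨huR, hu2⟩ := hval R u hu
      rw [hu2]
      exact hEeq x hx (fun h => hxE _ (hmem E x h) rfl) u.1 huR hcom

lemma card_add_card_le_of_sumNeighbors {n : ℕ} {A Y : Finset ℕ} (hA : A ⊆ Icc 1 n) (hY : Y ⊆ A)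
    {d : ℝ} (hd : 0 ≤ d) (h : ∀ y ∈ Y, (#(sumNeighbors A Y y) : ℝ) ≤ d) :
    (#Y + #A : ℝ) ≤ n + 1 + d := by
  have hAn : #A ≤ #(Icc 1 n) := card_le_card hA
  rw [Nat.card_Icc, Nat.add_sub_cancel] at hAn
  have hAn' : (#A : ℝ) ≤ n := by exact_mod_cast hAn
  rcases Y.eq_empty_or_nonempty with rfl | hne
  · simp
    linarith
  set μ := Y.min' hne with hμ
  have hμY : μ ∈ Y := min'_mem _ _
  have hμle : ∀ b ∈ Y, μ ≤ b := fun b hb => min'_le _ _ hb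
  let D := (Y.erase μ).image (· - μ)
  have hDc : #D + 1 = #Y := by
    rw [card_image_of_injOn, card_erase_add_one hμY]
    intro a ha b hb hab
    have := hμle a (mem_of_mem_erase ha)
    have := hμle b (mem_of_mem_erase hb)
    simp only at hab
    omega
  have h1 : D ∩ A ⊆ sumNeighbors A Y μ := by
    intro z hz
    obtain ⟨hzD, hzA⟩ := mem_inter.1 hz
    obtain ⟨b, hb, rfl⟩ := mem_image.1 hzD
    refine mem_filter.2 ⟨hzA, ?_⟩
    rw [Nat.add_sub_cancel' (hμle b (mem_of_mem_erase hb))]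
    exact mem_of_mem_erase hb
  have h2 : D ∪ A ⊆ Icc 1 n := by
    refine union_subset ?_ hA
    intro z hz
    obtain ⟨b, hb, rfl⟩ := mem_image.1 hz
    obtain ⟨hbμ, hb⟩ := mem_erase.1 hb
    have := hμle b hb
    have := mem_Icc.1 (hA (hY hb))
    rw [mem_Icc]
    omega
  have h3 := card_union_add_card_inter D A
  have h4 := card_le_card h1
  have h5 := card_le_card h2
  rw [Nat.card_Icc, Nat.add_sub_cancel] at h5
  have h6 : (#Y + #A : ℝ) ≤ n + 1 + #(sumNeighbors A Y μ) := by
    exact_mod_cast (by omega : #Y + #A ≤ n + 1 + #(sumNeighbors A Y μ))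
  have := h μ hμY
  linarith

lemma card_schur_pairs_le {A Y : Finset ℕ} (hY : Y ⊆ A) {d : ℝ}
    (h : ∀ y ∈ Y, (#(sumNeighbors A Y y) : ℝ) ≤ d) :
    (#((Y ×ˢ Y).filter fun p => p.1 + p.2 ∈ Y) : ℝ) ≤ #Y * d := by
  have h1 : #((Y ×ˢ Y).filter fun p => p.1 + p.2 ∈ Y) ≤ #(Y.sigma (sumNeighbors A Y)) := by
    refine card_le_card_of_injOn (fun p => ⟨p.1, p.2⟩) ?_ ?_
    · rintro ⟨y, z⟩ hp
      simp only [sumNeighbors, coe_filter, mem_product, Set.mem_ofPred_eq, coe_sigma,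
        Set.mem_sigma_iff, mem_coe] at hp ⊢
      exact ⟨hp.1.1, hY hp.1.2, hp.2⟩
    · rintro ⟨y, z⟩ - ⟨y', z'⟩ - hp
      simpa using hp
  rw [card_sigma] at h1
  have h2 : (#((Y ×ˢ Y).filter fun p => p.1 + p.2 ∈ Y) : ℝ) ≤
      ∑ y ∈ Y, (#(sumNeighbors A Y y) : ℝ) := by exact_mod_cast h1
  have h3 := sum_le_card_nsmul _ _ _ h
  rw [nsmul_eq_mul] at h3
  linarith

/-- Stability: a set with many rainbow sum-free colorings is close to a sum-free set of size close
to `n / 2`. -/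
lemma exists_sumFree_core {r : ℕ} (hr : 8 ≤ r) {ε : ℝ} (hε : 0 < ε) :
    ∃ n₀ : ℕ, ∀ n ≥ n₀, ∀ A ⊆ Icc 1 n, r ^ (n / 2) ≤ numRSF r A →
      ∃ S ⊆ A, (∀ x ∈ S, ∀ y ∈ S, x + y ∉ S) ∧ (1 / 2 - ε) * n ≤ #S ∧ (#A : ℝ) ≤ #S + ε * n := by
  have : NeZero r := ⟨by omega⟩
  obtain ⟨γ, hγ, hrem⟩ := exists_sumFree_subset (ε / 2) (by positivity)
  set κ := min γ (ε / 28) with hκ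
  have hκ0 : 0 < κ := by positivity
  obtain ⟨n₁, hn₁⟩ := exists_container_s7 r hκ0 hκ0
  obtain ⟨n₂, hn₂⟩ := exists_nat_ge (28 / ε)
  refine ⟨max (max n₁ n₂) 1, fun n hn A hA hcount => ?_⟩
  have hn1 : 1 ≤ n := (le_max_right _ _).trans hn
  have hn28 : 28 ≤ ε * n := by
    have : (n₂ : ℝ) ≤ n := by
      exact_mod_cast ((le_max_right _ _).trans (le_max_left _ _)).trans hn
    have : 28 / ε ≤ n := by linarith
    rw [div_le_iff₀ hε] at this
    linarith
  have hκn : 28 * (κ * n) ≤ ε * n := by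
    have : κ ≤ ε / 28 := min_le_right _ _
    have hn0 : (0 : ℝ) ≤ n := n.cast_nonneg
    nlinarith
  obtain ⟨Y, hYA, hle, hnb⟩ := hn₁ n ((le_max_left _ _).trans ((le_max_left _ _).trans hn)) A hA
  have hsum := card_add_card_le_of_sumNeighbors hA hYA (by positivity) hnb
  have hr0 : (0 : ℝ) < r := by exact_mod_cast (by omega : 0 < r)
  have hl2 : (0.69 : ℝ) < Real.log 2 := by linarith [Real.log_two_gt_d9]
  have hl2' : Real.log 2 < 0.7 := by linarith [Real.log_two_lt_d9]
  have hlr : 3 * Real.log 2 ≤ Real.log r := by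
    have : Real.log ((2 : ℝ) ^ 3) ≤ Real.log r :=
      Real.log_le_log (by norm_num) (by norm_num; exact_mod_cast hr)
    rwa [Real.log_pow] at this
  have hlog : ((n : ℝ) / 2 - 1 / 2) * Real.log r ≤
      κ * n + (#Y * Real.log r + (#A - #Y) * Real.log 2) := by
    have h1 : (r : ℝ) ^ (n / 2) ≤ Real.exp (κ * n) * (r ^ #Y * 2 ^ (#A - #Y)) :=
      le_trans (by exact_mod_cast hcount) hle
    have h2 := Real.log_le_log (by positivity) h1
    rw [Real.log_mul (by positivity) (by positivity), Real.log_mul (by positivity) (by positivity),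
      Real.log_exp, Real.log_pow, Real.log_pow, Real.log_pow, Nat.cast_sub (card_le_card hYA)] at h2
    have h3 : (n : ℝ) / 2 - 1 / 2 ≤ (n / 2 : ℕ) := by
      have : (n : ℝ) ≤ 2 * (n / 2 : ℕ) + 1 := by exact_mod_cast (by omega : n ≤ 2 * (n / 2) + 1)
      linarith
    nlinarith
  have hYlow : (n : ℝ) / 2 - 3 * (κ * n) - 3 ≤ #Y := by
    by_contra! h
    have hκn0 : 0 ≤ κ * n := by positivity
    have h4 : ((n : ℝ) / 2 - #Y - 1 / 2) * Real.log r ≤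
      κ * n + (n + 1 + κ * n - 2 * #Y) * Real.log 2 := by nlinarith
    have h5 : ((n : ℝ) / 2 - #Y) * (Real.log r - 2 * Real.log 2) ≤
      κ * n + (1 + κ * n) * Real.log 2 + Real.log r / 2 := by linarith
    have h6 : (3 * (κ * n) + 3) * (Real.log r - 2 * Real.log 2) ≤
      ((n : ℝ) / 2 - #Y) * (Real.log r - 2 * Real.log 2) := by
      apply mul_le_mul_of_nonneg_right <;> linarith
    nlinarith
  obtain ⟨S, hSY, hS, hsf⟩ := hrem n hn1 Y (hYA.trans hA) (by
    refine (card_schur_pairs_le hYA hnb).trans ?_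
    have h1 : #Y ≤ #(Icc 1 n) := card_le_card (hYA.trans hA)
    rw [Nat.card_Icc, Nat.add_sub_cancel] at h1
    have h2 : (#Y : ℝ) ≤ n := by exact_mod_cast h1
    have h3 : κ ≤ γ := min_le_left _ _
    calc (#Y : ℝ) * (κ * n) ≤ n * (γ * n) := by gcongr
      _ = γ * n ^ 2 := by ring)
  refine ⟨S, hSY.trans hYA, hsf, ?_, ?_⟩ <;> linarith

/-- A matching of pairwise disjoint pairs in `A`, each of which forms a Schur triple with `b`. -/
def IsSchurMatching (A : Finset ℕ) (b : ℕ) (M : Finset (ℕ × ℕ)) : Prop :=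
  (∀ m ∈ M, m.1 ∈ A ∧ m.2 ∈ A ∧ m.1 ≠ m.2 ∧ m.1 ≠ b ∧ m.2 ≠ b ∧
    (m.1 + m.2 = b ∨ b + m.1 = m.2)) ∧
  ∀ m ∈ M, ∀ m' ∈ M, m ≠ m' → m.1 ≠ m'.1 ∧ m.1 ≠ m'.2 ∧ m.2 ≠ m'.2

lemma IsSchurMatching.numRSF_le {r : ℕ} [NeZero r] {A : Finset ℕ} {b : ℕ} {M : Finset (ℕ × ℕ)}
    (hM : IsSchurMatching A b M) (hb : b ∈ A) {t : ℕ} (ht : t ≤ #M) :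
    2 * t + 1 ≤ #A ∧ numRSF r A ≤ r ^ (#A - 2 * t) * (3 * r - 2) ^ t := by
  obtain ⟨M', hM', rfl⟩ := exists_subset_card_eq ht
  exact numRSF_le_of_matching hb M' (fun m hm => hM.1 m (hM' hm))
    fun m hm m' hm' => hM.2 m (hM' hm) m' (hM' hm')

lemma pow_succ_lt_pow_mul {r : ℕ} (hr : 8 ≤ r) (m : ℕ) : r ^ (m + 1) < r ^ m * (3 * r - 2) := by
  rw [pow_succ]
  exact Nat.mul_lt_mul_of_pos_left (by omega) (by positivity)

lemma IsSchurMatching.numRSF_lt {r : ℕ} (hr : 8 ≤ r) {A : Finset ℕ} {b m s : ℕ}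
    {M : Finset (ℕ × ℕ)} (hM : IsSchurMatching A b M) (hb : b ∈ A) (hA : #A = m + 1 + s)
    (ht : 2 * s ≤ #M) : numRSF r A < r ^ m * (3 * r - 2) := by
  have : NeZero r := ⟨by omega⟩
  obtain ⟨h1, h2⟩ := hM.numRSF_le (r := r) hb ht
  refine lt_of_le_of_lt (h2.trans ?_) (pow_succ_lt_pow_mul hr m)
  calc r ^ (#A - 2 * (2 * s)) * (3 * r - 2) ^ (2 * s)
      = r ^ (m + 1 - 3 * s) * ((3 * r - 2) ^ 2) ^ s := by rw [pow_mul]; congr 2; omega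
    _ ≤ r ^ (m + 1 - 3 * s) * (r ^ 3) ^ s :=
        Nat.mul_le_mul_left _ (Nat.pow_le_pow_left (sq_three_mul_sub_two_lt hr).le _)
    _ = r ^ (m + 1) := by rw [← pow_mul, ← pow_add]; congr 1; omega

lemma IsSchurMatching.numRSF_lt_of_two_le {r : ℕ} (hr : 8 ≤ r) {A : Finset ℕ} {b m s : ℕ}
    {M : Finset (ℕ × ℕ)} (hM : IsSchurMatching A b M) (hb : b ∈ A) (hA : #A = m + 1 + s)
    (hs : 2 ≤ s) (ht : 2 * s - 1 ≤ #M) : numRSF r A < r ^ m * (3 * r - 2) := by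
  have : NeZero r := ⟨by omega⟩
  obtain ⟨h1, h2⟩ := hM.numRSF_le (r := r) hb ht
  obtain ⟨k, rfl⟩ := Nat.exists_eq_add_of_le' (by omega : 1 ≤ s)
  have h3 : 0 < (3 * r - 2) := by omega
  calc numRSF r A ≤ r ^ (m - 3 * k) * (((3 * r - 2) ^ 2) ^ k * (3 * r - 2)) := by
        rw [← pow_mul, ← pow_succ]
        convert h2 using 3 <;> omega
    _ < r ^ (m - 3 * k) * ((r ^ 3) ^ k * (3 * r - 2)) := by
        have : ((3 * r - 2) ^ 2) ^ k < (r ^ 3) ^ k :=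
          Nat.pow_lt_pow_left (sq_three_mul_sub_two_lt hr) (by omega)
        gcongr
    _ = r ^ m * (3 * r - 2) := by
        rw [← mul_assoc, ← pow_mul, ← pow_add]; congr 2; omega

/-- The pairs `(y, y + b)` in a set contain a matching with at least half of the pairs. -/
lemma exists_isSchurMatching_shift {A P : Finset ℕ} {b : ℕ} (hA : 0 ∉ A) (hb : b ∈ A)
    (hP : ∀ y ∈ P, y ∈ A ∧ y ≠ b ∧ y + b ∈ A) :
    ∃ M, IsSchurMatching A b M ∧ #P ≤ 2 * #M := by
  have hA' : ∀ x ∈ A, x ≠ 0 := fun x hx h => hA (h ▸ hx)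
  have hb0 : 0 < b := Nat.pos_of_ne_zero (hA' b hb)
  have key : ∀ i, IsSchurMatching A b (({y ∈ P | y / b % 2 = i}).image fun y => (y, y + b)) := by
    intro i
    refine ⟨?_, ?_⟩
    · intro m hm
      obtain ⟨y, hy, rfl⟩ := mem_image.1 hm
      obtain ⟨h1, h2, h3⟩ := hP y (mem_filter.1 hy).1
      have := hA' y h1
      refine ⟨h1, h3, ?_, h2, ?_, Or.inr (add_comm _ _)⟩ <;> simp only <;> omega
    · intro m hm m' hm' hne
      obtain ⟨y, hy, rfl⟩ := mem_image.1 hm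
      obtain ⟨z, hz, rfl⟩ := mem_image.1 hm'
      have h1 := (mem_filter.1 hy).2
      have h2 := (mem_filter.1 hz).2
      have h3 : y ≠ z := fun h => hne (by rw [h])
      refine ⟨h3, ?_, fun h => h3 (Nat.add_right_cancel h)⟩
      rintro h
      simp only at h
      rw [h, Nat.add_div_right _ hb0] at h1
      omega
  have hcard : ∀ i, #(({y ∈ P | y / b % 2 = i}).image fun y => (y, y + b)) =
      #{y ∈ P | y / b % 2 = i} :=
    fun i => card_image_of_injective _ fun y z h => (Prod.mk.inj h).1
  have hsum : #{y ∈ P | y / b % 2 = 0} + #{y ∈ P | y / b % 2 = 1} = #P := by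
    rw [← card_filter_add_card_filter_not (s := P) fun y => y / b % 2 = 0]
    simp
  rcases le_total #{y ∈ P | y / b % 2 = 0} #{y ∈ P | y / b % 2 = 1} with h | h
  · exact ⟨_, key 1, by rw [hcard]; omega⟩
  · exact ⟨_, key 0, by rw [hcard]; omega⟩

/-- The pairs `(y, b - y)` in a set contain a matching with half of the pairs. -/
lemma exists_isSchurMatching_reflect {A P : Finset ℕ} {b : ℕ}
    (hP : ∀ y ∈ P, y ∈ A ∧ 0 < y ∧ y < b ∧ b - y ∈ P) :
    ∃ M, IsSchurMatching A b M ∧ #P ≤ 2 * #M + 1 := by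
  refine ⟨({y ∈ P | 2 * y < b}).image fun y => (y, b - y), ⟨?_, ?_⟩, ?_⟩
  · intro m hm
    obtain ⟨y, hy, rfl⟩ := mem_image.1 hm
    obtain ⟨hyP, hyb⟩ := mem_filter.1 hy
    obtain ⟨h1, h2, h3, h4⟩ := hP y hyP
    refine ⟨h1, (hP _ h4).1, ?_, ?_, ?_, Or.inl ?_⟩ <;> simp only <;> omega
  · intro m hm m' hm' hne
    obtain ⟨y, hy, rfl⟩ := mem_image.1 hm
    obtain ⟨z, hz, rfl⟩ := mem_image.1 hm'
    have h1 := (mem_filter.1 hy).2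
    have h2 := (mem_filter.1 hz).2
    have h3 : y ≠ z := fun h => hne (by rw [h])
    refine ⟨h3, ?_, ?_⟩ <;> simp only <;> omega
  · rw [card_image_of_injective _ fun y z h => (Prod.mk.inj h).1]
    have h1 : #{y ∈ P | b < 2 * y} ≤ #{y ∈ P | 2 * y < b} := by
      refine card_le_card_of_injOn (b - ·) ?_ ?_
      · intro y hy
        obtain ⟨hyP, hyb⟩ := mem_filter.1 hy
        obtain ⟨-, -, h3, h4⟩ := hP y hyP
        rw [mem_coe, mem_filter]
        exact ⟨h4, by simp only; omega⟩
      · intro y hy z hz h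
        have := hP y (mem_filter.1 hy).1
        have := hP z (mem_filter.1 hz).1
        simp only at h
        omega
    have h2 : P ⊆ {y ∈ P | 2 * y < b} ∪ {y ∈ P | b < 2 * y} ∪ {b / 2} := by
      intro y hy
      simp only [mem_union, mem_filter, mem_singleton, hy, true_and]
      omega
    have h3 := card_le_card h2
    have h4 := card_union_le ({y ∈ P | 2 * y < b} ∪ {y ∈ P | b < 2 * y}) {b / 2}
    have h5 := card_union_le {y ∈ P | 2 * y < b} {y ∈ P | b < 2 * y}
    rw [card_singleton] at h4
    omega

lemma two_mul_card_le_of_odd {N : ℕ} {X : Finset ℕ} (hX : ∀ x ∈ X, Odd x ∧ x ≤ N) :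
    2 * #X ≤ N + 1 := by
  have : X ⊆ (range ((N + 1) / 2)).image fun j => 2 * j + 1 := by
    intro x hx
    obtain ⟨⟨j, rfl⟩, h⟩ := hX x hx
    exact mem_image.2 ⟨j, mem_range.2 (by omega), rfl⟩
  have := (card_le_card this).trans card_image_le
  rw [card_range] at this
  omega

lemma card_shift_inter {S : Finset ℕ} {b : ℕ} :
    #{y ∈ S | y + b ∈ S} + #(S ∪ S.image (· + b)) = #S + #S := by
  have h1 : #(S.image (· + b)) = #S := card_image_of_injective _ (add_left_injective b)
  have h2 : #{y ∈ S | y + b ∈ S} = #(S ∩ S.image (· + b)) := by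
    rw [← card_image_of_injective {y ∈ S | y + b ∈ S} (add_left_injective b)]
    congr 1
    ext x
    simp only [mem_image, mem_filter, mem_inter]
    constructor
    · rintro ⟨y, ⟨h1, h2⟩, rfl⟩
      exact ⟨h2, y, h1, rfl⟩
    · rintro ⟨h1, y, h2, rfl⟩
      exact ⟨y, ⟨h2, h1⟩, rfl⟩
  rw [h2]
  have := card_union_add_card_inter S (S.image (· + b))
  omega

/-- If `3 * min A ≥ n`, the pairs `(y, y + min A)` in `A` are pairwise disjoint. -/
lemma exists_isSchurMatching_min {n a : ℕ} {A : Finset ℕ} (hA : A ⊆ Icc a n)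
    (ha0 : 0 < a) (han : 2 * a ≤ n) (hn : n ≤ 3 * a) :
    ∃ M, IsSchurMatching A a M ∧ #A ≤ #M + 1 + a := by
  let P := {y ∈ A | y ≠ a ∧ y + a ∈ A}
  have hle : ∀ x ∈ A, a ≤ x ∧ x ≤ n := fun x hx => mem_Icc.1 (hA hx)
  refine ⟨P.image fun y => (y, y + a), ⟨?_, ?_⟩, ?_⟩
  · intro m hm
    obtain ⟨y, hy, rfl⟩ := mem_image.1 hm
    obtain ⟨h1, h2, h3⟩ := mem_filter.1 hy
    have := hle y h1
    refine ⟨h1, h3, ?_, h2, ?_, Or.inr (add_comm _ _)⟩ <;> simp only <;> omega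
  · intro m hm m' hm' hne
    obtain ⟨y, hy, rfl⟩ := mem_image.1 hm
    obtain ⟨z, hz, rfl⟩ := mem_image.1 hm'
    obtain ⟨h1, h2, h3⟩ := mem_filter.1 hy
    obtain ⟨h4, h5, h6⟩ := mem_filter.1 hz
    have h7 : y ≠ z := fun h => hne (by rw [h])
    have := hle y h1
    have := hle z h4
    have := hle _ h3
    refine ⟨h7, ?_, ?_⟩ <;> simp only <;> omega
  · rw [card_image_of_injective _ fun y z h => (Prod.mk.inj h).1]
    let U := {y ∈ A | y ≠ a ∧ y + a ≤ n}
    let V := {y ∈ A | 2 * a < y}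
    have h1 : #(U.image (· + a)) = #U := card_image_of_injective _ (add_left_injective a)
    have h2 : U.image (· + a) ∩ V ⊆ P.image (· + a) := by
      intro x hx
      obtain ⟨hxU, hxV⟩ := mem_inter.1 hx
      obtain ⟨y, hy, rfl⟩ := mem_image.1 hxU
      obtain ⟨h1, h2, -⟩ := mem_filter.1 hy
      exact mem_image_of_mem _ (mem_filter.2 ⟨h1, h2, (mem_filter.1 hxV).1⟩)
    have h3 : U.image (· + a) ∪ V ⊆ Icc (2 * a + 1) n := by
      intro x hx
      simp only [U, V, mem_union, mem_image, mem_filter, mem_Icc] at hx ⊢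
      rcases hx with ⟨y, ⟨h, h1, h2⟩, rfl⟩ | ⟨h, h1⟩
      · have := hle y h
        omega
      · have := hle x h
        omega
    have h4 : A ⊆ {a} ∪ U ∪ (Icc (n - a + 1) (2 * a) ∪ V) := by
      intro x hx
      have := hle x hx
      simp only [U, V, mem_union, mem_singleton, mem_filter, mem_Icc, hx, true_and]
      omega
    have h5 := (card_le_card h2).trans card_image_le
    have h6 := card_le_card h3
    have h7 := (card_le_card h4).trans (card_union_le _ _)
    have h8 := card_union_le {a} U
    have h9 := card_union_le (Icc (n - a + 1) (2 * a)) V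
    have h10 := card_union_add_card_inter (U.image (· + a)) V
    rw [Nat.card_Icc] at h6 h9
    rw [card_singleton] at h8
    omega

/-- Sets with a large sum-free part consisting of large elements have few colorings. -/
lemma numRSF_lt_of_core_large {r m s : ℕ} (hr : 8 ≤ r) {A S : Finset ℕ}
    (hA : A ⊆ Icc 1 (2 * m + 1)) (hSA : S ⊆ A) {a : ℕ} (ha : a ∈ A) (ham : 3 * a ≤ 2 * m + 1)
    (hAc : #A = m + 1 + s) (hm : 10000 ≤ m) (hS : 499 * (2 * m + 1) ≤ 1000 * #S)
    (hAS : 1000 * #A ≤ 1000 * #S + (2 * m + 1))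
    (hmin : ∀ x ∈ S, 5 * #S ≤ x + 2 * (2 * m + 1) + 4) :
    numRSF r A < r ^ m * (3 * r - 2) := by
  have hle : ∀ x ∈ A, 1 ≤ x ∧ x ≤ 2 * m + 1 := fun x hx => mem_Icc.1 (hA hx)
  obtain ⟨M, hM, hMc⟩ := exists_isSchurMatching_shift (P := {y ∈ S | y + a ∈ S})
    (fun h => by have := hle 0 h; omega) ha (by
      intro y hy
      obtain ⟨hy, hya⟩ := mem_filter.1 hy
      have := hmin y hy
      exact ⟨hSA hy, by omega, hSA hya⟩)
  have h1 := card_shift_inter (S := S) (b := a)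
  have h2 : S ∪ S.image (· + a) ⊆ Icc (5 * #S - 2 * (2 * m + 1) - 4) (2 * m + 1 + a) := by
    intro x hx
    simp only [mem_union, mem_image, mem_Icc] at hx ⊢
    rcases hx with hx | ⟨y, hy, rfl⟩
    · have := hmin x hx
      have := hle x (hSA hx)
      omega
    · have := hmin y hy
      have := hle y (hSA hy)
      omega
  have h3 := card_le_card h2
  have h4 : S ⊆ Icc (5 * #S - 2 * (2 * m + 1) - 4) (2 * m + 1) := by
    intro x hx
    have := hmin x hx
    have := hle x (hSA hx)
    rw [mem_Icc]
    omega
  have h5 := card_le_card h4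
  rw [Nat.card_Icc] at h3 h5
  exact hM.numRSF_lt hr ha hAc (by omega)

/-- Sets with a large part consisting of odd numbers have few colorings. -/
lemma numRSF_lt_of_core_odd {r m s : ℕ} (hr : 8 ≤ r) {A S : Finset ℕ}
    (hA : A ⊆ Icc 1 (2 * m + 1)) (hSA : S ⊆ A) (hAc : #A = m + 1 + s) (hs : 1 ≤ s)
    (hm : 10000 ≤ m) (hS : 499 * (2 * m + 1) ≤ 1000 * #S)
    (hAS : 1000 * #A ≤ 1000 * #S + (2 * m + 1)) (hodd : ∀ x ∈ S, Odd x) :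
    numRSF r A < r ^ m * (3 * r - 2) := by
  have hle : ∀ x ∈ A, 1 ≤ x ∧ x ≤ 2 * m + 1 := fun x hx => mem_Icc.1 (hA hx)
  have hSc := two_mul_card_le_of_odd fun x hx => ⟨hodd x hx, (hle x (hSA hx)).2⟩
  obtain ⟨b, hb, hbe⟩ : ∃ b ∈ A, Even b := by
    by_contra! h
    have := two_mul_card_le_of_odd fun x hx =>
      ⟨Nat.not_even_iff_odd.1 (h x hx), (hle x hx).2⟩
    omega
  rcases le_or_gt b m with hbm | hbm
  · obtain ⟨M, hM, hMc⟩ := exists_isSchurMatching_shift (P := {y ∈ S | y + b ∈ S})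
      (fun h => by have := hle 0 h; omega) hb (by
        intro y hy
        obtain ⟨hyS, hyb⟩ := mem_filter.1 hy
        refine ⟨hSA hyS, fun h => ?_, hSA hyb⟩
        exact Nat.not_even_iff_odd.2 (hodd y hyS) (h ▸ hbe))
    have h1 := card_shift_inter (S := S) (b := b)
    have h2 : ∀ x ∈ S ∪ S.image (· + b), Odd x ∧ x ≤ 2 * m + 1 + b := by
      intro x hx
      rcases mem_union.1 hx with hx | hx
      · have := hle x (hSA hx)
        exact ⟨hodd x hx, by omega⟩
      · obtain ⟨y, hy, rfl⟩ := mem_image.1 hx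
        have := hle y (hSA hy)
        exact ⟨(hodd y hy).add_even hbe, by omega⟩
    have h3 := two_mul_card_le_of_odd h2
    exact hM.numRSF_lt hr hb hAc (by omega)
  · let T := {y ∈ S | y < b}
    have hT : ∀ y ∈ T, y ∈ S ∧ y < b := fun y hy => mem_filter.1 hy
    have hrefl : Set.InjOn (b - ·) (T : Set ℕ) := by
      intro y hy z hz h
      have := hT y hy
      have := hT z hz
      simp only at h
      omega
    obtain ⟨M, hM, hMc⟩ := exists_isSchurMatching_reflect (A := A) (b := b)
      (P := {y ∈ T | b - y ∈ T}) (by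
        intro y hy
        obtain ⟨hy, hyb⟩ := mem_filter.1 hy
        obtain ⟨hyS, hlt⟩ := hT y hy
        have := hle y (hSA hyS)
        refine ⟨hSA hyS, by omega, hlt, mem_filter.2 ⟨hyb, ?_⟩⟩
        rwa [Nat.sub_sub_self hlt.le])
    have h1 : #(T.image (b - ·)) = #T := card_image_of_injOn hrefl
    have h2 : T ∩ T.image (b - ·) ⊆ {y ∈ T | b - y ∈ T} := by
      intro x hx
      obtain ⟨hx, hx'⟩ := mem_inter.1 hx
      obtain ⟨y, hy, rfl⟩ := mem_image.1 hx'
      refine mem_filter.2 ⟨hx, ?_⟩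
      rwa [Nat.sub_sub_self (hT y hy).2.le]
    have h3 : ∀ x ∈ T ∪ T.image (b - ·), Odd x ∧ x ≤ b := by
      intro x hx
      rcases mem_union.1 hx with hx | hx
      · exact ⟨hodd x (hT x hx).1, (hT x hx).2.le⟩
      · obtain ⟨y, hy, rfl⟩ := mem_image.1 hx
        obtain ⟨hyS, hlt⟩ := hT y hy
        exact ⟨Nat.Even.sub_odd hlt.le hbe (hodd y hyS), Nat.sub_le _ _⟩
    have h4 := two_mul_card_le_of_odd h3
    have h5 := card_union_add_card_inter T (T.image (b - ·))
    have h6 := card_le_card h2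
    have h7 : #S ≤ #T + #{y ∈ S | ¬ y < b} := (card_filter_add_card_filter_not _).ge
    have h8 : 2 * #(({y ∈ S | ¬ y < b}).image (· - b)) ≤ 2 * m + 1 - b + 1 := by
      refine two_mul_card_le_of_odd fun x hx => ?_
      obtain ⟨y, hy, rfl⟩ := mem_image.1 hx
      obtain ⟨hyS, hyb⟩ := mem_filter.1 hy
      have := hle y (hSA hyS)
      exact ⟨Nat.Odd.sub_even (not_lt.1 hyb) (hodd y hyS) hbe, by omega⟩
    have h9 : #(({y ∈ S | ¬ y < b}).image (· - b)) = #{y ∈ S | ¬ y < b} := by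
      refine card_image_of_injOn fun y hy z hz h => ?_
      have := (mem_filter.1 hy).2
      have := (mem_filter.1 hz).2
      omega
    have := hle b hb
    exact hM.numRSF_lt hr hb hAc (by omega)

/-- The main bound in terms of natural numbers, for `n = 2 * m + 1`. -/
lemma numRSF_bound {r : ℕ} (hr : 8 ≤ r) : ∃ n₀ : ℕ, ∀ m : ℕ, n₀ ≤ m →
    ∀ A ⊆ Icc 1 (2 * m + 1), m + 2 ≤ #A →
      numRSF r A ≤ r ^ m * (3 * r - 2) ∧
        (A ≠ Icc m (2 * m + 1) → numRSF r A < r ^ m * (3 * r - 2)) := by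
  have : NeZero r := ⟨by omega⟩
  obtain ⟨n₁, hn₁⟩ := exists_sumFree_core hr (by norm_num : (0 : ℝ) < 1 / 1000)
  refine ⟨max n₁ 10000, fun m hm A hA hAc => ?_⟩
  have hm1 : n₁ ≤ m := (le_max_left _ _).trans hm
  have hm2 : 10000 ≤ m := (le_max_right _ _).trans hm
  obtain ⟨s, hs⟩ := Nat.exists_eq_add_of_le (by omega : m + 1 ≤ #A)
  have hle : ∀ x ∈ A, 1 ≤ x ∧ x ≤ 2 * m + 1 := fun x hx => mem_Icc.1 (hA hx)
  have hne : A.Nonempty := by rw [← card_pos]; omega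
  set a := A.min' hne
  have haA : a ∈ A := min'_mem _ _
  have hAa : A ⊆ Icc a (2 * m + 1) := fun x hx => mem_Icc.2 ⟨min'_le _ _ hx, (hle x hx).2⟩
  have hAa' := card_le_card hAa
  rw [Nat.card_Icc] at hAa'
  have ha0 := (hle a haA).1
  rcases le_or_gt (2 * m + 1) (3 * a) with h3a | h3a
  · obtain ⟨M, hM, hMc⟩ := exists_isSchurMatching_min hAa ha0 (by omega) h3a
    rcases le_or_gt (2 * s) #M with hs2 | hs2
    · have := hM.numRSF_lt hr haA hs hs2
      exact ⟨this.le, fun _ => this⟩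
    rcases le_or_gt 2 s with hs3 | hs3
    · have := hM.numRSF_lt_of_two_le hr haA hs hs3 (by omega)
      exact ⟨this.le, fun _ => this⟩
    obtain rfl : s = 1 := by omega
    refine ⟨?_, fun h => absurd ?_ h⟩
    · have h1 := (hM.numRSF_le (r := r) haA (by omega : 1 ≤ #M)).2
      rw [hs] at h1
      simpa using h1
    · have ham : a = m := by omega
      rw [ham] at hAa
      refine eq_of_subset_of_card_le hAa ?_
      rw [Nat.card_Icc]
      omega
  · suffices h : numRSF r A < r ^ m * (3 * r - 2) from ⟨h.le, fun _ => h⟩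
    rcases lt_or_ge (numRSF r A) (r ^ m) with hlt | hge
    · exact hlt.trans_le (Nat.le_mul_of_pos_right _ (by omega))
    obtain ⟨S, hSA, hsf, hS, hAS⟩ := hn₁ (2 * m + 1) (by omega) A hA (by
      rwa [show (2 * m + 1) / 2 = m by omega])
    have hS' : 499 * (2 * m + 1) ≤ 1000 * #S := by
      have : (499 : ℝ) * (2 * m + 1 : ℕ) ≤ 1000 * #S := by linarith
      exact_mod_cast this
    have hAS' : 1000 * #A ≤ 1000 * #S + (2 * m + 1) := by
      have : (1000 : ℝ) * #A ≤ 1000 * #S + (2 * m + 1 : ℕ) := by linarith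
      exact_mod_cast this
    rcases sumFree_odd_or_large (hSA.trans hA) hsf (by omega) with hodd | hlarge
    · exact numRSF_lt_of_core_odd hr hA hSA hs (by omega) hm2 hS' hAS' hodd
    · exact numRSF_lt_of_core_large hr hA hSA haA h3a.le hs hm2 hS' hAS' hlarge

theorem stmt_7 (r : ℕ) (hr : 8 ≤ r) :
    ∃ n₀ : ℕ, ∀ n : ℕ, n₀ < n → Odd n → ∀ A ⊆ Finset.Icc 1 n,
      (n + 1) / 2 + 1 ≤ A.card →
      (numRSF r A : ℝ) ≤ (r : ℝ) ^ ((n + 1) / 2) * (3 - 2 / (r : ℝ)) ∧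
      ((numRSF r A : ℝ) = (r : ℝ) ^ ((n + 1) / 2) * (3 - 2 / (r : ℝ)) ↔
        A = Finset.Icc ((n - 1) / 2) n) := by
  obtain ⟨n₀, hn₀⟩ := numRSF_bound hr
  refine ⟨2 * n₀ + 1, fun n hn hodd A hA hAc => ?_⟩
  obtain ⟨m, rfl⟩ := hodd
  have e1 : (2 * m + 1 + 1) / 2 = m + 1 := by omega
  have e2 : (2 * m + 1 - 1) / 2 = m := by omega
  rw [e1] at hAc
  rw [e1, e2]
  have hr0 : (r : ℝ) ≠ 0 := by
    have : 0 < r := by omega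
    positivity
  have hbound : (r : ℝ) ^ (m + 1) * (3 - 2 / (r : ℝ)) = ((r ^ m * (3 * r - 2) : ℕ) : ℝ) := by
    rw [Nat.cast_mul, Nat.cast_sub (by omega)]
    push_cast
    rw [pow_succ]
    field_simp
  obtain ⟨h1, h2⟩ := hn₀ m (by omega) A hA hAc
  rw [hbound, Nat.cast_le, Nat.cast_inj]
  refine ⟨h1, fun h => ?_, fun h => h1.antisymm ?_⟩
  · by_contra hne
    exact (h2 hne).ne h
  · rw [h]
    exact le_numRSF_Icc (by omega)
end

section
/- Let A ⊆ [n] with |A| > ⌈n/2⌉. Then the number of restricted Schur triples of A satisfies s(A) ≥ (|A| - ⌈n/2⌉)(|A| - ⌊n/2⌋) - |A|/2. Moreover, s([n]) = (n² - 2n)/4 if n is even, and s([n]) = (n² - 2n + 1)/4 if n is odd. -/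
open Finset

/-- The set of restricted Schur triples of `A`: ordered triples `(a, b, c)` of
elements of `A` with `a < b < c` and `a + b = c`. -/
def restrictedSchurTriples (A : Finset ℕ) : Finset (ℕ × ℕ × ℕ) :=
  (A ×ˢ A ×ˢ A).filter
    (fun t => t.1 < t.2.1 ∧ t.2.1 < t.2.2 ∧ t.1 + t.2.1 = t.2.2)

/-- `s(A)`: the number of restricted Schur triples of `A`. -/
def numST (A : Finset ℕ) : ℕ := (restrictedSchurTriples A).card

theorem numST_insert {n : ℕ} {A : Finset ℕ} (hA : A ⊆ Finset.Icc 1 n) :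
    numST (insert (n + 1) A) =
      numST A + (A.filter fun a => n + 1 - a ∈ A ∧ a < n + 1 - a).card := by
  have hA' : ∀ a ∈ A, 1 ≤ a ∧ a ≤ n := fun a ha => Finset.mem_Icc.1 (hA ha)
  have hsplit : restrictedSchurTriples (insert (n + 1) A) = restrictedSchurTriples A ∪
      (A.filter fun a => n + 1 - a ∈ A ∧ a < n + 1 - a).image
        fun a => (a, n + 1 - a, n + 1) := by
    ext ⟨a, b, c⟩
    simp only [restrictedSchurTriples, mem_filter, mem_product, mem_insert, mem_union,
      mem_image, Prod.mk.injEq]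
    constructor
    · rintro ⟨⟨ha, hb, hc⟩, hab, hbc, habc⟩
      have hc' : c ≤ n + 1 := by
        rcases hc with rfl | hc
        · exact le_rfl
        · have := hA' c hc; omega
      have ha : a ∈ A := ha.resolve_left (by omega)
      have hb : b ∈ A := hb.resolve_left (by omega)
      rcases hc with rfl | hc
      · have hb' : n + 1 - a = b := by omega
        exact Or.inr ⟨a, ⟨ha, hb'.symm ▸ hb, by omega⟩, rfl, hb', rfl⟩
      · exact Or.inl ⟨⟨ha, hb, hc⟩, hab, hbc, habc⟩
    · rintro (⟨⟨ha, hb, hc⟩, h⟩ | ⟨x, ⟨hx, hy, hxy⟩, rfl, rfl, rfl⟩)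
      · exact ⟨⟨Or.inr ha, Or.inr hb, Or.inr hc⟩, h⟩
      · have := hA' x hx
        exact ⟨⟨Or.inr hx, Or.inr hy, Or.inl rfl⟩, hxy, by omega, by omega⟩
  rw [numST, hsplit, card_union_of_disjoint, card_image_of_injective]
  · rfl
  · intro a b h
    exact (Prod.mk.inj h).1
  · rw [Finset.disjoint_left]
    rintro ⟨a, b, c⟩ h h'
    simp only [restrictedSchurTriples, mem_filter, mem_product, mem_image,
      Prod.mk.injEq] at h h'
    obtain ⟨x, -, -, -, rfl⟩ := h'
    have := hA' _ h.1.2.2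
    omega

theorem card_le_card_pairs_add {n : ℕ} {A : Finset ℕ} (hA : A ⊆ Finset.Icc 1 n) :
    A.card ≤ (A.filter fun a => n + 1 - a ∈ A ∧ a < n + 1 - a).card + (n + 1) / 2 := by
  have hA' : ∀ a ∈ A, 1 ≤ a ∧ a ≤ n := fun a ha => Finset.mem_Icc.1 (hA ha)
  rw [← card_filter_add_card_filter_not (s := A) (fun a => n + 1 - a ∈ A ∧ a < n + 1 - a)]
  refine Nat.add_le_add_left ?_ _
  have h : (A.filter fun a => ¬(n + 1 - a ∈ A ∧ a < n + 1 - a)).card ≤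
      (Finset.Icc 1 ((n + 1) / 2)).card := by
    refine card_le_card_of_injOn (fun a => min a (n + 1 - a)) ?_ ?_
    · intro a ha
      have := hA' a (mem_filter.1 ha).1
      simp only [coe_Icc, Set.mem_Icc]
      omega
    · intro a ha b hb hab
      obtain ⟨ha, ha'⟩ := mem_filter.1 ha
      obtain ⟨hb, hb'⟩ := mem_filter.1 hb
      have h1 := hA' a ha
      have h2 := hA' b hb
      by_contra hne
      have hab' : b = n + 1 - a := by
        dsimp only at hab
        omega
      have hba' : a = n + 1 - b := by omega
      rw [← hab'] at ha'
      rw [← hba'] at hb'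
      have h3 : ¬ a < b := fun h => ha' ⟨hb, h⟩
      have h4 : ¬ b < a := fun h => hb' ⟨ha, h⟩
      omega
  simpa using h

theorem half_mul_half_succ (r : ℕ) :
    (r + 1) / 2 * (r / 2) = r / 2 * ((r - 1) / 2) + r / 2 := by
  rcases Nat.even_or_odd' r with ⟨k, rfl | rfl⟩
  · rcases k with _ | k
    · rfl
    · rw [show (2 * (k + 1) + 1) / 2 = k + 1 by omega, show 2 * (k + 1) / 2 = k + 1 by omega,
        show (2 * (k + 1) - 1) / 2 = k by omega]
      ring
  · rw [show (2 * k + 1 + 1) / 2 = k + 1 by omega, show (2 * k + 1) / 2 = k by omega,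
      show (2 * k + 1 - 1) / 2 = k by omega]
    ring

theorem half_mul_half_le_numST (n : ℕ) (A : Finset ℕ) (hA : A ⊆ Finset.Icc 1 n) :
    (2 * A.card - n) / 2 * ((2 * A.card - n - 1) / 2) ≤ numST A := by
  induction n generalizing A with
  | zero =>
    have : A = ∅ := by simpa using hA
    simp [this]
  | succ n ih =>
    by_cases hn : n + 1 ∈ A
    · have hB : A.erase (n + 1) ⊆ Finset.Icc 1 n := by
        intro a ha
        have h1 := Finset.mem_Icc.1 (hA (mem_of_mem_erase ha))
        have h2 := ne_of_mem_erase ha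
        exact Finset.mem_Icc.2 ⟨h1.1, by omega⟩
      have hc := card_erase_add_one hn
      rw [← insert_erase hn, numST_insert hB, insert_erase hn]
      have h1 := ih _ hB
      have h2 := card_le_card_pairs_add hB
      set B := A.erase (n + 1)
      rcases Nat.lt_or_ge (2 * A.card) (n + 2) with h | h
      · rw [show (2 * A.card - (n + 1)) / 2 = 0 by omega, zero_mul]
        exact Nat.zero_le _
      · have h3 := half_mul_half_succ (2 * B.card - n)
        rw [show 2 * A.card - (n + 1) = 2 * B.card - n + 1 by omega, Nat.add_sub_cancel, h3]
        omega
    · have hB : A ⊆ Finset.Icc 1 n := by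
        intro a ha
        have h1 := Finset.mem_Icc.1 (hA ha)
        have h2 : a ≠ n + 1 := fun h => hn (h ▸ ha)
        exact Finset.mem_Icc.2 ⟨h1.1, by omega⟩
      exact (Nat.mul_le_mul (by omega) (by omega)).trans (ih A hB)

theorem numST_Icc (n : ℕ) : numST (Finset.Icc 1 n) = n / 2 * ((n - 1) / 2) := by
  induction n with
  | zero => rfl
  | succ n ih =>
    have h : (Finset.Icc 1 n).filter (fun a => n + 1 - a ∈ Finset.Icc 1 n ∧ a < n + 1 - a) =
        Finset.Icc 1 (n / 2) := by
      ext a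
      simp only [mem_filter, Finset.mem_Icc]
      omega
    rw [← Finset.insert_Icc_right_eq_Icc_add_one (by omega),
      numST_insert Subset.rfl, ih, h, Nat.card_Icc, Nat.add_sub_cancel,
      Nat.add_sub_cancel, half_mul_half_succ]

theorem stmt_8 (n : ℕ) (A : Finset ℕ) (hA : A ⊆ Finset.Icc 1 n)
    (hcard : (n + 1) / 2 < A.card) :
    ((A.card : ℝ) - (((n + 1) / 2 : ℕ) : ℝ)) * ((A.card : ℝ) - ((n / 2 : ℕ) : ℝ))
        - (A.card : ℝ) / 2 ≤ (numST A : ℝ) ∧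
    (Even n → numST (Finset.Icc 1 n) = (n ^ 2 - 2 * n) / 4) ∧
    (Odd n → numST (Finset.Icc 1 n) = (n ^ 2 - 2 * n + 1) / 4) := by
  refine ⟨?_, ?_, ?_⟩
  · have h := half_mul_half_le_numST n A hA
    have hle : A.card ≤ n := by simpa using card_le_card hA
    obtain ⟨r, hr⟩ : ∃ r, 2 * A.card = n + r := ⟨2 * A.card - n, by omega⟩
    rw [show 2 * A.card - n = r by omega] at h
    have hrR : 2 * (A.card : ℝ) = n + r := by exact_mod_cast hr
    have hleR : (A.card : ℝ) ≤ n := by exact_mod_cast hle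
    have hsum : (((n + 1) / 2 : ℕ) : ℝ) + ((n / 2 : ℕ) : ℝ) = n := by
      exact_mod_cast (by omega : (n + 1) / 2 + n / 2 = n)
    have hq : (r : ℝ) ^ 2 - 2 * r ≤ 4 * numST A := by
      have h' : (((r / 2 : ℕ) : ℝ)) * (((r - 1) / 2 : ℕ) : ℝ) ≤ numST A := by exact_mod_cast h
      rcases Nat.even_or_odd' r with ⟨k, rfl | rfl⟩
      · rcases k with _ | k
        · simp
        · rw [show 2 * (k + 1) / 2 = k + 1 by omega,
            show (2 * (k + 1) - 1) / 2 = k by omega] at h'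
          push_cast at h' ⊢
          nlinarith
      · rw [show (2 * k + 1) / 2 = k by omega, show (2 * k + 1 - 1) / 2 = k by omega] at h'
        push_cast at h' ⊢
        nlinarith
    nlinarith [sq_nonneg ((((n + 1) / 2 : ℕ) : ℝ) - ((n / 2 : ℕ) : ℝ))]
  · rintro ⟨k, rfl⟩
    rw [numST_Icc]
    rcases k with _ | k
    · rfl
    · rw [show (k + 1 + (k + 1)) / 2 = k + 1 by omega,
        show (k + 1 + (k + 1) - 1) / 2 = k by omega,
        show (k + 1 + (k + 1)) ^ 2 = 4 * ((k + 1) * k) + 2 * (k + 1 + (k + 1)) by ring]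
      omega
  · rintro ⟨k, rfl⟩
    rw [numST_Icc, show (2 * k + 1) / 2 = k by omega, show (2 * k + 1 - 1) / 2 = k by omega]
    rcases k with _ | k
    · rfl
    · rw [show (2 * (k + 1) + 1) ^ 2 = 4 * ((k + 1) * (k + 1)) - 1 + 2 * (2 * (k + 1) + 1) by
        have : (2 * (k + 1) + 1) ^ 2 + 1 = 4 * ((k + 1) * (k + 1)) + 2 * (2 * (k + 1) + 1) := by
          ring
        have : 0 < (k + 1) * (k + 1) := by positivity
        omega]
      have : 0 < (k + 1) * (k + 1) := by positivity
      omega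
end
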